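/- Let 𝔤 be a finite-dimensional complex simple Lie algebra of one of the exceptional types E6, E7, E8, F4 or G2, and let (e,h,f) be an sl2-triple in 𝔤 such that e is a distinguished nilpotent element which is not regular. Then e satisfies property (P). -/

import Mathlib

open scoped ComplexOrder

/-- The centralizer `𝔤^e = {x ∈ 𝔤 : ⁅x, e⁆ = 0}` of an element `e`, as a Lie subalgebra. -/
def centralizer (L : Type*) [LieRing L] [LieAlgebra ℂ L] (e : L) : LieSubalgebra ℂ L where
  carrier := {x : L | ⁅x, e⁆ = 0}
  add_mem' := fun {a b} ha hb => by
    simp only [Set.mem_setOf_eq] at *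
    rw [add_lie, ha, hb, add_zero]
  zero_mem' := by simp
  smul_mem' := fun c a ha => by
    simp only [Set.mem_setOf_eq] at *
    rw [smul_lie, ha, smul_zero]
  lie_mem' := fun {a b} ha hb => by
    simp only [Set.mem_setOf_eq] at *
    simp [lie_lie, ha, hb]

/-- Membership in the centre `𝔷(𝔤^e)` of the centralizer of `e`:
`v` centralizes `e` and commutes with every element of `𝔤^e`. -/
def InCenterOfCentralizer (L : Type*) [LieRing L] [LieAlgebra ℂ L] (e v : L) : Prop :=
  ⁅v, e⁆ = 0 ∧ ∀ y : L, ⁅y, e⁆ = 0 → ⁅v, y⁆ = 0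

/-- The centre `𝔷(𝔤^e)` of the centralizer of `e`, as a subspace of `L`. -/
def zCenter (L : Type*) [LieRing L] [LieAlgebra ℂ L] (e : L) : Submodule ℂ L where
  carrier := {v : L | ⁅v, e⁆ = 0 ∧ ∀ y : L, ⁅y, e⁆ = 0 → ⁅v, y⁆ = 0}
  add_mem' := fun {a b} ha hb => ⟨by rw [add_lie, ha.1, hb.1, add_zero],
    fun y hy => by rw [add_lie, ha.2 y hy, hb.2 y hy, add_zero]⟩
  zero_mem' := ⟨zero_lie e, fun y _ => zero_lie y⟩
  smul_mem' := fun c a ha => ⟨by rw [smul_lie, ha.1, smul_zero],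
    fun y hy => by rw [smul_lie, ha.2 y hy, smul_zero]⟩

/-- Property (P) for an `sl₂`-triple `(e, h, f)`: for every nonzero `v ∈ 𝔷(𝔤^e)`, the
eigenspace `𝔷_max` of the restriction of `ad h` to `𝔷(𝔤^e)` for its largest eigenvalue is
contained in `[[f, 𝔤^e], v] = {⁅⁅f, x⁆, v⁆ : x ∈ 𝔤^e}`. -/
def PropertyP (L : Type*) [LieRing L] [LieAlgebra ℂ L] (e h f : L) : Prop :=
  ∀ m : ℂ,
    (∃ z : L, z ≠ 0 ∧ InCenterOfCentralizer L e z ∧ ⁅h, z⁆ = m • z) →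
    (∀ m' : ℂ, (∃ z : L, z ≠ 0 ∧ InCenterOfCentralizer L e z ∧ ⁅h, z⁆ = m' • z) → m' ≤ m) →
    ∀ v : L, InCenterOfCentralizer L e v → v ≠ 0 →
      ∀ z : L, InCenterOfCentralizer L e z → ⁅h, z⁆ = m • z →
        ∃ x : L, ⁅x, e⁆ = 0 ∧ ⁅⁅f, x⁆, v⁆ = z

/-- The stabilizer `{x ∈ 𝔮 : ξ(⁅x, y⁆) = 0 for all y ∈ 𝔮}` of a linear functional `ξ`. -/
def coadStab (Q : Type*) [LieRing Q] [LieAlgebra ℂ Q] (ξ : Module.Dual ℂ Q) : Submodule ℂ Q where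
  carrier := {x : Q | ∀ y : Q, ξ ⁅x, y⁆ = 0}
  add_mem' := fun {a b} ha hb y => by rw [add_lie, map_add, ha y, hb y, add_zero]
  zero_mem' := fun y => by rw [zero_lie, map_zero]
  smul_mem' := fun c a ha y => by rw [smul_lie, map_smul, ha y, smul_zero]

/-- The index of a complex Lie algebra:
`ind 𝔮 = min_{ξ ∈ 𝔮*} dim {x ∈ 𝔮 : ξ(⁅x, y⁆) = 0 for all y ∈ 𝔮}`. -/
noncomputable def lieIndex (Q : Type*) [LieRing Q] [LieAlgebra ℂ Q] : ℕ :=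
  ⨅ ξ : Module.Dual ℂ Q, Module.finrank ℂ ↥(coadStab Q ξ)

/-- A nilpotent element `e` is distinguished if the only `x ∈ 𝔤^e` such that `ad x` is a
semisimple endomorphism of `𝔤` is `x = 0`. -/
def IsDistinguished (L : Type*) [LieRing L] [LieAlgebra ℂ L] (e : L) : Prop :=
  ∀ x : L, ⁅x, e⁆ = 0 → (LieAlgebra.ad ℂ L x).IsSemisimple → x = 0

section
open Module LieAlgebra

section Jordan
variable {L : Type*} [LieRing L] [LieAlgebra ℂ L] [FiniteDimensional ℂ L]

/-- The semisimple part of `ad x` is again inner. -/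
theorem exists_semisimple_part [LieAlgebra.IsKilling ℂ L] (x : L) :
    ∃ s : L, (ad ℂ L s).IsSemisimple ∧ IsNilpotent (ad ℂ L (x - s)) ∧
      ∀ (μ : ℂ) (y : L), ⁅x, y⁆ = μ • y → ⁅s, y⁆ = μ • y := by
  obtain ⟨N, -, S, hS₀, hN, hS, hSN⟩ := (ad ℂ L x).exists_isNilpotent_isSemisimple
  replace hS₀ : Commute (ad ℂ L x) S := Algebra.commute_of_mem_adjoin_self hS₀
  have hN' := hN
  rw [eq_sub_of_add_eq hSN.symm] at hN
  have aux {μ : ℂ} {y : L} (hy : y ∈ (ad ℂ L x).maxGenEigenspace μ) : S y = μ • y :=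
    Module.End.apply_eq_of_mem_of_comm_of_isFinitelySemisimple_of_isNil hy hS₀
      hS.isFinitelySemisimple hN
  have htop (y : L) : y ∈ ⨆ μ : ℂ, (ad ℂ L x).maxGenEigenspace μ := by
    simp [Module.End.iSup_maxGenEigenspace_eq_top]
  have h_der (y z : L) : S ⁅y, z⁆ = ⁅S y, z⁆ + ⁅y, S z⁆ := by
    induction htop y using Submodule.iSup_induction' with
    | mem μ y hy =>
      induction htop z using Submodule.iSup_induction' with
      | mem ν z hz =>
        rw [aux hy, aux hz, aux (LieModule.lie_mem_maxGenEigenspace_toEnd hy hz), smul_lie,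
          lie_smul,
          ← add_smul]
      | zero => simp
      | add _ _ _ _ h h' => simp only [lie_add, map_add, h, h']; abel
    | zero => simp
    | add _ _ _ _ h h' => simp only [add_lie, map_add, h, h']; abel
  replace h_der : ∀ y z : L, S ⁅y, z⁆ = ⁅y, S z⁆ - ⁅z, S y⁆ := by
    simp_rw [← lie_skew (S _) _, add_comm, ← sub_eq_add_neg] at h_der; assumption
  let S' : LieDerivation ℂ L L := ⟨S, h_der⟩
  obtain ⟨s, hs⟩ := LieDerivation.IsKilling.exists_eq_ad S'
  have hs' : ad ℂ L s = S := by
    ext y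
    have := congrArg (fun D : LieDerivation ℂ L L => D y) hs
    simp only [LieDerivation.ad_apply_apply] at this
    exact this
  refine ⟨s, hs' ▸ hS, ?_, fun μ y hy => ?_⟩
  · rw [map_sub, hs']; exact hN
  · have : S y = μ • y := aux (Module.End.mem_maxGenEigenspace _ _ _ |>.2 ⟨1, by simp [hy]⟩)
    rw [← this, ← hs', ad_apply]

end Jordan

section Sl2
variable {L V : Type*} [LieRing L] [LieAlgebra ℂ L] [AddCommGroup V] [Module ℂ V]
  [LieRingModule L V] [LieModule ℂ L V] {h e f : L}

/-- An eigenvector of `h` can be raised to a primitive vector. -/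
theorem exists_primitive_of_eigenvector [FiniteDimensional ℂ V] (ht : IsSl2Triple h e f) {p :
    Submodule ℂ V}
    (hpe : ∀ v ∈ p, ⁅e, v⁆ ∈ p) {v : V} (hv : v ∈ p) (hv0 : v ≠ 0) {μ : ℂ}
    (hμ : ⁅h, v⁆ = μ • v) :
    ∃ j : ℕ, ∃ w ∈ p, ht.HasPrimitiveVectorWith w (μ + 2 * j) := by
  have hw (n : ℕ) : ⁅h, ((LieModule.toEnd ℂ L V e) ^ n) v⁆
      = (μ + 2 * n) • ((LieModule.toEnd ℂ L V e) ^ n) v := by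
    induction n with
    | zero => simpa using hμ
    | succ n ih =>
      rw [pow_succ', Module.End.mul_apply, LieModule.toEnd_apply_apply, leibniz_lie h,
        ht.lie_h_e_smul ℂ, ih, lie_smul, smul_lie, ← add_smul]
      congr 1; push_cast; ring
  have hmem (n : ℕ) : ((LieModule.toEnd ℂ L V e) ^ n) v ∈ p := by
    induction n with
    | zero => simpa using hv
    | succ n ih => rw [pow_succ', Module.End.mul_apply]; exact hpe _ ih
  have hex : ∃ n : ℕ, ((LieModule.toEnd ℂ L V e) ^ n) v = 0 := by
    by_contra! hne
    have hinf : (Set.range fun n : ℕ => μ + 2 * (n : ℂ)).Infinite :=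
      Set.infinite_range_of_injective fun a b hab => by simpa using hab
    refine hinf ((LieModule.toEnd ℂ L V h).finite_hasEigenvalue.subset ?_)
    rintro _ ⟨n, rfl⟩
    exact Module.End.hasEigenvalue_of_hasEigenvector
      ⟨Module.End.mem_eigenspace_iff.2 (hw n), hne n⟩
  obtain ⟨n, h1, h2⟩ := Nat.exists_not_and_succ_of_not_zero_of_exists
    (p := fun n => ((LieModule.toEnd ℂ L V e) ^ n) v = 0) (by simpa using hv0) hex
  refine ⟨n, _, hmem n, h1, hw n, ?_⟩
  rwa [pow_succ', Module.End.mul_apply, LieModule.toEnd_apply_apply] at h2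

/-- The Casimir operator of an `sl₂`-triple acting on a module. -/
noncomputable def casimir (V : Type*) [AddCommGroup V] [Module ℂ V]
    [LieRingModule L V] [LieModule ℂ L V] (h e f : L) : Module.End ℂ V :=
  (4 : ℂ) • (LieModule.toEnd ℂ L V f * LieModule.toEnd ℂ L V e) +
    LieModule.toEnd ℂ L V h * LieModule.toEnd ℂ L V h + (2 : ℂ) • LieModule.toEnd ℂ L V h

theorem casimir_apply (v : V) : casimir V h e f v =
    (4 : ℂ) • ⁅f, ⁅e, v⁆⁆ + ⁅h, ⁅h, v⁆⁆ + (2 : ℂ) • ⁅h, v⁆ := rfl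

theorem casimir_lie_e (ht : IsSl2Triple h e f) (v : V) :
    casimir V h e f ⁅e, v⁆ = ⁅e, casimir V h e f v⁆ := by
  have hf (w : V) : ⁅f, ⁅e, w⁆⁆ = ⁅e, ⁅f, w⁆⁆ - ⁅h, w⁆ := by
    rw [← ht.lie_e_f, lie_lie]; abel
  have hh (w : V) : ⁅h, ⁅e, w⁆⁆ = ⁅e, ⁅h, w⁆⁆ + (2 : ℂ) • ⁅e, w⁆ := by
    rw [leibniz_lie h e, ht.lie_h_e_smul ℂ, smul_lie]; abel
  simp only [casimir_apply, hf, hh, lie_add, lie_sub, lie_smul]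
  module

theorem casimir_lie_f (ht : IsSl2Triple h e f) (v : V) :
    casimir V h e f ⁅f, v⁆ = ⁅f, casimir V h e f v⁆ := by
  have hf (w : V) : ⁅e, ⁅f, w⁆⁆ = ⁅f, ⁅e, w⁆⁆ + ⁅h, w⁆ := by
    rw [← ht.lie_e_f, lie_lie]; abel
  have hh (w : V) : ⁅h, ⁅f, w⁆⁆ = ⁅f, ⁅h, w⁆⁆ - (2 : ℂ) • ⁅f, w⁆ := by
    rw [leibniz_lie h f, ht.lie_lie_smul_f ℂ, neg_lie, smul_lie]; abel
  simp only [casimir_apply, hf, hh, lie_add, lie_sub, lie_smul]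
  module

theorem casimir_symm (ht : IsSl2Triple h e f) : casimir V (-h) f e = casimir V h e f := by
  ext v
  have : ⁅e, ⁅f, v⁆⁆ = ⁅f, ⁅e, v⁆⁆ + ⁅h, v⁆ := by rw [← ht.lie_e_f, lie_lie]; abel
  simp only [casimir_apply, this, neg_lie, lie_neg]; module

/-- On a subspace stable under the triple on which the Casimir operator is nilpotent, the triple
acts trivially. -/
theorem lie_eq_zero_of_casimir_nilpotent [FiniteDimensional ℂ V] (ht : IsSl2Triple h e f) {p :
    Submodule ℂ V}
    (hpe : ∀ v ∈ p, ⁅e, v⁆ ∈ p) (hpf : ∀ v ∈ p, ⁅f, v⁆ ∈ p) {N : ℕ}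
    (hN : ∀ v ∈ p, (casimir V h e f ^ N) v = 0) : ∀ v ∈ p, ⁅e, v⁆ = 0 := by
  have hph : ∀ v ∈ p, ⁅h, v⁆ ∈ p := fun v hv => by
    rw [← ht.lie_e_f, lie_lie]; exact p.sub_mem (hpe _ (hpf _ hv)) (hpf _ (hpe _ hv))
  have hprim {h e f : L} (ht : IsSl2Triple h e f)
      (hN : ∀ v ∈ p, (casimir V h e f ^ N) v = 0) {w : V} (hw : w ∈ p) {μ : ℂ}
      (hP : ht.HasPrimitiveVectorWith w μ) : μ = 0 := by
    obtain ⟨n, rfl⟩ := hP.exists_nat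
    have h1 : casimir V h e f w = ((n : ℂ) * (n + 2)) • w := by
      rw [casimir_apply, hP.lie_e, hP.lie_h, lie_smul, hP.lie_h, lie_zero]; module
    have h2 : ∀ k : ℕ, (casimir V h e f ^ k) w = ((n : ℂ) * (n + 2)) ^ k • w := by
      intro k
      induction k with
      | zero => simp
      | succ k ih => rw [pow_succ', Module.End.mul_apply, ih, map_smul, h1, smul_smul, pow_succ]
    have h3 := hN w hw
    rw [h2] at h3
    have h4 := (smul_eq_zero.1 h3).resolve_right hP.ne_zero
    have h5 := eq_zero_of_pow_eq_zero h4
    have h6 : (n : ℂ) + 2 ≠ 0 := by exact_mod_cast (by omega : n + 2 ≠ 0)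
    exact (mul_eq_zero.1 h5).resolve_right h6
  have hev : ∀ v ∈ p, v ≠ 0 → ∀ μ : ℂ, ⁅h, v⁆ = μ • v → μ = 0 := by
    intro v hv hv0 μ hμ
    obtain ⟨j, w, hw, hP⟩ := exists_primitive_of_eigenvector ht hpe hv hv0 hμ
    obtain ⟨j', w', hw', hP'⟩ := exists_primitive_of_eigenvector ht.symm hpf hv hv0
      (μ := -μ) (by rw [neg_lie, hμ, neg_smul])
    have e1 := hprim ht hN hw hP
    have e2 := hprim ht.symm (by rwa [casimir_symm ht]) hw' hP'
    have : ((j + j' : ℕ) : ℂ) = 0 := by push_cast; linear_combination (e1 + e2) / 2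
    have : j = 0 := by have := Nat.cast_eq_zero.1 this; omega
    simpa [this] using e1
  -- `h` is nilpotent on `p`, so `e`, which raises generalised weights by `2`, kills `p`.
  obtain ⟨H, hHdef⟩ : ∃ H : Module.End ℂ p, ∀ w, (H w : V) = ⁅h, (w : V)⁆ :=
    ⟨(LieModule.toEnd ℂ L V h).restrict hph, fun _ => rfl⟩
  have hH : ∀ μ : ℂ, μ ≠ 0 → H.maxGenEigenspace μ = ⊥ := by
    intro μ hμ
    by_contra hne
    have : H.HasEigenvalue μ :=
      Module.End.HasUnifEigenvalue.lt (k := ⊤) one_pos hne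
    obtain ⟨v, hv⟩ := this.exists_hasEigenvector
    refine hμ (hev v v.2 (by simpa using hv.2) μ ?_)
    rw [← hHdef]; exact congrArg Subtype.val (hv.apply_eq_smul)
  have htop : H.maxGenEigenspace 0 = ⊤ := by
    rw [← Module.End.iSup_maxGenEigenspace_eq_top H]
    refine le_antisymm (le_iSup _ _) (iSup_le fun μ => ?_)
    by_cases hμ : μ = 0
    · rw [hμ]
    · rw [hH μ hμ]; exact bot_le
  intro v hv
  have hv0 : (⟨v, hv⟩ : p) ∈ H.maxGenEigenspace 0 := htop ▸ Submodule.mem_top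
  obtain ⟨k, hk⟩ := (Module.End.mem_maxGenEigenspace _ _ _).1 hv0
  rw [zero_smul, sub_zero] at hk
  let E : Module.End ℂ p := (LieModule.toEnd ℂ L V e).restrict hpe
  have hE (w : p) : (H - (2 : ℂ) • 1) (E w) = E (H w) := by
    refine Subtype.ext ?_
    change ((H (E w) : p) : V) - (2 : ℂ) • ⁅e, (w : V)⁆ = ⁅e, (H w : V)⁆
    rw [hHdef, hHdef]
    change ⁅h, ⁅e, (w : V)⁆⁆ - (2 : ℂ) • ⁅e, (w : V)⁆ = ⁅e, ⁅h, (w : V)⁆⁆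
    rw [leibniz_lie h e, ht.lie_h_e_smul ℂ, smul_lie]; abel
  have hEk (k : ℕ) (w : p) : ((H - (2 : ℂ) • 1) ^ k) (E w) = E ((H ^ k) w) := by
    induction k generalizing w with
    | zero => simp
    | succ k ih => rw [pow_succ, Module.End.mul_apply, hE, ih, pow_succ, Module.End.mul_apply]
  have hmem : E ⟨v, hv⟩ ∈ H.maxGenEigenspace 2 :=
    (Module.End.mem_maxGenEigenspace _ _ _).2 ⟨k, by rw [hEk, hk, map_zero]⟩
  rw [hH 2 two_ne_zero, Submodule.mem_bot] at hmem
  exact congrArg Subtype.val hmem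

end Sl2

end

section
open Module LieAlgebra

section Distinguished
variable {L : Type*} [LieRing L] [LieAlgebra ℂ L] [FiniteDimensional ℂ L] [LieAlgebra.IsKilling ℂ L]
  {h e f : L}

theorem isNilpotent_ad_of_lie_eq_zero
    (hdist : ∀ x : L, ⁅x, e⁆ = 0 → (ad ℂ L x).IsSemisimple → x = 0) {x : L} (hx : ⁅x, e⁆ = 0) :
    IsNilpotent (ad ℂ L x) := by
  obtain ⟨s, hs, hn, hev⟩ := exists_semisimple_part x
  have h0 : s = 0 := hdist s (by simpa using hev 0 e (by simpa using hx)) hs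
  simpa [h0] using hn

/-- No nonzero element commutes with an `sl₂`-triple whose nilpositive element is distinguished. -/
theorem eq_zero_of_lie_eq_zero (ht : IsSl2Triple h e f)
    (hdist : ∀ x : L, ⁅x, e⁆ = 0 → (ad ℂ L x).IsSemisimple → x = 0) {x : L}
    (hxe : ⁅e, x⁆ = 0) (hxf : ⁅f, x⁆ = 0) : x = 0 := by
  let S : LieSubalgebra ℂ L :=
    { carrier := {y | ⁅e, y⁆ = 0 ∧ ⁅f, y⁆ = 0}
      zero_mem' := by simp
      add_mem' := fun ha hb => ⟨by rw [lie_add, ha.1, hb.1, add_zero],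
        by rw [lie_add, ha.2, hb.2, add_zero]⟩
      smul_mem' := fun c y hy => ⟨by rw [lie_smul, hy.1, smul_zero],
        by rw [lie_smul, hy.2, smul_zero]⟩
      lie_mem' := fun {a b} ha hb => by
        simp only [Set.mem_ofPred_eq] at *
        simp [leibniz_lie e, leibniz_lie f, ha, hb] }
  have hnil : LieModule.IsNilpotent S L := by
    rw [LieModule.isNilpotent_iff_forall (R := ℂ)]
    intro y
    exact isNilpotent_ad_of_lie_eq_zero hdist (x := (y : L)) (by
      rw [← lie_skew, y.2.1, neg_zero])
  have hκ : ∀ y ∈ S, killingForm ℂ L x y = 0 := fun y hy => by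
    have := LieModule.traceForm_eq_zero_of_isNilpotent ℂ S L
    exact congrArg (fun φ : LinearMap.BilinForm ℂ S => φ ⟨x, hxe, hxf⟩ ⟨y, hy⟩) this
  have hinv (a y : L) (ha : ⁅a, x⁆ = 0) : killingForm ℂ L x ⁅a, y⁆ = 0 := by
    have := LieModule.traceForm_apply_lie_apply ℂ L L x a y
    rw [← this, ← lie_skew, ha]; simp
  have hhx : ⁅h, x⁆ = 0 := by rw [← ht.lie_e_f, lie_lie, hxe, hxf]; simp
  obtain ⟨N, hN⟩ := (casimir L h e f).eventually_isCompl_ker_pow_range_pow.exists_forall_of_atTop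
  have hcompl := hN (N + 1) (by omega)
  have hker : ∀ y ∈ LinearMap.ker (casimir L h e f ^ (N + 1)), y ∈ S := by
    have hpow (a : L) (hc : ∀ v, casimir L h e f ⁅a, v⁆ = ⁅a, casimir L h e f v⁆) :
        ∀ v ∈ LinearMap.ker (casimir L h e f ^ (N + 1)),
          ⁅a, v⁆ ∈ LinearMap.ker (casimir L h e f ^ (N + 1)) := fun v hv => by
      have hcomm : Commute (casimir L h e f) (ad ℂ L a) := LinearMap.ext hc
      have := congrArg (fun φ : Module.End ℂ L => φ v) (hcomm.pow_left (N + 1)).eq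
      simp only [Module.End.mul_apply, LinearMap.mem_ker, ad_apply] at *
      rw [this, hv, lie_zero]
    have hcas : casimir L (-h) f e = casimir L h e f := casimir_symm ht
    have h1 := hpow e (casimir_lie_e ht)
    have h2 := hpow f (casimir_lie_f ht)
    intro y hy
    exact ⟨lie_eq_zero_of_casimir_nilpotent ht h1 h2 (fun v hv => hv) y hy,
      lie_eq_zero_of_casimir_nilpotent ht.symm h2 h1
        (fun v hv => by rw [hcas]; exact hv) y hy⟩
  have hall : ∀ y, killingForm ℂ L x y = 0 := by
    intro y
    obtain ⟨y0, hy0, y1, hy1, rfl⟩ := Submodule.mem_sup.1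
      (hcompl.sup_eq_top ▸ Submodule.mem_top : y ∈ _ ⊔ _)
    obtain ⟨z, rfl⟩ := hy1
    rw [map_add, hκ y0 (hker y0 hy0), zero_add, pow_succ', Module.End.mul_apply, casimir_apply]
    simp [hinv f _ hxf, hinv h _ hhx]
  have : x ∈ LinearMap.ker (killingForm ℂ L) := LinearMap.ext hall
  simpa using this

theorem isSemisimple_ad_of_distinguished (ht : IsSl2Triple h e f)
    (hdist : ∀ x : L, ⁅x, e⁆ = 0 → (ad ℂ L x).IsSemisimple → x = 0) :
    (ad ℂ L h).IsSemisimple := by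
  obtain ⟨s, hs, -, hev⟩ := exists_semisimple_part h
  have h1 := hev 2 e (ht.lie_h_e_smul ℂ)
  have h2 := hev (-2) f (by rw [ht.lie_lie_smul_f ℂ, neg_smul])
  have : h - s = 0 := eq_zero_of_lie_eq_zero ht hdist
    (by rw [← lie_skew, sub_lie, h1, ht.lie_h_e_smul ℂ]; simp)
    (by rw [← lie_skew, sub_lie, h2, ht.lie_lie_smul_f ℂ]; simp)
  rwa [sub_eq_zero.1 this]

theorem eq_zero_of_lie_h_of_lie_e (ht : IsSl2Triple h e f)
    (hdist : ∀ x : L, ⁅x, e⁆ = 0 → (ad ℂ L x).IsSemisimple → x = 0) {x : L}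
    (hxh : ⁅h, x⁆ = 0) (hxe : ⁅e, x⁆ = 0) : x = 0 := by
  by_contra hx0
  have hP : ht.HasPrimitiveVectorWith x (0 : ℂ) := ⟨hx0, by simpa using hxh, hxe⟩
  have := hP.pow_toEnd_f_eq_zero_of_eq_nat (n := 0) (by simp)
  exact hx0 (eq_zero_of_lie_eq_zero ht hdist hxe (by simpa using this))

end Distinguished

end

section
open Module LieAlgebra Filter Topology

section Exponential
variable {V : Type*} [NormedAddCommGroup V] [NormedSpace ℂ V] [FiniteDimensional ℂ V]

/-- The exponential of a derivation of a bilinear product is multiplicative. -/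
theorem exp_derivation_apply (br : V →L[ℂ] V →L[ℂ] V) (D : V →L[ℂ] V)
    (hD : ∀ x y, D (br x y) = br (D x) y + br x (D y)) (x y : V) :
    NormedSpace.exp D (br x y) = br (NormedSpace.exp D x) (NormedSpace.exp D y) := by
  have : CompleteSpace V := FiniteDimensional.complete ℂ V
  have hd (z : V) (s : ℂ) : HasDerivAt (fun u : ℂ => NormedSpace.exp (u • D) z)
      (D (NormedSpace.exp (s • D) z)) s := by
    simpa using (hasDerivAt_exp_smul_const' (𝕂 := ℂ) D s).clm_apply (hasDerivAt_const s z)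
  have hneg (s : ℂ) : HasDerivAt (fun u : ℂ => NormedSpace.exp ((-u) • D))
      (-(NormedSpace.exp ((-s) • D) * D)) s := by
    have := (hasDerivAt_exp_smul_const (𝕂 := ℂ) (-D) s)
    simpa using this
  let g : ℂ → V := fun s => NormedSpace.exp ((-s) • D)
    (br (NormedSpace.exp (s • D) x) (NormedSpace.exp (s • D) y))
  have hg (s : ℂ) : HasDerivAt g 0 s := by
    have h1 := ((hasDerivAt_const s br).clm_apply (hd x s)).clm_apply (hd y s)
    have h2 := (hneg s).clm_apply h1
    refine h2.congr_deriv ?_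
    simp [hD]
  have hconst := is_const_of_deriv_eq_zero (fun s => (hg s).differentiableAt)
    (fun s => (hg s).deriv) 1 0
  let _ : NormedAlgebra ℚ (V →L[ℂ] V) := NormedAlgebra.restrictScalars ℚ ℂ _
  have hinv : NormedSpace.exp D * NormedSpace.exp (-D) = 1 := by
    rw [← NormedSpace.exp_add_of_commute ((Commute.refl D).neg_right), add_neg_cancel,
      NormedSpace.exp_zero]
  have h3 := congrArg (fun v => NormedSpace.exp D v) hconst
  have h4 (z : V) : NormedSpace.exp D (NormedSpace.exp (-D) z) = z :=
    congrArg (fun T : V →L[ℂ] V => T z) hinv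
  simpa [g, h4] using h3.symm

theorem exp_apply_of_cube_eq_zero (D : V →L[ℂ] V) {x : V} (hx : D (D (D x)) = 0) :
    NormedSpace.exp D x = x + D x + (2⁻¹ : ℂ) • D (D x) := by
  have : CompleteSpace V := FiniteDimensional.complete ℂ V
  have h0 (n : ℕ) (hn : n ∉ Finset.range 3) :
      ((n.factorial⁻¹ : ℂ) • D ^ n) x = 0 := by
    obtain ⟨k, rfl⟩ := Nat.exists_eq_add_of_le (not_lt.1 (mt Finset.mem_range.2 hn))
    have : (D ^ (3 + k)) x = 0 := by
      rw [add_comm, pow_add, pow_succ, pow_succ, pow_one]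
      change (D ^ k) (D (D (D x))) = 0
      rw [hx, map_zero]
    rw [smul_apply, this, smul_zero]
  have h1 := (NormedSpace.exp_series_hasSum_exp' (𝕂 := ℂ) D).mapL
    (ContinuousLinearMap.apply ℂ V x)
  refine (h1.tsum_eq.symm.trans (tsum_eq_sum h0)).trans ?_
  simp [Finset.sum_range_succ]

theorem eventually_exists_exp {U : Type*} [NormedAddCommGroup U] [NormedSpace ℂ U]
    [FiniteDimensional ℂ U] (i : U →ₗ[ℂ] V) (π : V →ₗ[ℂ] U) (hπ : ∀ u, π (i u) = u)
    (D : U →ₗ[ℂ] V →L[ℂ] V) (γ : U →ₗ[ℂ] V) (v₀ : V) (h : ∀ u, D u v₀ + γ u = i u) (u : U) :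
    ∀ᶠ t in 𝓝 (0 : ℂ), ∃ u' : U,
      π (NormedSpace.exp (D u') (v₀ + γ u')) = π v₀ + t • u := by
  have : CompleteSpace V := FiniteDimensional.complete ℂ V
  have : CompleteSpace U := FiniteDimensional.complete ℂ U
  let D' := LinearMap.toContinuousLinearMap D
  let γ' := LinearMap.toContinuousLinearMap γ
  let π' := LinearMap.toContinuousLinearMap π
  let F : U → U := fun w' => π' (NormedSpace.exp (D' w') (v₀ + γ' w'))
  have hexp : HasStrictFDerivAt (fun w' : U => NormedSpace.exp (D' w')) D' 0 := by
    have h0 : HasStrictFDerivAt NormedSpace.exp (1 : (V →L[ℂ] V) →L[ℂ] (V →L[ℂ] V)) (D' 0) := by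
      rw [map_zero]; exact hasStrictFDerivAt_exp_zero
    exact h0.comp (0 : U) D'.hasStrictFDerivAt
  have hF : HasStrictFDerivAt F (ContinuousLinearMap.id ℂ U) 0 := by
    have h1 := π'.hasStrictFDerivAt.comp (0 : U)
      (hexp.clm_apply (γ'.hasStrictFDerivAt.const_add v₀))
    refine h1.congr_fderiv ?_
    ext w'
    have h2 : π' (γ' w') + π' (D' w' v₀) = w' := by
      rw [← map_add, add_comm]; exact (congrArg π (h w')).trans (hπ w')
    simpa using h2
  have hmap := hF.map_nhds_eq_of_surj (by ext; simp)
  have hF0 : F 0 = π v₀ := by simp [F, π']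
  have htend : Tendsto (fun t : ℂ => π v₀ + t • u) (𝓝 0) (map F (𝓝 0)) := by
    rw [hmap, hF0]
    have : Continuous fun t : ℂ => π v₀ + t • u := by fun_prop
    simpa using this.tendsto 0
  exact (htend.eventually (image_mem_map univ_mem)).mono fun t ⟨w', _, hw'⟩ => ⟨w', hw'⟩

end Exponential

section Orbits
variable {L : Type*} [LieRing L] [LieAlgebra ℂ L]

/-- Exponentials of inner derivations are automorphisms. -/
theorem exists_aut_exp {V : Type*} [NormedAddCommGroup V] [NormedSpace ℂ V] [FiniteDimensional ℂ V]
    (ψ : L ≃ₗ[ℂ] V) {D : V →L[ℂ] V} {a : L} (hD : ∀ v, D v = ψ ⁅a, ψ.symm v⁆) :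
    ∃ φ : L ≃ₗ⁅ℂ⁆ L, (∀ x, φ x = ψ.symm (NormedSpace.exp D (ψ x))) ∧
      ∀ x, ⁅a, ⁅a, ⁅a, x⁆⁆⁆ = 0 → φ x = x + ⁅a, x⁆ + (2⁻¹ : ℂ) • ⁅a, ⁅a, x⁆⁆ := by
  let br : V →L[ℂ] V →L[ℂ] V := LinearMap.toContinuousBilinearMap
    (LinearMap.mk₂ ℂ (fun x y => ψ ⁅ψ.symm x, ψ.symm y⁆) (by simp) (by simp) (by simp) (by simp))
  have hbr (x y : V) : br x y = ψ ⁅ψ.symm x, ψ.symm y⁆ := rfl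
  have : CompleteSpace V := FiniteDimensional.complete ℂ V
  let _ : NormedAlgebra ℚ (V →L[ℂ] V) := NormedAlgebra.restrictScalars ℚ ℂ _
  have hinv (b : V →L[ℂ] V) (v : V) : NormedSpace.exp b (NormedSpace.exp (-b) v) = v := by
    have : NormedSpace.exp b * NormedSpace.exp (-b) = 1 := by
      rw [← NormedSpace.exp_add_of_commute ((Commute.refl b).neg_right), add_neg_cancel,
        NormedSpace.exp_zero]
    exact congrArg (fun T : V →L[ℂ] V => T v) this
  let φ₀ : L ≃ₗ[ℂ] L := LinearEquiv.ofLinearMap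
    (ψ.symm.toLinearMap ∘ₗ (NormedSpace.exp D).toLinearMap ∘ₗ ψ.toLinearMap)
    (ψ.symm.toLinearMap ∘ₗ (NormedSpace.exp (-D)).toLinearMap ∘ₗ ψ.toLinearMap)
    (LinearMap.ext fun x => by simp [hinv])
    (LinearMap.ext fun x => by
      have := congrArg ψ.symm (hinv (-D) (ψ x))
      rw [neg_neg] at this
      simpa using this)
  have hφ₀ (x : L) : φ₀ x = ψ.symm (NormedSpace.exp D (ψ x)) := rfl
  refine ⟨{ φ₀ with map_lie' := ?_ }, hφ₀, fun x hx => ?_⟩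
  · intro x y
    change φ₀ ⁅x, y⁆ = ⁅φ₀ x, φ₀ y⁆
    have := exp_derivation_apply br D (fun v w => by
      simp only [hD, hbr, LinearEquiv.symm_apply_apply, leibniz_lie a (ψ.symm v), map_add])
      (ψ x) (ψ y)
    rw [hφ₀, hφ₀, hφ₀]
    simpa [hbr] using congrArg ψ.symm this
  · change φ₀ x = _
    rw [hφ₀, exp_apply_of_cube_eq_zero D]
    · simp [hD]
    · simp [hD, hx]

variable [FiniteDimensional ℂ L]

/-- Orbit maps of the adjoint group are open along lines: if `[A, c₀] + C = W`, then every point of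
`c₀ + W` close to `c₀` along a line lies in `exp (ad a) (c₀ + C)` for some `a ∈ A`. -/
theorem eventually_exists_aut (A W C : Submodule ℂ L)
    (hW : ∀ φ : L ≃ₗ⁅ℂ⁆ L, (∀ x, (∀ a ∈ A, ⁅a, x⁆ = 0) → φ x = x) → ∀ w ∈ W, φ w ∈ W)
    (hC : C ≤ W) {c₀ : L} (hc₀ : c₀ ∈ W)
    (hsurj : ∀ w ∈ W, ∃ a ∈ A, ∃ c ∈ C, ⁅a, c₀⁆ + c = w) {w : L} (hw : w ∈ W) :
    ∀ᶠ t in 𝓝 (0 : ℂ), ∃ φ : L ≃ₗ⁅ℂ⁆ L, (∀ x, (∀ a ∈ A, ⁅a, x⁆ = 0) → φ x = x) ∧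
      ∃ c ∈ C, c₀ + t • w = φ (c₀ + c) := by
  -- transport the situation to `ℂⁿ`
  let V := Fin (finrank ℂ L) → ℂ
  let ψ : L ≃ₗ[ℂ] V := (Module.finBasis ℂ L).equivFun
  let D : L →ₗ[ℂ] V →L[ℂ] V := LinearMap.toContinuousLinearMap.toLinearMap ∘ₗ
    (ψ.conj.toLinearMap ∘ₗ (ad ℂ L : L →ₗ[ℂ] Module.End ℂ L))
  have hD (a : L) (v : V) : D a v = ψ ⁅a, ψ.symm v⁆ := rfl
  -- linear right inverse of `(a, c) ↦ ⁅a, c₀⁆ + c`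
  let b := Module.finBasis ℂ W
  choose a ha c hc hac using fun i => hsurj (b i) (b i).2
  let U := Fin (finrank ℂ W) → ℂ
  let σ : U →ₗ[ℂ] L := Fintype.linearCombination ℂ a
  let γ : U →ₗ[ℂ] L := Fintype.linearCombination ℂ c
  let ι : U →ₗ[ℂ] L := W.subtype ∘ₗ b.equivFun.symm.toLinearMap
  have hσ' (u : U) : σ u = ∑ i, u i • a i := Fintype.linearCombination_apply ℂ a u
  have hγ' (u : U) : γ u = ∑ i, u i • c i := Fintype.linearCombination_apply ℂ c u
  have hσ (u : U) : σ u ∈ A := by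
    rw [hσ']
    exact sum_mem fun i _ => A.smul_mem _ (ha i)
  have hγ (u : U) : γ u ∈ C := by
    rw [hγ']
    exact sum_mem fun i _ => C.smul_mem _ (hc i)
  have hσγ (u : U) : ⁅σ u, c₀⁆ + γ u = ι u := by
    simp only [hσ', hγ', sum_lie, smul_lie, ← Finset.sum_add_distrib, ← smul_add, hac]
    change _ = W.subtype (b.equivFun.symm u)
    rw [b.equivFun_symm_apply, map_sum]
    rfl
  obtain ⟨ρ, hρ⟩ := LinearMap.exists_leftInverse_of_injective W.subtype
    (LinearMap.ker_eq_bot.2 W.injective_subtype)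
  have hρ' (w : L) (hw : w ∈ W) : ρ w = ⟨w, hw⟩ := LinearMap.congr_fun hρ ⟨w, hw⟩
  have key := eventually_exists_exp (ψ.toLinearMap ∘ₗ ι)
    (b.equivFun.toLinearMap ∘ₗ ρ ∘ₗ ψ.symm.toLinearMap)
    (fun u => by
      have := congrArg b.equivFun (LinearMap.congr_fun hρ (b.equivFun.symm u))
      rw [LinearMap.id_apply, LinearEquiv.apply_symm_apply] at this
      refine Eq.trans ?_ this
      exact congrArg (fun x => b.equivFun (ρ x)) (ψ.symm_apply_apply _))
    (D ∘ₗ σ) (ψ.toLinearMap ∘ₗ γ) (ψ c₀)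
    (fun u => by simp [hD, ← hσγ]) (b.equivFun ⟨w, hw⟩)
  refine key.mono fun t ⟨u, hu⟩ => ?_
  obtain ⟨φ, hφ, hfix⟩ := exists_aut_exp ψ (hD (σ u))
  have hφA : ∀ x, (∀ a ∈ A, ⁅a, x⁆ = 0) → φ x = x := fun x hx => by
    have h0 := hx _ (hσ u)
    rw [hfix x (by simp [h0])]
    simp [h0]
  refine ⟨φ, hφA, γ u, hγ u, ?_⟩
  have hmem := hW φ hφA _ (W.add_mem hc₀ (hC (hγ u)))
  have h1 : ρ (φ (c₀ + γ u)) = ρ c₀ + t • ⟨w, hw⟩ := by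
    apply b.equivFun.injective
    rw [hφ, map_add b.equivFun, map_smul b.equivFun]
    simpa using hu
  rw [hρ' _ hmem, hρ' _ hc₀] at h1
  exact (congrArg Subtype.val h1).symm

end Orbits

end

section
open Module LieAlgebra LieSubalgebra Filter Topology

/-- A locally constant relation is constant on the complement of a finite set of complex numbers. -/
theorem rel_of_locally_rel {S : Set ℂ} (hS : Sᶜ.Finite) {r : ℂ → ℂ → Prop}
    (hsymm : ∀ a b, r a b → r b a) (htrans : ∀ a b c, r a b → r b c → r a c)
    (hloc : ∀ a ∈ S, ∀ᶠ b in 𝓝 a, b ∈ S → r a b) {a b : ℂ} (ha : a ∈ S) (hb : b ∈ S) : r a b := by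
  have hSo : IsOpen S := by simpa using hS.isClosed.isOpen_compl
  have hconn : IsPreconnected S := by
    have := hS.countable.isPathConnected_compl_of_one_lt_rank (E := ℂ) (by simp)
    simpa using this.isConnected.isPreconnected
  have hu : IsOpen {x | x ∈ S ∧ r a x} := isOpen_iff_mem_nhds.2 fun x hx => by
    filter_upwards [hloc x hx.1, hSo.mem_nhds hx.1] with y h1 h2
    exact ⟨h2, htrans _ _ _ hx.2 (h1 h2)⟩
  have hv : IsOpen {x | x ∈ S ∧ ¬ r a x} := isOpen_iff_mem_nhds.2 fun x hx => by
    filter_upwards [hloc x hx.1, hSo.mem_nhds hx.1] with y h1 h2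
    exact ⟨h2, fun h => hx.2 (htrans _ _ _ h (hsymm _ _ (h1 h2)))⟩
  have haa : r a a := mem_of_mem_nhds (hloc a ha) ha
  by_contra hab
  obtain ⟨x, -, hx1, hx2⟩ := hconn _ _ hu hv
    (fun x hx => (em (r a x)).imp (fun h => ⟨hx, h⟩) fun h => ⟨hx, h⟩)
    ⟨a, ha, ha, haa⟩ ⟨b, hb, hb, hab⟩
  exact hx2.2 hx1.2

/-- A polynomial not vanishing at a point has finitely many zeros on a line through that point. -/
theorem finite_eval_line_eq_zero {ι : Type*} {p : MvPolynomial ι ℂ} {x : ι → ℂ}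
    (hx : MvPolynomial.eval x p ≠ 0) (w : ι → ℂ) :
    {s : ℂ | MvPolynomial.eval (x + s • w) p = 0}.Finite := by
  let q : Polynomial ℂ := MvPolynomial.aeval
    (fun i => Polynomial.C (x i) + Polynomial.X * Polynomial.C (w i)) p
  have hq (s : ℂ) : q.eval s = MvPolynomial.eval (x + s • w) p := by
    change Polynomial.evalRingHom s (MvPolynomial.eval₂Hom _ _ p) = _
    rw [MvPolynomial.map_eval₂Hom]
    change MvPolynomial.eval₂ _ _ p = MvPolynomial.eval₂ _ _ p
    congr 1
    · ext z; simp
    · ext i; simp; exact mul_comm _ _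
  have hq0 : q ≠ 0 := fun h0 => hx (by
    have := hq 0
    simpa [h0] using this.symm)
  refine (q.roots.toFinset.finite_toSet).subset fun s hs => ?_
  rw [Set.mem_ofPred_eq, ← hq] at hs
  simpa [hq0] using hs

section Cartan
variable {L : Type*} [LieRing L] [LieAlgebra ℂ L]

theorem mem_engel_map_iff (φ : L ≃ₗ⁅ℂ⁆ L) (x y : L) :
    φ y ∈ engel ℂ (φ x) ↔ y ∈ engel ℂ x := by
  have (n : ℕ) : ((ad ℂ L (φ x)) ^ n) (φ y) = φ (((ad ℂ L x) ^ n) y) := by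
    induction n with
    | zero => simp
    | succ n ih => rw [pow_succ', Module.End.mul_apply, ih, pow_succ', Module.End.mul_apply,
      ad_apply,
      ad_apply, φ.map_lie]
  simp [mem_engel_iff, this]

variable [FiniteDimensional ℂ L]

theorem exists_lie_add_mem_engel (x w : L) : ∃ a : L, ∃ c ∈ engel ℂ x, ⁅a, x⁆ + c = w := by
  obtain ⟨N, hN⟩ := (ad ℂ L x).eventually_isCompl_ker_pow_range_pow.exists_forall_of_atTop
  obtain ⟨c, hc, d, ⟨a, rfl⟩, rfl⟩ := Submodule.mem_sup.1
      ((hN (N + 1) (by omega)).sup_eq_top ▸ Submodule.mem_top : w ∈ _ ⊔ _)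
  refine ⟨-(((ad ℂ L x) ^ N) a), c, (mem_engel_iff _ _ _).2 ⟨N + 1, hc⟩, ?_⟩
  rw [pow_succ', Module.End.mul_apply, ad_apply, neg_lie, lie_skew, add_comm]

theorem isRegular_map_iff (φ : L ≃ₗ⁅ℂ⁆ L) (x : L) : IsRegular ℂ (φ x) ↔ IsRegular ℂ x := by
  rw [isRegular_iff_finrank_engel_eq_rank, isRegular_iff_finrank_engel_eq_rank]
  have : (engel ℂ (φ x)).toSubmodule = (engel ℂ x).toSubmodule.map φ.toLinearEquiv.toLinearMap := by
    ext y
    obtain ⟨z, rfl⟩ := φ.surjective y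
    refine (mem_engel_map_iff φ x z).trans ⟨fun hz => ⟨z, hz, rfl⟩, fun ⟨z', hz, h⟩ => ?_⟩
    rwa [← φ.injective h]
  have h2 := LinearEquiv.finrank_map_eq φ.toLinearEquiv (engel ℂ x).toSubmodule
  change finrank ℂ (engel ℂ (φ x)).toSubmodule = _ ↔ _
  rw [this]
  exact Eq.congr_left h2

theorem engel_le_of_isRegular {x y : L} (hx : IsRegular ℂ x) (hy : y ∈ engel ℂ x) :
    engel ℂ x ≤ engel ℂ y := by
  set Ex : {engel ℂ z | z ∈ engel ℂ x} := ⟨engel ℂ x, x, self_mem_engel _ _, rfl⟩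
  suffices IsBot Ex from @this ⟨engel ℂ y, y, hy, rfl⟩
  apply engel_isBot_of_isMin ((Cardinal.natCast_lt_aleph0).le.trans (Cardinal.aleph0_le_mk ℂ))
    (engel ℂ x) Ex le_rfl
  rintro ⟨_, y, hy, rfl⟩ hyx
  suffices engel ℂ y = engel ℂ x from this.ge
  refine LieSubalgebra.toSubmodule_injective (Submodule.eq_of_le_of_finrank_le hyx ?_)
  exact ((isRegular_iff_finrank_engel_eq_rank ℂ x).1 hx).le.trans (rank_le_finrank_engel ℂ y)

theorem engel_eq_of_isRegular {x y : L} (hx : IsRegular ℂ x) (hy : IsRegular ℂ y)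
    (hxy : y ∈ engel ℂ x) : engel ℂ y = engel ℂ x := by
  apply LieSubalgebra.toSubmodule_injective
  refine (Submodule.eq_of_le_of_finrank_le (engel_le_of_isRegular hx hxy) ?_).symm
  have h1 := (isRegular_iff_finrank_engel_eq_rank ℂ x).1 hx
  have h2 := (isRegular_iff_finrank_engel_eq_rank ℂ y).1 hy
  exact (h2.trans h1.symm).le

/-- A line through a regular element meets the non-regular elements in a finite set. -/
theorem finite_not_isRegular_line {x : L} (hx : IsRegular ℂ x) (w : L) :
    {s : ℂ | ¬ IsRegular ℂ (x + s • w)}.Finite := by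
  classical
  let b := Module.finBasis ℂ L
  obtain ⟨p, hreg⟩ : ∃ p : MvPolynomial _ ℂ,
      ∀ y : L, IsRegular ℂ y ↔ MvPolynomial.eval (b.repr y) p ≠ 0 :=
    ⟨_, fun y => isRegular_iff_coeff_polyCharpoly_rank_ne_zero ℂ b y⟩
  simp only [hreg, not_not, map_add, map_smul] at hx ⊢
  exact finite_eval_line_eq_zero hx _

theorem exists_isRegular_mem (T : Submodule ℂ L) {c₀ : L} (hc₀ : c₀ ∈ T)
    (hT : ∀ w, ∃ a : L, ∃ c ∈ T, ⁅a, c₀⁆ + c = w) : ∃ c ∈ T, IsRegular ℂ c := by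
  obtain ⟨x, hx⟩ := exists_isRegular ℂ L
  have h1 := eventually_exists_aut ⊤ ⊤ T (fun _ _ _ _ => trivial) le_top
    (Submodule.mem_top : c₀ ∈ ⊤) (fun w _ => by simpa using hT w) (w := x - c₀) trivial
  -- `c₀ + t • (x - c₀)` is regular for all but finitely many `t`
  have h2 := finite_not_isRegular_line hx (c₀ - x)
  have h3 : ∀ᶠ t in 𝓝[≠] (0 : ℂ), IsRegular ℂ (c₀ + t • (x - c₀)) := by
    refine nhdsNE_le_cofinite 0 ?_
    refine (h2.preimage (f := fun t => 1 - t) (sub_right_injective.injOn)).subset fun t ht => ?_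
    have h4 : x + (1 - t) • (c₀ - x) = c₀ + t • (x - c₀) := by module
    rwa [Set.mem_preimage, Set.mem_ofPred_eq, h4]
  obtain ⟨t, ⟨φ, -, c, hc, ht⟩, hreg⟩ := ((h1.filter_mono nhdsWithin_le_nhds).and h3).exists
  rw [ht, isRegular_map_iff] at hreg
  exact ⟨c₀ + c, T.add_mem hc₀ hc, hreg⟩

/-- Cartan subalgebras attached to regular elements are conjugate. -/
theorem exists_aut_engel {x y : L} (hx : IsRegular ℂ x) (hy : IsRegular ℂ y) :
    ∃ φ : L ≃ₗ⁅ℂ⁆ L, ∀ z, φ z ∈ engel ℂ y ↔ z ∈ engel ℂ x := by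
  let γ : ℂ → L := fun s => x + s • (y - x)
  have key := rel_of_locally_rel (S := {s | IsRegular ℂ (γ s)})
    (finite_not_isRegular_line hx (y - x))
    (r := fun s t => ∃ φ : L ≃ₗ⁅ℂ⁆ L, ∀ z, φ z ∈ engel ℂ (γ t) ↔ z ∈ engel ℂ (γ s))
    (fun s t ⟨φ, hφ⟩ => ⟨φ.symm, fun z => by
      rw [← hφ, φ.apply_symm_apply]⟩)
    (fun s t u ⟨φ, hφ⟩ ⟨φ', hφ'⟩ => ⟨φ.trans φ', fun z => by
      rw [← hφ, ← hφ']; rfl⟩)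
    (fun s hs => by
      have h1 := eventually_exists_aut ⊤ ⊤ (engel ℂ (γ s)).toSubmodule (fun _ _ _ _ => trivial)
        le_top (Submodule.mem_top : γ s ∈ ⊤)
        (fun w _ => by simpa using exists_lie_add_mem_engel (γ s) w) (w := y - x) trivial
      have h2 : Tendsto (fun t : ℂ => t - s) (𝓝 s) (𝓝 0) := by
        have : Continuous fun t : ℂ => t - s := by fun_prop
        simpa using this.tendsto s
      refine (h2.eventually h1).mono fun t ht hreg => ?_
      obtain ⟨φ, -, c, hc, ht⟩ := ht
      refine ⟨φ, fun z => ?_⟩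
      have ht' : γ t = φ (γ s + c) := by rw [← ht]; simp only [γ]; module
      have hreg' : IsRegular ℂ (γ s + c) := (isRegular_map_iff φ _).1 (ht' ▸ hreg)
      rw [ht', mem_engel_map_iff,
        engel_eq_of_isRegular hs hreg' (add_mem (self_mem_engel _ _) hc)])
    (a := 0) (b := 1) (by simpa [γ] using hx) (by simpa [γ] using hy)
  simpa [γ] using key

/-- Any element with semisimple adjoint action can be moved into a given Cartan subalgebra. -/
theorem exists_aut_mem_of_isSemisimple (T : Submodule ℂ L)
    (hTc : ∀ x ∈ T, ∀ y ∈ T, ⁅x, y⁆ = 0) {c₀ : L} (hc₀ : c₀ ∈ T)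
    (hT : ∀ x ∈ engel ℂ c₀, x ∈ T) {h : L} (hh : (ad ℂ L h).IsSemisimple) :
    ∃ φ : L ≃ₗ⁅ℂ⁆ L, φ h ∈ T := by
  obtain ⟨c, hc, hcreg⟩ := exists_isRegular_mem T hc₀ (fun w => by
    obtain ⟨a, c, hc, h1⟩ := exists_lie_add_mem_engel c₀ w
    exact ⟨a, c, hT c hc, h1⟩)
  have hcT : ∀ z ∈ engel ℂ c, z ∈ T := fun z hz =>
    hT z (engel_le_of_isRegular hcreg ((mem_engel_iff _ _ _).2 ⟨1, by simp [hTc c hc c₀ hc₀]⟩) hz)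
  obtain ⟨c', hc', hreg'⟩ := exists_isRegular_mem (LinearMap.ker (ad ℂ L h))
    (c₀ := h) (by simp) (fun w => by
      obtain ⟨a, c, hc, h1⟩ := exists_lie_add_mem_engel h w
      refine ⟨a, c, ?_, h1⟩
      have := hh.isFinitelySemisimple.maxGenEigenspace_eq_eigenspace 0
      rw [Module.End.eigenspace_zero] at this
      exact this ▸ hc)
  obtain ⟨φ, hφ⟩ := exists_aut_engel hreg' hcreg
  refine ⟨φ, hcT _ ((hφ h).2 ((mem_engel_iff _ _ _).2 ⟨1, ?_⟩))⟩
  have h1 : ⁅h, c'⁆ = 0 := by simpa using hc'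
  rw [pow_one, ad_apply, ← lie_skew, h1, neg_zero]

end Cartan

end

section
open Module LieAlgebra LieSubalgebra

/-- A basis of weight vectors of a Lie algebra for a split Cartan subalgebra, together with
`sl₂`-triples attached to simple roots. Weights are written in coordinates given by simple roots. -/
structure RootBasis (L : Type*) [LieRing L] [LieAlgebra ℂ L] (n : ℕ) (ι : Type) where
  basis : Basis ι ℂ L
  wt : ι → Fin n → ℤ
  cart : (Fin n → ℂ) →ₗ[ℂ] L
  E : Fin n → L
  F : Fin n → L
  A : Fin n → Fin n → ℤ
  rho : Fin n → ℤ
  lie_cart : ∀ c k, ⁅cart c, basis k⁆ = (∑ j, c j * wt k j) • basis k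
  mem_cart : ∀ k, wt k = 0 → basis k ∈ LinearMap.range cart
  sign : ∀ k, 0 ≤ wt k ∨ wt k ≤ 0
  triple : ∀ i, IsSl2Triple (cart fun j => A i j) (E i) (F i)
  lie_E : ∀ c i, ⁅cart c, E i⁆ = c i • E i
  lie_F : ∀ c i, ⁅cart c, F i⁆ = -(c i • F i)
  rho_pos : ∀ i, 0 < ∑ j, rho j * A i j
  lie_F_eq_zero : ∀ k i, 0 ≤ wt k → wt k ≠ 0 → wt k i = 0 → ⁅basis k, F i⁆ = 0

section Transport
variable {L : Type*} [LieRing L] [LieAlgebra ℂ L] {h e f : L}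

theorem IsSl2Triple.map (ht : IsSl2Triple h e f) (φ : L ≃ₗ⁅ℂ⁆ L) :
    IsSl2Triple (φ h) (φ e) (φ f) where
  h_ne_zero := fun h0 => ht.h_ne_zero (φ.injective (h0.trans (map_zero φ).symm))
  lie_e_f := by rw [← φ.map_lie, ht.lie_e_f]
  lie_h_e_nsmul := by rw [← φ.map_lie, ht.lie_h_e_nsmul, map_nsmul]
  lie_h_f_nsmul := by rw [← φ.map_lie, ht.lie_h_f_nsmul, map_neg, map_nsmul]

theorem distinguished_map (hdist : ∀ x : L, ⁅x, e⁆ = 0 → (ad ℂ L x).IsSemisimple → x = 0)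
    (φ : L ≃ₗ⁅ℂ⁆ L) : ∀ x : L, ⁅x, φ e⁆ = 0 → (ad ℂ L x).IsSemisimple → x = 0 := by
  intro x hx hs
  obtain ⟨y, rfl⟩ := φ.surjective x
  have h1 : ⁅y, e⁆ = 0 := φ.injective ((φ.map_lie y e).trans (hx.trans (map_zero φ).symm))
  have h2 : (ad ℂ L y).IsSemisimple := by
    refine (LinearEquiv.isSemisimple_iff (f := ad ℂ L y) (e := φ.toLinearEquiv)
      (g := ad ℂ L (φ y)) ?_).2 hs
    ext z
    exact φ.map_lie y z
  rw [hdist y h1 h2]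
  exact map_zero φ

theorem exists_int_of_lie_eq_smul [FiniteDimensional ℂ L] (ht : IsSl2Triple h e f) {x : L} (hx :
    x ≠ 0)
    {μ : ℂ} (hμ : ⁅h, x⁆ = μ • x) : ∃ z : ℤ, μ = z := by
  obtain ⟨j, w, -, hw⟩ := exists_primitive_of_eigenvector ht (p := ⊤) (by simp) trivial hx hμ
  obtain ⟨m, hm⟩ := hw.exists_nat
  exact ⟨m - 2 * j, by push_cast; linear_combination hm⟩

theorem eq_zero_of_lie_e_of_neg [FiniteDimensional ℂ L] (ht : IsSl2Triple h e f) {x : L}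
    (hx : ⁅e, x⁆ = 0) {k : ℤ} (hk : k < 0) (hμ : ⁅h, x⁆ = (k : ℂ) • x) : x = 0 := by
  by_contra hx0
  have hP : ht.HasPrimitiveVectorWith x (k : ℂ) := ⟨hx0, hμ, hx⟩
  obtain ⟨m, hm⟩ := hP.exists_nat
  have : k = m := by exact_mod_cast hm
  omega

theorem eq_zero_of_lie_f_of_pos [FiniteDimensional ℂ L] (ht : IsSl2Triple h e f) {x : L}
    (hx : ⁅f, x⁆ = 0) {k : ℤ} (hk : 0 < k) (hμ : ⁅h, x⁆ = (k : ℂ) • x) : x = 0 :=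
  eq_zero_of_lie_e_of_neg ht.symm hx (k := -k) (by omega) (by rw [neg_lie, hμ]; simp)

end Transport

namespace RootBasis
variable {L : Type*} [LieRing L] [LieAlgebra ℂ L] {n : ℕ} {ι : Type}
  (R : RootBasis L n ι)

theorem repr_lie_cart (c : Fin n → ℂ) (x : L) (k : ι) :
    R.basis.repr ⁅R.cart c, x⁆ k = (∑ j, c j * R.wt k j) * R.basis.repr x k := by
  classical
  have hx : x ∈ Submodule.span ℂ (Set.range R.basis) := R.basis.span_eq ▸ Submodule.mem_top
  induction hx using Submodule.span_induction with
  | zero => simp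
  | add x y _ _ hx hy => simp [hx, hy, mul_add]
  | smul a x _ hx => simp [hx]; ring
  | mem x hx =>
    obtain ⟨i, rfl⟩ := hx
    rw [R.lie_cart]
    by_cases hik : i = k
    · subst hik; simp
    · simp [hik]

/-- Membership in an eigenspace of an element of the Cartan subalgebra. -/
theorem lie_cart_eq_smul_iff {c : Fin n → ℂ} {x : L} {μ : ℂ} :
    ⁅R.cart c, x⁆ = μ • x ↔ ∀ k, (∑ j, c j * R.wt k j) ≠ μ → R.basis.repr x k = 0 := by
  rw [R.basis.ext_elem_iff]
  refine forall_congr' fun k => ?_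
  rw [repr_lie_cart, map_smul, Finsupp.smul_apply, smul_eq_mul, mul_eq_mul_right_iff, ne_eq,
    or_iff_not_imp_left]

theorem mem_span_of_lie_cart {c : Fin n → ℂ} {x : L} {μ : ℂ} (hx : ⁅R.cart c, x⁆ = μ • x) :
    x ∈ Submodule.span ℂ (R.basis '' {k | ∑ j, c j * R.wt k j = μ}) := by
  rw [R.basis.mem_span_image]
  intro k hk
  by_contra hne
  exact Finsupp.mem_support_iff.1 hk (R.lie_cart_eq_smul_iff.1 hx k hne)

theorem finrank_eigenspace [Fintype ι] (c : Fin n → ℂ) (μ : ℂ) :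
    finrank ℂ ((ad ℂ L (R.cart c)).eigenspace μ) =
      Nat.card {k // ∑ j, c j * R.wt k j = μ} := by
  have h1 : (ad ℂ L (R.cart c)).eigenspace μ =
      Submodule.span ℂ (Set.range fun k : {k // ∑ j, c j * R.wt k j = μ} => R.basis k) := by
    apply le_antisymm
    · intro x hx
      rw [End.mem_eigenspace_iff, ad_apply] at hx
      have := R.mem_span_of_lie_cart hx
      rwa [Set.image_eq_range] at this
    · rw [Submodule.span_le]
      rintro _ ⟨⟨k, hk⟩, rfl⟩
      simp only [SetLike.mem_coe, End.mem_eigenspace_iff, ad_apply, R.lie_cart, hk]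
  classical
  have : Fintype {k // ∑ j, c j * R.wt k j = μ} := Fintype.ofFinite _
  rw [h1, Nat.card_eq_fintype_card]
  exact finrank_span_eq_card (R.basis.linearIndependent.comp _ Subtype.val_injective)

theorem cart_lie_cart [FiniteDimensional ℂ L] [IsKilling ℂ L] (c d : Fin n → ℂ) :
    ⁅R.cart c, R.cart d⁆ = 0 := by
  have h : ad ℂ L ⁅R.cart c, R.cart d⁆ = 0 := by
    refine R.basis.ext fun k => ?_
    simp only [ad_apply, lie_lie, R.lie_cart, lie_smul, LinearMap.zero_apply]
    rw [smul_comm, sub_self]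
  rw [← LieDerivation.IsKilling.ad_apply_eq_zero_iff ℂ]
  ext y
  rw [LieDerivation.ad_apply_apply]
  exact LinearMap.congr_fun h y

theorem mem_range_cart_of_mem_engel {x : L} (hx : x ∈ engel ℂ (R.cart 1)) :
    x ∈ LinearMap.range R.cart := by
  obtain ⟨N, hN⟩ := (mem_engel_iff _ _ _).1 hx
  have key (m : ℕ) (k : ι) : R.basis.repr (((ad ℂ L (R.cart 1)) ^ m) x) k =
      (∑ j, (R.wt k j : ℂ)) ^ m * R.basis.repr x k := by
    induction m with
    | zero => simp
    | succ m ih =>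
      rw [pow_succ', Module.End.mul_apply, ad_apply, repr_lie_cart, ih]
      simp only [Pi.one_apply, one_mul]; ring
  have h1 : x ∈ Submodule.span ℂ (R.basis '' {k | R.wt k = 0}) := by
    rw [R.basis.mem_span_image]
    intro k hk
    by_contra hne
    have h2 := key N k
    rw [hN, map_zero, Finsupp.zero_apply, eq_comm, mul_eq_zero] at h2
    have h4 : ∑ j, (R.wt k j : ℂ) = 0 :=
      eq_zero_of_pow_eq_zero (h2.resolve_right (Finsupp.mem_support_iff.1 hk))
    have h5 : ∑ j, R.wt k j = 0 := by exact_mod_cast h4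
    refine hne (funext fun j => ?_)
    rcases R.sign k with hs | hs
    · exact (Finset.sum_eq_zero_iff_of_nonneg fun i _ => hs i).1 h5 j (Finset.mem_univ j)
    · exact (Finset.sum_eq_zero_iff_of_nonpos fun i _ => hs i).1 h5 j (Finset.mem_univ j)
  refine Submodule.span_le.2 ?_ h1
  rintro _ ⟨k, hk, rfl⟩
  exact R.mem_cart k hk

/-- Simple reflections are induced by automorphisms. -/
theorem exists_aut_reflection [FiniteDimensional ℂ L] (i : Fin n) :
    ∃ φ : L ≃ₗ⁅ℂ⁆ L, ∀ c, φ (R.cart c) = R.cart (c - c i • fun j => (R.A i j : ℂ)) := by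
  obtain ⟨φ, -, hφ⟩ := exists_aut_exp (finBasis ℂ L).equivFun
    (D := LinearMap.toContinuousLinearMap ((finBasis ℂ L).equivFun.conj (ad ℂ L (R.E i))))
    (a := R.E i) fun _ => rfl
  obtain ⟨ψ, -, hψ⟩ := exists_aut_exp (finBasis ℂ L).equivFun
    (D := LinearMap.toContinuousLinearMap ((finBasis ℂ L).equivFun.conj (ad ℂ L (-R.F i))))
    (a := -R.F i) fun _ => rfl
  have ht := R.triple i
  set H := R.cart fun j => R.A i j with hH
  have hc (c : Fin n → ℂ) : ⁅R.E i, R.cart c⁆ = -(c i • R.E i) := by rw [← lie_skew, R.lie_E]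
  have hFc (c : Fin n → ℂ) : ⁅R.F i, R.cart c⁆ = c i • R.F i := by
    rw [← lie_skew, R.lie_F, neg_neg]
  have hEH : ⁅R.E i, H⁆ = -((2 : ℂ) • R.E i) := by rw [← lie_skew, ht.lie_h_e_smul ℂ]
  have hFH : ⁅R.F i, H⁆ = (2 : ℂ) • R.F i := by rw [← lie_skew, ht.lie_lie_smul_f ℂ, neg_neg]
  have hEF := ht.lie_e_f
  have hFE : ⁅R.F i, R.E i⁆ = -H := by rw [← lie_skew, hEF]
  have φc (c : Fin n → ℂ) : φ (R.cart c) = R.cart c - c i • R.E i := by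
    rw [hφ _ (by simp [hc])]; simp [hc, sub_eq_add_neg]
  have φE : φ (R.E i) = R.E i := by rw [hφ _ (by simp)]; simp
  have φF : φ (R.F i) = R.F i + H - R.E i := by
    rw [hφ _ (by simp [hEF, hEH]), hEF, hEH]; module
  have φH : φ H = H - (2 : ℂ) • R.E i := by rw [hφ _ (by simp [hEH]), hEH]; simp [sub_eq_add_neg]
  have ψc (c : Fin n → ℂ) : ψ (R.cart c) = R.cart c - c i • R.F i := by
    rw [hψ _ (by simp [hFc])]; simp [hFc, sub_eq_add_neg]
  have ψE : ψ (R.E i) = R.E i + H - R.F i := by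
    rw [hψ _ (by simp [hFE, hFH])]; simp only [neg_lie, lie_neg, hFE, hFH]; module
  refine ⟨(φ.trans ψ).trans φ, fun c => ?_⟩
  change φ (ψ (φ (R.cart c))) = _
  rw [φc, map_sub, map_smul, ψc, ψE, map_sub, map_sub, φc, map_smul, map_smul, map_sub, map_add, φE,
    φH, φF, map_sub, map_smul]
  module

end RootBasis

end

section
open Module LieAlgebra LieSubalgebra Filter Topology

namespace RootBasis
variable {L : Type*} [LieRing L] [LieAlgebra ℂ L] [FiniteDimensional ℂ L] [IsKilling ℂ L]
  {n : ℕ} {ι : Type} (R : RootBasis L n ι) {h e f : L}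

theorem exists_aut_eq_cart (ht : IsSl2Triple h e f)
    (hdist : ∀ x : L, ⁅x, e⁆ = 0 → (ad ℂ L x).IsSemisimple → x = 0) :
    ∃ φ : L ≃ₗ⁅ℂ⁆ L, ∃ c, φ h = R.cart c := by
  obtain ⟨φ, c, hc⟩ := exists_aut_mem_of_isSemisimple (LinearMap.range R.cart)
    (by rintro _ ⟨c, rfl⟩ _ ⟨d, rfl⟩; exact R.cart_lie_cart c d) ⟨1, rfl⟩
    (fun x hx => R.mem_range_cart_of_mem_engel hx) (isSemisimple_ad_of_distinguished ht hdist)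
  exact ⟨φ, c, hc.symm⟩

/-- The neutral element of a distinguished `sl₂`-triple is conjugate to a dominant one. -/
theorem exists_aut_dominant (ht : IsSl2Triple h e f)
    (hdist : ∀ x : L, ⁅x, e⁆ = 0 → (ad ℂ L x).IsSemisimple → x = 0) :
    ∃ φ : L ≃ₗ⁅ℂ⁆ L, ∃ d : Fin n → ℕ, φ h = R.cart fun i => (d i : ℂ) := by
  have heig (φ : L ≃ₗ⁅ℂ⁆ L) (c : Fin n → ℂ) (hφ : φ h = R.cart c) (i : Fin n) :
      (∃ z : ℤ, c i = z) ∧ End.HasEigenvalue (ad ℂ L h) (c i) := by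
    have h1 := R.lie_E c i
    have h0 := (R.triple i).e_ne_zero
    obtain ⟨x, hx⟩ := φ.surjective (R.E i)
    have hx' : φ x = R.E i := hx
    rw [← hφ, ← hx', ← φ.map_lie, ← map_smul] at h1
    replace h1 : ⁅h, x⁆ = c i • x := φ.injective h1
    have hx0 : x ≠ 0 := by rintro rfl; exact h0 (hx'.symm.trans (map_zero φ))
    exact ⟨exists_int_of_lie_eq_smul ht hx0 h1,
      End.hasEigenvalue_of_hasEigenvector ⟨End.mem_eigenspace_iff.2 h1, hx0⟩⟩
  let P : ℤ → Prop := fun z => ∃ φ : L ≃ₗ⁅ℂ⁆ L, ∃ c : Fin n → ℤ,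
    φ h = R.cart (fun i => (c i : ℂ)) ∧ z = ∑ j, R.rho j * c j
  have hbdd : ∃ b : ℤ, ∀ z, P z → z ≤ b := by
    have hfin : {z : ℤ | End.HasEigenvalue (ad ℂ L h) (z : ℂ)}.Finite :=
      (End.finite_hasEigenvalue (ad ℂ L h)).preimage Int.cast_injective.injOn
    obtain ⟨B, hB⟩ := (hfin.image fun z => |z|).bddAbove
    refine ⟨∑ j, |R.rho j| * B, ?_⟩
    rintro z ⟨φ, c, hφ, rfl⟩
    refine Finset.sum_le_sum fun j _ => (le_abs_self _).trans ?_
    rw [abs_mul]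
    exact mul_le_mul_of_nonneg_left (hB ⟨c j, (heig φ _ hφ j).2, rfl⟩) (abs_nonneg _)
  have hne : ∃ z, P z := by
    obtain ⟨φ, c, hφ⟩ := R.exists_aut_eq_cart ht hdist
    choose c' hc' using fun i => (heig φ c hφ i).1
    exact ⟨_, φ, c', by rw [hφ]; exact congrArg _ (funext hc'), rfl⟩
  obtain ⟨z, ⟨φ, c, hφ, rfl⟩, hmax⟩ := Int.exists_greatest_of_bdd hbdd hne
  have hpos (i : Fin n) : 0 ≤ c i := by
    by_contra! hneg
    obtain ⟨ψ, hψ⟩ := R.exists_aut_reflection i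
    have h1 := hmax (∑ j, R.rho j * (c j - c i * R.A i j)) ⟨φ.trans ψ,
      fun j => c j - c i * R.A i j, by
      change ψ (φ h) = _
      rw [hφ, hψ]
      congr 1
      ext j
      simp, rfl⟩
    have h2 : ∑ j, R.rho j * (c j - c i * R.A i j) =
        ∑ j, R.rho j * c j - c i * ∑ j, R.rho j * R.A i j := by
      rw [Finset.mul_sum, ← Finset.sum_sub_distrib]
      exact Finset.sum_congr rfl fun j _ => by ring
    have h3 := R.rho_pos i
    nlinarith
  refine ⟨φ, fun i => (c i).toNat, hφ.trans (congrArg _ (funext fun i => ?_))⟩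
  exact_mod_cast (Int.toNat_of_nonneg (hpos i)).symm

omit [IsKilling ℂ L] in
theorem le_two_of_distinguished {d : Fin n → ℕ}
    (ht : IsSl2Triple (R.cart fun i => (d i : ℂ)) e f) (i : Fin n) : d i ≤ 2 := by
  by_contra! hi
  have he := R.mem_span_of_lie_cart (ht.lie_h_e_smul ℂ)
  have h1 : ⁅e, R.F i⁆ = 0 := by
    clear ht
    induction he using Submodule.span_induction with
    | zero => simp
    | add x y _ _ hx hy => rw [add_lie, hx, hy, add_zero]
    | smul a x _ hx => rw [smul_lie, hx, smul_zero]
    | mem x hx =>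
      obtain ⟨k, hk, rfl⟩ := hx
      have hk' : ∑ j, (d j : ℤ) * R.wt k j = 2 := by
        have : ∑ j, (d j : ℂ) * R.wt k j = 2 := hk
        exact_mod_cast this
      have hk0 : 0 ≤ R.wt k := (R.sign k).resolve_right fun hneg => by
        have : ∑ j, (d j : ℤ) * R.wt k j ≤ 0 := Finset.sum_nonpos fun j _ =>
          mul_nonpos_of_nonneg_of_nonpos (by positivity) (hneg j)
        omega
      refine R.lie_F_eq_zero k i hk0 (fun h0 => by simp [h0] at hk') ?_
      by_contra hne
      have h2 : (d i : ℤ) * R.wt k i ≤ 2 := hk' ▸ Finset.single_le_sum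
        (f := fun j => (d j : ℤ) * R.wt k j) (fun j _ => mul_nonneg (by positivity) (hk0 j))
        (Finset.mem_univ i)
      have h3 : 1 ≤ R.wt k i := by have := hk0 i; simp only [Pi.zero_apply] at this; omega
      have h4 : (3 : ℤ) ≤ d i := by exact_mod_cast hi
      nlinarith
  refine (R.triple i).f_ne_zero (eq_zero_of_lie_e_of_neg ht h1 (k := -d i) (by omega) ?_)
  rw [R.lie_F]; simp

end RootBasis

section Conjugacy
variable {L : Type*} [LieRing L] [LieAlgebra ℂ L] {h e f : L}

theorem lie_mem_eigenspace {h x y : L} {μ ν : ℂ} (hx : ⁅h, x⁆ = μ • x) (hy : ⁅h, y⁆ = ν • y) :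
    ⁅h, ⁅x, y⁆⁆ = (μ + ν) • ⁅x, y⁆ := by
  rw [leibniz_lie h x y, hx, hy, smul_lie, lie_smul, add_smul]

variable [FiniteDimensional ℂ L]

/-- For a distinguished triple, `ad e` maps degree `0` bijectively onto degree `2`. -/
theorem finrank_eigenspace_zero_eq (ht : IsSl2Triple h e f)
    (hinj : ∀ x : L, ⁅h, x⁆ = 0 → ⁅e, x⁆ = 0 → x = 0) :
    finrank ℂ ((ad ℂ L h).eigenspace 0) = finrank ℂ ((ad ℂ L h).eigenspace 2) := by
  have h2 := ht.lie_h_e_smul ℂ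
  have h3 : ⁅h, f⁆ = (-2 : ℂ) • f := by rw [ht.lie_lie_smul_f ℂ, neg_smul]
  apply le_antisymm
  · refine LinearMap.finrank_le_finrank_of_injective (f := (ad ℂ L e).restrict
      (p := (ad ℂ L h).eigenspace 0) (q := (ad ℂ L h).eigenspace 2) fun x hx => ?_) ?_
    · rw [End.mem_eigenspace_iff, ad_apply] at hx ⊢
      simpa using lie_mem_eigenspace h2 hx
    · refine (injective_iff_map_eq_zero _).2 fun ⟨x, hx⟩ hx0 => ?_
      rw [End.mem_eigenspace_iff, ad_apply, zero_smul] at hx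
      exact Subtype.ext (hinj x hx (congrArg Subtype.val hx0))
  · refine LinearMap.finrank_le_finrank_of_injective (f := (ad ℂ L f).restrict
      (p := (ad ℂ L h).eigenspace 2) (q := (ad ℂ L h).eigenspace 0) fun x hx => ?_) ?_
    · rw [End.mem_eigenspace_iff, ad_apply] at hx ⊢
      simpa using lie_mem_eigenspace h3 hx
    · refine (injective_iff_map_eq_zero _).2 fun ⟨x, hx⟩ hx0 => ?_
      rw [End.mem_eigenspace_iff, ad_apply] at hx
      exact Subtype.ext (eq_zero_of_lie_f_of_pos ht (congrArg Subtype.val hx0) (k := 2) (by omega)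
        (by simpa using hx))

/-- Injectivity of a pencil of linear maps fails for only finitely many parameters. -/
theorem finite_not_injective_pencil {U V : Type*} [AddCommGroup U] [Module ℂ U] [AddCommGroup V]
    [Module ℂ V] [FiniteDimensional ℂ U] [FiniteDimensional ℂ V] (hUV : finrank ℂ U = finrank ℂ V)
    (S T : U →ₗ[ℂ] V)
    (hS : Function.Injective S) : {s : ℂ | ¬ Function.Injective (S + s • T)}.Finite := by
  let S' := LinearEquiv.ofInjectiveOfFinrankEq S hS hUV
  have hS' (u : U) : S'.symm (S u) = u := S'.symm_apply_apply u
  have h1 := End.finite_hasEigenvalue (S'.symm.toLinearMap ∘ₗ T)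
  refine (h1.image fun μ => -μ⁻¹).subset fun s hs => ?_
  rw [Set.mem_ofPred_eq, injective_iff_map_eq_zero] at hs
  push Not at hs
  obtain ⟨u, hu, hu0⟩ := hs
  have h2 : u + s • S'.symm (T u) = 0 := by
    have := congrArg S'.symm hu
    simpa [hS'] using this
  have hs0 : s ≠ 0 := by rintro rfl; simp at h2; exact hu0 h2
  refine ⟨-s⁻¹, End.hasEigenvalue_of_hasEigenvector (x := u) ⟨End.mem_eigenspace_iff.2 ?_, hu0⟩,
    by simp⟩
  have h3 : u = -(s • S'.symm (T u)) := eq_neg_of_add_eq_zero_left h2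
  change S'.symm (T u) = _
  conv_rhs => rw [h3]
  rw [smul_neg, neg_smul, neg_neg, smul_smul, inv_mul_cancel₀ hs0, one_smul]

/-- Two elements of degree two on which degree zero acts with open orbits are conjugate. -/
theorem exists_aut_of_degree_two {h x y : L} (hx : ⁅h, x⁆ = (2 : ℂ) • x) (hy : ⁅h, y⁆ = (2 : ℂ) • y)
    (hdim : finrank ℂ ((ad ℂ L h).eigenspace 0) = finrank ℂ ((ad ℂ L h).eigenspace 2))
    (hxi : ∀ a : L, ⁅h, a⁆ = 0 → ⁅x, a⁆ = 0 → a = 0)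
    (hyi : ∀ a : L, ⁅h, a⁆ = 0 → ⁅y, a⁆ = 0 → a = 0) :
    ∃ φ : L ≃ₗ⁅ℂ⁆ L, φ h = h ∧ φ x = y := by
  have hmem (z : L) (hz : ⁅h, z⁆ = (2 : ℂ) • z) (a : L) (ha : a ∈ (ad ℂ L h).eigenspace 0) :
      ad ℂ L z a ∈ (ad ℂ L h).eigenspace 2 := by
    rw [End.mem_eigenspace_iff, ad_apply] at ha ⊢
    simpa using lie_mem_eigenspace hz ha
  let S (z : L) (hz : ⁅h, z⁆ = (2 : ℂ) • z) := (ad ℂ L z).restrict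
      (p := (ad ℂ L h).eigenspace 0) (q := (ad ℂ L h).eigenspace 2) (hmem z hz)
  have hS (z : L) (hz : ⁅h, z⁆ = (2 : ℂ) • z) : Function.Injective (S z hz) ↔
      ∀ a : L, ⁅h, a⁆ = 0 → ⁅z, a⁆ = 0 → a = 0 := by
    rw [injective_iff_map_eq_zero]
    refine ⟨fun H a ha hza => ?_, fun H ⟨a, ha⟩ ha0 => ?_⟩
    · exact congrArg Subtype.val (H ⟨a, End.mem_eigenspace_iff.2 (by simpa using ha)⟩
      (Subtype.ext hza))
    · rw [End.mem_eigenspace_iff, ad_apply, zero_smul] at ha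
      exact Subtype.ext (H a ha (congrArg Subtype.val ha0))
  let γ : ℂ → L := fun s => x + s • (y - x)
  have hγ (s : ℂ) : ⁅h, γ s⁆ = (2 : ℂ) • γ s := by
    simp only [γ, lie_add, lie_smul, lie_sub, hx, hy]; module
  have hyx : ⁅h, y - x⁆ = (2 : ℂ) • (y - x) := by rw [lie_sub, hx, hy, smul_sub]
  have hlin (s : ℂ) : S (γ s) (hγ s) = S x hx + s • S (y - x) hyx := by
    ext a
    simp [S, γ]
  have hfin := finite_not_injective_pencil hdim (S x hx) (S (y - x) hyx) ((hS x hx).2 hxi)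
  have key := rel_of_locally_rel (S := {s | Function.Injective (S x hx + s • S (y - x) hyx)}) hfin
    (r := fun s t => ∃ φ : L ≃ₗ⁅ℂ⁆ L, φ h = h ∧ φ (γ s) = γ t)
    (fun s t ⟨φ, h1, h2⟩ => ⟨φ.symm, by rw [← h1, φ.symm_apply_apply, h1],
      by rw [← h2, φ.symm_apply_apply]⟩)
    (fun s t u ⟨φ, h1, h2⟩ ⟨ψ, h3, h4⟩ => ⟨φ.trans ψ, by
      change ψ (φ h) = h
      rw [h1, h3], by
      change ψ (φ (γ s)) = γ u
      rw [h2, h4]⟩)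
    (fun s hs => by
      have hsurj : Function.Surjective (S (γ s) (hγ s)) :=
        (LinearMap.injective_iff_surjective_of_finrank_eq_finrank hdim).1 (hlin s ▸ hs)
      have hfixh : ∀ φ : L ≃ₗ⁅ℂ⁆ L, (∀ x, (∀ a ∈ (ad ℂ L h).eigenspace 0, ⁅a, x⁆ = 0) → φ x = x) →
          φ h = h := fun φ hφ => hφ h fun a ha => by
        rw [End.mem_eigenspace_iff, ad_apply, zero_smul] at ha
        rw [← lie_skew, ha, neg_zero]
      have h1 := eventually_exists_aut ((ad ℂ L h).eigenspace 0) ((ad ℂ L h).eigenspace 2) ⊥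
        (fun φ hφ w hw => by
          rw [End.mem_eigenspace_iff, ad_apply] at hw ⊢
          conv_lhs => rw [← hfixh φ hφ]
          rw [← φ.map_lie, hw, map_smul]) bot_le (c₀ := γ s)
        (End.mem_eigenspace_iff.2 (hγ s))
        (fun w hw => by
          obtain ⟨a, ha⟩ := hsurj ⟨w, hw⟩
          have ha' : ⁅γ s, (a : L)⁆ = w := congrArg Subtype.val ha
          exact ⟨-a, neg_mem a.2, 0, zero_mem _, by rw [neg_lie, lie_skew, ha', add_zero]⟩)
        (w := y - x) (End.mem_eigenspace_iff.2 hyx)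
      have h2 : Tendsto (fun t : ℂ => t - s) (𝓝 s) (𝓝 0) := by
        have : Continuous fun t : ℂ => t - s := by fun_prop
        simpa using this.tendsto s
      refine (h2.eventually h1).mono fun t ht _ => ?_
      obtain ⟨φ, hφ, c, hc, ht⟩ := ht
      rw [(Submodule.mem_bot ℂ).1 hc, add_zero] at ht
      refine ⟨φ, hfixh φ hφ, ?_⟩
      rw [← ht]; simp only [γ]; module)
    (a := 0) (b := 1) (by simpa using (hS x hx).2 hxi) (by
      have h1 : S x hx + (1 : ℂ) • S (y - x) hyx = S y hy := by ext a; simp [S]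
      rw [Set.mem_ofPred_eq, h1]
      exact (hS y hy).2 hyi)
  simpa [γ] using key

/-- An `sl₂`-triple is determined by its first two elements. -/
theorem IsSl2Triple.eq_of_eq {f' : L} (ht : IsSl2Triple h e f) (ht' : IsSl2Triple h e f') :
    f = f' := by
  refine sub_eq_zero.1 (eq_zero_of_lie_e_of_neg ht (k := -2) ?_ (by omega) ?_)
  · rw [lie_sub, ht.lie_e_f, ht'.lie_e_f, sub_self]
  · rw [lie_sub, ht.lie_lie_smul_f ℂ, ht'.lie_lie_smul_f ℂ]
    push_cast; module

end Conjugacy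

end

section
open Module LieAlgebra LieSubalgebra

section Transport
variable {L : Type*} [LieRing L] [LieAlgebra ℂ L] {e h f : L}

theorem inCenterOfCentralizer_map (φ : L ≃ₗ⁅ℂ⁆ L) {v : L} (hv : InCenterOfCentralizer L e v) :
    InCenterOfCentralizer L (φ e) (φ v) := by
  refine ⟨by rw [← φ.map_lie, hv.1]; exact map_zero φ, fun y hy => ?_⟩
  obtain ⟨y, rfl⟩ : ∃ x, φ x = y := φ.surjective y
  rw [← φ.map_lie, hv.2 y (φ.injective ((φ.map_lie y e).trans (hy.trans (map_zero φ).symm)))]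
  exact map_zero φ

theorem PropertyP.map (hP : PropertyP L e h f) (φ : L ≃ₗ⁅ℂ⁆ L) :
    PropertyP L (φ e) (φ h) (φ f) := by
  have hs {x v : L} {m : ℂ} (hx : ⁅φ x, v⁆ = m • v) : ⁅x, φ.symm v⁆ = m • φ.symm v := by
    have h1 := congrArg φ.symm hx
    rw [LieEquiv.map_lie, map_smul, LieEquiv.symm_apply_apply] at h1
    exact h1
  have hc {v : L} (hv : InCenterOfCentralizer L (φ e) v) :
      InCenterOfCentralizer L e (φ.symm v) := by
    have h1 := inCenterOfCentralizer_map φ.symm hv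
    rwa [LieEquiv.symm_apply_apply] at h1
  have hn {v : L} (hv : v ≠ 0) : φ.symm v ≠ 0 := fun h0 =>
    hv (φ.symm.injective (h0.trans (map_zero φ.symm).symm))
  rintro m ⟨z, hz0, hz, hzm⟩ hmax v hv hv0 w hw hwm
  obtain ⟨x, hx, hxv⟩ := hP m ⟨φ.symm z, hn hz0, hc hz, hs hzm⟩ (by
    rintro m' ⟨y, hy0, hy, hym⟩
    refine hmax m' ⟨φ y, fun h0 => hy0 (φ.injective (h0.trans (map_zero φ).symm)),
      inCenterOfCentralizer_map φ hy, ?_⟩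
    rw [← φ.map_lie, hym]
    exact map_smul φ m' y) _ (hc hv) (hn hv0) _ (hc hw) (hs hwm)
  refine ⟨φ x, by rw [← φ.map_lie, hx]; exact map_zero φ, ?_⟩
  have h2 := congrArg φ hxv
  rw [LieEquiv.map_lie, LieEquiv.map_lie, LieEquiv.apply_symm_apply,
    LieEquiv.apply_symm_apply] at h2
  exact h2

end Transport

namespace RootBasis
variable {L : Type*} [LieRing L] [LieAlgebra ℂ L] {n : ℕ} {ι : Type}
  (R : RootBasis L n ι)

/-- The degree of a basis vector for the grading defined by a weighted Dynkin diagram. -/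
def deg (d : Fin n → ℕ) (k : ι) : ℤ := ∑ j, (d j : ℤ) * R.wt k j

theorem lie_cart_natCast (d : Fin n → ℕ) (k : ι) :
    ⁅R.cart fun i => (d i : ℂ), R.basis k⁆ = (R.deg d k : ℂ) • R.basis k := by
  rw [R.lie_cart, deg]; push_cast; rfl

/-- The homogeneous component of a given degree. -/
noncomputable def comp (d : Fin n → ℕ) (m : ℤ) : L →ₗ[ℂ] L :=
  R.basis.constr ℂ fun k => if R.deg d k = m then R.basis k else 0

theorem comp_basis (d : Fin n → ℕ) (m : ℤ) (k : ι) :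
    R.comp d m (R.basis k) = if R.deg d k = m then R.basis k else 0 := by
  simp [comp]

theorem lie_comp (d : Fin n → ℕ) (m : ℤ) (x : L) :
    ⁅R.cart fun i => (d i : ℂ), R.comp d m x⁆ = (m : ℂ) • R.comp d m x := by
  change (ad ℂ L (R.cart fun i => (d i : ℂ)) ∘ₗ R.comp d m) x = ((m : ℂ) • R.comp d m) x
  congr 1
  refine R.basis.ext fun k => ?_
  simp only [LinearMap.comp_apply, LinearMap.smul_apply, comp_basis, ad_apply]
  split_ifs with hk
  · rw [R.lie_cart_natCast, hk]
  · simp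

theorem sum_comp [Fintype ι] (d : Fin n → ℕ) (x : L) :
    ∑ m ∈ Finset.univ.image (R.deg d), R.comp d m x = x := by
  rw [← LinearMap.sum_apply]
  conv_rhs => rw [← LinearMap.id_apply (R := ℂ) x]
  congr 1
  refine R.basis.ext fun k => ?_
  simp [comp_basis]

theorem mem_span_deg (d : Fin n → ℕ) {m : ℤ} {x : L}
    (hx : ⁅R.cart fun i => (d i : ℂ), x⁆ = (m : ℂ) • x) :
    x ∈ Submodule.span ℂ (R.basis '' {k | R.deg d k = m}) := by
  convert R.mem_span_of_lie_cart hx using 4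
  ext k
  simp only [deg]
  exact_mod_cast Iff.rfl

theorem comp_of_lie (d : Fin n → ℕ) {m : ℤ} {x : L}
    (hx : ⁅R.cart fun i => (d i : ℂ), x⁆ = (m : ℂ) • x) (m' : ℤ) :
    R.comp d m' x = if m = m' then x else 0 := by
  have h1 := R.mem_span_deg d hx
  clear hx
  induction h1 using Submodule.span_induction with
  | zero => simp
  | add x y _ _ hx hy => rw [map_add, hx, hy]; split_ifs <;> simp
  | smul a x _ hx => rw [map_smul, hx]; split_ifs <;> simp
  | mem x hx =>
    obtain ⟨k, rfl, rfl⟩ := hx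
    exact R.comp_basis d m' k

theorem comp_lie (d : Fin n → ℕ) {j : ℤ} {y : L}
    (hy : ⁅R.cart fun i => (d i : ℂ), y⁆ = (j : ℂ) • y) (m : ℤ) (x : L) :
    ⁅y, R.comp d m x⁆ = R.comp d (j + m) ⁅y, x⁆ := by
  change (ad ℂ L y ∘ₗ R.comp d m) x = (R.comp d (j + m) ∘ₗ ad ℂ L y) x
  congr 1
  refine R.basis.ext fun k => ?_
  simp only [LinearMap.comp_apply, comp_basis, ad_apply]
  have h1 := lie_mem_eigenspace hy (R.lie_cart_natCast d k)
  rw [R.comp_of_lie d (m := j + R.deg d k) (by push_cast; exact h1)]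
  by_cases hk : R.deg d k = m
  · simp [hk]
  · rw [if_neg hk, if_neg (by omega), lie_zero]

theorem eq_zero_of_lt (d : Fin n → ℕ) {M m : ℤ} (hM : ∀ k, R.deg d k ≤ M) (hm : M < m) {x : L}
    (hx : ⁅R.cart fun i => (d i : ℂ), x⁆ = (m : ℂ) • x) : x = 0 := by
  have h1 := R.mem_span_deg d hx
  have h2 : {k | R.deg d k = m} = ∅ := by
    ext k; simpa using ((hM k).trans_lt hm).ne
  simpa [h2] using h1

variable [FiniteDimensional ℂ L] [Fintype ι]

/-- Property (P) may be checked on homogeneous elements of the centre of the centralizer. -/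
theorem propertyP_of_homogeneous (d : Fin n → ℕ) {e f : L}
    (ht : IsSl2Triple (R.cart fun i => (d i : ℂ)) e f)
    (hinj : ∀ a : L, ⁅R.cart fun i => (d i : ℂ), a⁆ = 0 → ⁅e, a⁆ = 0 → a = 0)
    {M : ℤ} (hM : ∀ k, R.deg d k ≤ M) (hM' : ∃ k, R.deg d k = M)
    (hz : ∀ k : ℤ, 0 < k → ∀ u, InCenterOfCentralizer L e u → u ≠ 0 →
      ⁅R.cart fun i => (d i : ℂ), u⁆ = (k : ℂ) • u →
      ∀ z : L, ⁅R.cart fun i => (d i : ℂ), z⁆ = (M : ℂ) • z →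
        ∃ x : L, ⁅x, e⁆ = 0 ∧ ⁅R.cart fun i => (d i : ℂ), x⁆ = ((M + 2 - k : ℤ) : ℂ) • x ∧
          ⁅⁅f, x⁆, u⁆ = z) :
    PropertyP L e (R.cart fun i => (d i : ℂ)) f := by
  set h := R.cart fun i => (d i : ℂ) with hh
  have he : ⁅h, e⁆ = ((2 : ℤ) : ℂ) • e := by simpa using ht.lie_h_e_smul ℂ
  have hf : ⁅h, f⁆ = ((-2 : ℤ) : ℂ) • f := by rw [ht.lie_lie_smul_f ℂ]; simp
  have hpos {k : ℤ} {x : L} (hx : ⁅x, e⁆ = 0) (hk : ⁅h, x⁆ = (k : ℂ) • x) (hk0 : k ≤ 0) :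
      x = 0 := by
    have hx' : ⁅e, x⁆ = 0 := by rw [← lie_skew, hx, neg_zero]
    rcases hk0.lt_or_eq with hk0 | rfl
    · exact eq_zero_of_lie_e_of_neg ht hx' hk0 hk
    · exact hinj x (by simpa using hk) hx'
  have hcomp {x : L} (hx : ⁅x, e⁆ = 0) (m : ℤ) : ⁅R.comp d m x, e⁆ = 0 := by
    rw [← lie_skew, R.comp_lie d he, ← lie_skew, hx]; simp
  have hcent {x : L} (hx : InCenterOfCentralizer L e x) (m : ℤ) :
      InCenterOfCentralizer L e (R.comp d m x) := by
    refine ⟨hcomp hx.1 m, fun y hy => ?_⟩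
    rw [← R.sum_comp d y, lie_sum]
    refine Finset.sum_eq_zero fun j _ => ?_
    rw [← lie_skew, R.comp_lie d (R.lie_comp d j y), ← lie_skew, hx.2 _ (hcomp hy j)]
    simp
  have htop {z : L} (hzM : ⁅h, z⁆ = (M : ℂ) • z) {y : L} (hy : ⁅y, e⁆ = 0) : ⁅z, y⁆ = 0 := by
    rw [← R.sum_comp d y, lie_sum]
    refine Finset.sum_eq_zero fun j _ => ?_
    rcases le_or_gt j 0 with hj | hj
    · rw [hpos (hcomp hy j) (R.lie_comp d j y) hj, lie_zero]
    · refine R.eq_zero_of_lt d hM (m := M + j) (by omega) ?_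
      push_cast
      exact lie_mem_eigenspace hzM (R.lie_comp d j y)
  rintro m ⟨z₀, hz₀, -, hz₀m⟩ hmax v hv hv0 z - hzm
  have hm : m = M := by
    apply le_antisymm
    · have h1 := mt (R.basis.ext_elem_iff (x := z₀) (y := 0)).2 hz₀
      push Not at h1
      obtain ⟨k, hk⟩ := h1
      have h2 := mt (R.lie_cart_eq_smul_iff.1 hz₀m k) (by simpa using hk)
      rw [not_not] at h2
      have h3 : m = (R.deg d k : ℂ) := by rw [← h2, deg]; push_cast; rfl
      rw [h3]
      exact_mod_cast hM k
    · obtain ⟨k, hk⟩ := hM'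
      have h1 := R.lie_cart_natCast d k
      rw [hk] at h1
      refine hmax M ⟨R.basis k, R.basis.ne_zero k, ⟨?_, fun y hy => htop h1 hy⟩, h1⟩
      exact htop h1 (lie_self e)
  subst hm
  have hex : ∃ k, R.comp d k v ≠ 0 := by
    by_contra! h0
    exact hv0 (by rw [← R.sum_comp d v]; simp [h0])
  obtain ⟨k, hk, hkmin⟩ : ∃ k : ℤ, R.comp d k v ≠ 0 ∧ ∀ j, R.comp d j v ≠ 0 → k ≤ j := by
    have hb : ∀ k, R.comp d k v ≠ 0 → 0 ≤ k := fun k hk => by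
      by_contra! hk0
      exact hk (hpos (hcent hv k).1 (R.lie_comp d k v) hk0.le)
    obtain ⟨k, hk, hk'⟩ := Int.exists_least_of_bdd (P := fun k => R.comp d k v ≠ 0) ⟨0, hb⟩ hex
    exact ⟨k, hk, hk'⟩
  have hk0 : 0 < k := by
    by_contra! hk0
    exact hk (hpos (hcent hv k).1 (R.lie_comp d k v) hk0)
  obtain ⟨x, hxe, hxh, hxz⟩ := hz k hk0 _ (hcent hv k) hk (R.lie_comp d k v) z hzm
  refine ⟨x, hxe, ?_⟩
  have hw : ⁅h, ⁅f, x⁆⁆ = ((M - k : ℤ) : ℂ) • ⁅f, x⁆ := by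
    rw [lie_mem_eigenspace hf hxh]; push_cast; ring_nf
  have hkm : k ∈ Finset.univ.image (R.deg d) := by
    by_contra hkm
    refine hk ?_
    have h1 := R.sum_comp d (R.comp d k v)
    rw [Finset.sum_eq_zero] at h1
    · exact h1.symm
    · intro m hm
      rw [R.comp_of_lie d (R.lie_comp d k v), if_neg]
      rintro rfl
      exact hkm hm
  conv_lhs => rw [← R.sum_comp d v]
  rw [lie_sum, Finset.sum_eq_single_of_mem k hkm, hxz]
  intro j _ hj
  by_cases hj0 : R.comp d j v = 0
  · rw [hj0, lie_zero]
  · have := hkmin j hj0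
    refine R.eq_zero_of_lt d hM (m := M - k + j) (by omega) ?_
    push_cast
    push_cast at hw
    exact lie_mem_eigenspace hw (R.lie_comp d j v)

variable [IsKilling ℂ L]

/-- A distinguished triple is conjugate to a standard one, for a diagram satisfying the dimension
criterion. -/
theorem exists_aut_triple {e h f : L} (ht : IsSl2Triple h e f) (hdist : IsDistinguished L e) :
    ∃ d : Fin n → ℕ, (∀ i, d i ≤ 2) ∧
      Nat.card {k // R.deg d k = 0} = Nat.card {k // R.deg d k = 2} ∧
      ∀ e₀ f₀, IsSl2Triple (R.cart fun i => (d i : ℂ)) e₀ f₀ →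
        (∀ a : L, ⁅R.cart fun i => (d i : ℂ), a⁆ = 0 → ⁅e₀, a⁆ = 0 → a = 0) →
        ∃ φ : L ≃ₗ⁅ℂ⁆ L, φ h = R.cart (fun i => (d i : ℂ)) ∧ φ e = e₀ ∧ φ f = f₀ := by
  obtain ⟨φ, d, hd⟩ := R.exists_aut_dominant ht hdist
  have ht' := ht.map φ
  have hdist' := distinguished_map hdist φ
  rw [hd] at ht'
  have hinj : ∀ a : L, ⁅R.cart fun i => (d i : ℂ), a⁆ = 0 → ⁅φ e, a⁆ = 0 → a = 0 := fun a h1 h2 =>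
    eq_zero_of_lie_h_of_lie_e ht' hdist' h1 h2
  have hdim := finrank_eigenspace_zero_eq ht' hinj
  refine ⟨d, R.le_two_of_distinguished ht', ?_, fun e₀ f₀ ht₀ hinj₀ => ?_⟩
  · rw [R.finrank_eigenspace, R.finrank_eigenspace] at hdim
    convert hdim using 4 <;> (simp only [deg]; exact_mod_cast Iff.rfl)
  · obtain ⟨ψ, hψh, hψe⟩ := exists_aut_of_degree_two (ht'.lie_h_e_smul ℂ) (ht₀.lie_h_e_smul ℂ)
      hdim hinj hinj₀
    refine ⟨φ.trans ψ, ?_, hψe, ?_⟩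
    · rw [LieEquiv.trans_apply, hd, hψh]
    · have h1 := ht'.map ψ
      rw [hψh, hψe] at h1
      exact IsSl2Triple.eq_of_eq h1 ht₀

/-- Property (P) for all distinguished nilpotent elements follows from its verification on
standard triples. -/
theorem propertyP_of_distinguished
    (H : ∀ d : Fin n → ℕ, (∀ i, d i ≤ 2) →
      Nat.card {k // R.deg d k = 0} = Nat.card {k // R.deg d k = 2} →
      ∃ e f, IsSl2Triple (R.cart fun i => (d i : ℂ)) e f ∧
        (∀ a : L, ⁅R.cart fun i => (d i : ℂ), a⁆ = 0 → ⁅e, a⁆ = 0 → a = 0) ∧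
        PropertyP L e (R.cart fun i => (d i : ℂ)) f)
    {e h f : L} (ht : IsSl2Triple h e f) (hdist : IsDistinguished L e) : PropertyP L e h f := by
  obtain ⟨d, hd, hcard, hφ⟩ := R.exists_aut_triple ht hdist
  obtain ⟨e₀, f₀, ht₀, hinj, hP⟩ := H d hd hcard
  obtain ⟨φ, hφh, hφe, hφf⟩ := hφ e₀ f₀ ht₀ hinj
  rw [← hφh, ← hφe, ← hφf] at hP
  simpa using hP.map φ.symm

end RootBasis

end

/-- The root lattice of type `E₈`, in the basis of simple roots. -/
structure RootLattice where
  (a₁ a₂ a₃ a₄ a₅ a₆ a₇ a₈ : ℤ)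
  deriving DecidableEq

namespace RootLattice

instance : Zero RootLattice := ⟨⟨0, 0, 0, 0, 0, 0, 0, 0⟩⟩
instance : Add RootLattice := ⟨fun a b => ⟨a.a₁ + b.a₁, a.a₂ + b.a₂, a.a₃ + b.a₃, a.a₄ + b.a₄,
  a.a₅ + b.a₅, a.a₆ + b.a₆, a.a₇ + b.a₇, a.a₈ + b.a₈⟩⟩

theorem zero_def : (0 : RootLattice) = ⟨0, 0, 0, 0, 0, 0, 0, 0⟩ := rfl
theorem add_def (a b : RootLattice) : a + b = ⟨a.a₁ + b.a₁, a.a₂ + b.a₂, a.a₃ + b.a₃, a.a₄ + b.a₄,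
  a.a₅ + b.a₅, a.a₆ + b.a₆, a.a₇ + b.a₇, a.a₈ + b.a₈⟩ := rfl

/-- A bilinear form whose symmetrization is the Cartan form of `E₈`. -/
def form (a b : RootLattice) : ℤ :=
  a.a₁ * (b.a₁ - b.a₃) + a.a₂ * (b.a₂ - b.a₄) + a.a₃ * (b.a₃ - b.a₄) + a.a₄ * (b.a₄ - b.a₅) +
    a.a₅ * (b.a₅ - b.a₆) + a.a₆ * (b.a₆ - b.a₇) + a.a₇ * (b.a₇ - b.a₈) + a.a₈ * b.a₈

theorem form_add_left (a b c : RootLattice) : form (a + b) c = form a c + form b c := by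
  simp only [form, add_def]; ring

theorem form_add_right (a b c : RootLattice) : form a (b + c) = form a b + form a c := by
  simp only [form, add_def]; ring

theorem form_self_nonneg_and (a : RootLattice) : 0 ≤ form a a ∧ (form a a = 0 → a = 0) := by
  obtain ⟨a, b, c, d, e, f, g, h⟩ := a
  have key : 120 * form ⟨a, b, c, d, e, f, g, h⟩ ⟨a, b, c, d, e, f, g, h⟩ =
      30 * (2 * a - c) ^ 2 + 30 * (2 * b - d) ^ 2 + 10 * (3 * c - 2 * d) ^ 2 +
        2 * (5 * d - 6 * e) ^ 2 + 3 * (4 * e - 5 * f) ^ 2 + 5 * (3 * f - 4 * g) ^ 2 +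
        10 * (2 * g - 3 * h) ^ 2 + 30 * h ^ 2 := by
    simp only [form]; ring
  refine ⟨by nlinarith [sq_nonneg (2 * a - c), sq_nonneg (2 * b - d), sq_nonneg (3 * c - 2 * d),
    sq_nonneg (5 * d - 6 * e), sq_nonneg (4 * e - 5 * f), sq_nonneg (3 * f - 4 * g),
    sq_nonneg (2 * g - 3 * h), sq_nonneg h], fun h0 => ?_⟩
  rw [h0, mul_zero] at key
  have h1 : h ^ 2 = 0 := by
    nlinarith [sq_nonneg (2 * a - c), sq_nonneg (2 * b - d), sq_nonneg (3 * c - 2 * d),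
    sq_nonneg (5 * d - 6 * e), sq_nonneg (4 * e - 5 * f), sq_nonneg (3 * f - 4 * g),
    sq_nonneg (2 * g - 3 * h), sq_nonneg h]
  obtain rfl := pow_eq_zero_iff (two_ne_zero) |>.1 h1
  have h2 : (2 * g - 3 * 0) ^ 2 = 0 := by
    nlinarith [sq_nonneg (2 * a - c), sq_nonneg (2 * b - d), sq_nonneg (3 * c - 2 * d),
    sq_nonneg (5 * d - 6 * e), sq_nonneg (4 * e - 5 * f), sq_nonneg (3 * f - 4 * g),
    sq_nonneg (2 * g - 3 * 0)]
  obtain rfl : g = 0 := by have := pow_eq_zero_iff (two_ne_zero) |>.1 h2; omega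
  have h3 : (3 * f - 4 * 0) ^ 2 = 0 := by
    nlinarith [sq_nonneg (2 * a - c), sq_nonneg (2 * b - d), sq_nonneg (3 * c - 2 * d),
    sq_nonneg (5 * d - 6 * e), sq_nonneg (4 * e - 5 * f), sq_nonneg (3 * f - 4 * 0)]
  obtain rfl : f = 0 := by have := pow_eq_zero_iff (two_ne_zero) |>.1 h3; omega
  have h4 : (4 * e - 5 * 0) ^ 2 = 0 := by
    nlinarith [sq_nonneg (2 * a - c), sq_nonneg (2 * b - d), sq_nonneg (3 * c - 2 * d),
    sq_nonneg (5 * d - 6 * e), sq_nonneg (4 * e - 5 * 0)]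
  obtain rfl : e = 0 := by have := pow_eq_zero_iff (two_ne_zero) |>.1 h4; omega
  have h5 : (5 * d - 6 * 0) ^ 2 = 0 := by
    nlinarith [sq_nonneg (2 * a - c), sq_nonneg (2 * b - d), sq_nonneg (3 * c - 2 * d),
    sq_nonneg (5 * d - 6 * 0)]
  obtain rfl : d = 0 := by have := pow_eq_zero_iff (two_ne_zero) |>.1 h5; omega
  have h6 : (3 * c - 2 * 0) ^ 2 = 0 := by
    nlinarith [sq_nonneg (2 * a - c), sq_nonneg (2 * b - 0), sq_nonneg (3 * c - 2 * 0)]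
  obtain rfl : c = 0 := by have := pow_eq_zero_iff (two_ne_zero) |>.1 h6; omega
  have h7 : a ^ 2 = 0 := by nlinarith [sq_nonneg a, sq_nonneg b]
  have h8 : b ^ 2 = 0 := by nlinarith [sq_nonneg a, sq_nonneg b]
  obtain rfl := pow_eq_zero_iff (two_ne_zero) |>.1 h7
  obtain rfl := pow_eq_zero_iff (two_ne_zero) |>.1 h8
  rfl

/-- The Cartan form of `E₈`. -/
def pair (a b : RootLattice) : ℤ := form a b + form b a

/-- Pairing with a simple coroot. -/
def coroot (i : Fin 8) (a : RootLattice) : ℤ :=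
  match i with
  | 0 => 2 * a.a₁ - a.a₃
  | 1 => 2 * a.a₂ - a.a₄
  | 2 => 2 * a.a₃ - a.a₁ - a.a₄
  | 3 => 2 * a.a₄ - a.a₂ - a.a₃ - a.a₅
  | 4 => 2 * a.a₅ - a.a₄ - a.a₆
  | 5 => 2 * a.a₆ - a.a₅ - a.a₇
  | 6 => 2 * a.a₇ - a.a₆ - a.a₈
  | 7 => 2 * a.a₈ - a.a₇


theorem add_assoc' (a b c : RootLattice) : a + b + c = a + (b + c) := by
  simp only [add_def, add_assoc]

theorem add_comm' (a b : RootLattice) : a + b = b + a := by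
  simp only [add_def, add_comm]

theorem pair_comm (a b : RootLattice) : pair a b = pair b a := add_comm _ _

theorem pair_add_right (a b c : RootLattice) : pair a (b + c) = pair a b + pair a c := by
  simp only [pair, form_add_left, form_add_right]; ring

theorem form_self_add (a b : RootLattice) :
    form (a + b) (a + b) = form a a + form b b + pair a b := by
  simp only [pair, form_add_left, form_add_right]; ring

theorem coroot_add (i : Fin 8) (a b : RootLattice) :
    coroot i (a + b) = coroot i a + coroot i b := by
  fin_cases i <;> simp only [coroot, add_def] <;> ring

theorem coroot_zero (i : Fin 8) : coroot i 0 = 0 := by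
  fin_cases i <;> rfl

/-- The sign of a parity. -/
def sgn (n : ℤ) : ℤ := if n % 2 = 0 then 1 else -1

theorem sgn_eq_of_even {m n : ℤ} (h : (m - n) % 2 = 0) : sgn m = sgn n := by
  unfold sgn; split_ifs <;> omega

theorem sgn_eq_neg_of_odd {m n : ℤ} (h : (m - n) % 2 = 1) : sgn m = -sgn n := by
  unfold sgn; split_ifs <;> omega

theorem sgn_mul (m n : ℤ) : sgn m * sgn n = sgn (m + n) := by
  unfold sgn; split_ifs <;> omega

theorem pair_mem {a b : RootLattice} (ha : form a a = 1) (hb : form b b = 1) :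
    -2 ≤ pair a b ∧ (pair a b = -2 → a + b = 0) := by
  have h1 := form_self_add a b
  rw [ha, hb] at h1
  obtain ⟨h2, h3⟩ := form_self_nonneg_and (a + b)
  exact ⟨by omega, fun h => h3 (by omega)⟩

end RootLattice

section
open RootLattice

/-- Labels of the standard basis of the Lie algebra of type `E₈`: simple coroots and roots. -/
abbrev E8Key := Fin 8 ⊕ RootLattice

/-- A vector space containing the Lie algebra of type `E₈`, with junk basis vectors for the lattice
elements which are not roots. -/
def E8Model : Type := E8Key →₀ ℂ

noncomputable instance : AddCommGroup E8Model := inferInstanceAs (AddCommGroup (E8Key →₀ ℂ))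
noncomputable instance : Module ℂ E8Model := inferInstanceAs (Module ℂ (E8Key →₀ ℂ))

/-- Integral linear combinations of labels. -/
abbrev E8List := List (E8Key × ℤ)

namespace E8Model

/-- The standard basis vectors. -/
noncomputable def δ (k : E8Key) : E8Model := Finsupp.single k (1 : ℂ)

/-- The vector given by an integral linear combination of labels. -/
noncomputable def ev (l : E8List) : E8Model := (l.map fun p => (p.2 : ℂ) • δ p.1).sum

@[simp] theorem ev_nil : ev [] = 0 := rfl
@[simp] theorem ev_cons (p : E8Key × ℤ) (l : E8List) : ev (p :: l) = (p.2 : ℂ) • δ p.1 + ev l := by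
  simp [ev]
theorem ev_append (l l' : E8List) : ev (l ++ l') = ev l + ev l' := by simp [ev]

/-- The coroot of a lattice element. -/
def corootList (a : RootLattice) : E8List :=
  [(.inl 0, a.a₁), (.inl 1, a.a₂), (.inl 2, a.a₃), (.inl 3, a.a₄), (.inl 4, a.a₅), (.inl 5, a.a₆),
    (.inl 6, a.a₇), (.inl 7, a.a₈)]

/-- The bracket of two standard basis vectors. -/
def bracketKey : E8Key → E8Key → E8List
  | .inl _, .inl _ => []
  | .inl i, .inr a => if form a a = 1 then [(.inr a, coroot i a)] else []
  | .inr a, .inl i => if form a a = 1 then [(.inr a, -coroot i a)] else []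
  | .inr a, .inr b =>
    if pair a b = -1 then
      if form a a = 1 then if form b b = 1 then [(.inr (a + b), sgn (form a b))] else [] else []
    else if pair a b = -2 then
      if form a a = 1 then
        if form b b = 1 then (corootList a).map fun p => (p.1, sgn (form a b) * p.2) else []
      else []
    else []

/-- The bracket as a bilinear map. -/
noncomputable def bracket : E8Model →ₗ[ℂ] E8Model →ₗ[ℂ] E8Model :=
  Finsupp.linearCombination ℂ fun k =>
    (Finsupp.linearCombination ℂ fun l => ev (bracketKey k l) : (E8Key →₀ ℂ) →ₗ[ℂ] E8Model)

theorem bracket_δ (k l : E8Key) : bracket (δ k) (δ l) = ev (bracketKey k l) := by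
  simp only [bracket, δ]
  erw [Finsupp.linearCombination_single, one_smul, Finsupp.linearCombination_single, one_smul]

theorem ev_map_smul (c : ℤ) (l : E8List) :
    ev (l.map fun p => (p.1, c * p.2)) = (c : ℂ) • ev l := by
  induction l with
  | nil => simp
  | cons p l ih => simp [ih, smul_smul]

theorem bracket_inl_inl (i j : Fin 8) : bracket (δ (.inl i)) (δ (.inl j)) = 0 := by
  simp [bracket_δ, bracketKey]

theorem bracket_inl_inr {a : RootLattice} (ha : form a a = 1) (i : Fin 8) :
    bracket (δ (.inl i)) (δ (.inr a)) = (coroot i a : ℂ) • δ (.inr a) := by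
  simp [bracket_δ, bracketKey, ha]

theorem bracket_inr_inl {a : RootLattice} (ha : form a a = 1) (i : Fin 8) :
    bracket (δ (.inr a)) (δ (.inl i)) = -(coroot i a : ℂ) • δ (.inr a) := by
  simp [bracket_δ, bracketKey, ha]

theorem bracket_of_not_root {a : RootLattice} (ha : form a a ≠ 1) :
    bracket (δ (.inr a)) = 0 := by
  refine Finsupp.lhom_ext' fun k => LinearMap.ext_ring ?_
  change bracket (δ (.inr a)) (δ k) = 0
  rw [bracket_δ]
  rcases k with i | b <;> simp [bracketKey, ha]

theorem bracket_of_not_root' {a : RootLattice} (ha : form a a ≠ 1) (x : E8Model) :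
    bracket x (δ (.inr a)) = 0 := by
  change (bracket.flip (δ (.inr a))) x = (0 : E8Model →ₗ[ℂ] E8Model) x
  congr 1
  refine Finsupp.lhom_ext' fun k => LinearMap.ext_ring ?_
  change bracket (δ k) (δ (.inr a)) = 0
  rw [bracket_δ]
  rcases k with i | b <;> simp [bracketKey, ha]

variable {a b c : RootLattice} (ha : form a a = 1) (hb : form b b = 1) (hc : form c c = 1)

theorem bracket_eq_zero (h1 : pair a b ≠ -1) (h2 : pair a b ≠ -2) :
    bracket (δ (.inr a)) (δ (.inr b)) = 0 := by
  simp [bracket_δ, bracketKey, h1, h2]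

include ha hb in
theorem bracket_of_pair (h1 : pair a b = -1) :
    bracket (δ (.inr a)) (δ (.inr b)) = (sgn (form a b) : ℂ) • δ (.inr (a + b)) := by
  simp [bracket_δ, bracketKey, h1, ha, hb]

include ha hb in
theorem bracket_of_opp (h1 : pair a b = -2) :
    bracket (δ (.inr a)) (δ (.inr b)) = (sgn (form a b) : ℂ) • ev (corootList a) := by
  rw [bracket_δ, ← ev_map_smul]
  simp [bracketKey, h1, ha, hb]

end E8Model

end

section
open RootLattice
namespace E8Model

theorem induction_δ {P : E8Model → Prop} (h0 : P 0) (hadd : ∀ x y, P x → P y → P (x + y))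
    (hsmul : ∀ (r : ℂ) k, P (r • δ k)) (x : E8Model) : P x := by
  refine Finsupp.induction_linear (motive := P) x h0 hadd fun k r => ?_
  have h := hsmul r k
  rwa [show r • δ k = (Finsupp.single k r : E8Key →₀ ℂ) from Finsupp.smul_single_one k r] at h

theorem bracket_corootList {a : RootLattice} (ha : form a a = 1) (b : RootLattice) :
    bracket (δ (.inr a)) (ev (corootList b)) = (-pair b a : ℂ) • δ (.inr a) := by
  simp only [corootList, ev_cons, ev_nil, map_add, map_smul, bracket_inr_inl ha, map_zero, pair,
    form, coroot]
  push_cast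
  module

theorem bracket_inl_corootList (i : Fin 8) (b : RootLattice) :
    bracket (δ (.inl i)) (ev (corootList b)) = 0 := by
  simp [corootList, bracket_inl_inl]

theorem ev_corootList_add (a b : RootLattice) :
    ev (corootList (a + b)) = ev (corootList a) + ev (corootList b) := by
  simp only [corootList, ev_cons, ev_nil, add_def]
  push_cast
  module

theorem ev_corootList_zero : ev (corootList 0) = 0 := by
  simp [corootList, zero_def]

theorem bracket_skew_δ (k l : E8Key) : bracket (δ k) (δ l) = -bracket (δ l) (δ k) := by
  rcases k with i | a <;> rcases l with j | b
  · simp [bracket_inl_inl]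
  · by_cases hb : form b b = 1
    · rw [bracket_inl_inr hb, bracket_inr_inl hb, neg_smul, neg_neg]
    · rw [bracket_of_not_root hb, bracket_of_not_root' hb]; simp
  · by_cases hb : form a a = 1
    · rw [bracket_inl_inr hb, bracket_inr_inl hb, neg_smul]
    · rw [bracket_of_not_root hb, bracket_of_not_root' hb]; simp
  by_cases ha : form a a = 1
  swap
  · rw [bracket_of_not_root ha, bracket_of_not_root' ha]; simp
  by_cases hb : form b b = 1
  swap
  · rw [bracket_of_not_root hb, bracket_of_not_root' hb]; simp
  have hp := pair_comm a b
  by_cases h1 : pair a b = -1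
  · rw [bracket_of_pair ha hb h1, bracket_of_pair hb ha (hp ▸ h1), add_comm' b a,
      sgn_eq_neg_of_odd (m := form a b) (n := form b a) (by unfold pair at h1; omega)]
    push_cast
    module
  by_cases h2 : pair a b = -2
  · have h3 := (pair_mem ha hb).2 h2
    have h4 : ev (corootList b) = -ev (corootList a) := by
      rw [eq_neg_iff_add_eq_zero, ← ev_corootList_add, add_comm', h3, ev_corootList_zero]
    rw [bracket_of_opp ha hb h2, bracket_of_opp hb ha (hp ▸ h2),
      sgn_eq_of_even (m := form a b) (n := form b a) (by unfold pair at h2; omega), h4]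
    module
  · rw [bracket_eq_zero h1 h2, bracket_eq_zero (hp ▸ h1) (hp ▸ h2), neg_zero]

theorem bracket_skew (x y : E8Model) : bracket x y = -bracket y x := by
  induction x using induction_δ with
  | h0 => simp
  | hadd x x' hx hx' => simp only [map_add, LinearMap.add_apply, hx, hx', neg_add]
  | hsmul r k =>
    induction y using induction_δ with
    | h0 => simp
    | hadd y y' hy hy' => simp only [map_add, LinearMap.add_apply, hy, hy', neg_add]
    | hsmul s l =>
      simp only [map_smul, LinearMap.smul_apply]
      rw [bracket_skew_δ k l]
      module

section
variable {a b c : RootLattice} (ha : form a a = 1) (hb : form b b = 1) (hc : form c c = 1)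
include ha hb hc

theorem bracket_bracket_of_opp (h : pair b c = -2) :
    bracket (δ (.inr a)) (bracket (δ (.inr b)) (δ (.inr c))) =
      (-(sgn (form b c) * pair a b : ℤ) : ℂ) • δ (.inr a) := by
  rw [bracket_of_opp hb hc h, map_smul, bracket_corootList ha, pair_comm b a]
  push_cast
  module

omit ha in
theorem form_self_add_of_pair (h : pair b c = -1) : form (b + c) (b + c) = 1 := by
  rw [form_self_add, hb, hc, h]; rfl

theorem bracket_bracket_of_sum_eq_neg_one (h : pair b c = -1) (h' : pair a b + pair a c = -1) :
    bracket (δ (.inr a)) (bracket (δ (.inr b)) (δ (.inr c))) =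
      (sgn (form b c + form a b + form a c) : ℂ) • δ (.inr (a + b + c)) := by
  rw [bracket_of_pair hb hc h, map_smul,
    bracket_of_pair ha (form_self_add_of_pair hb hc h) (by rw [pair_add_right]; exact h'),
    smul_smul, add_assoc', ← Int.cast_mul, sgn_mul, form_add_right, add_assoc]

theorem bracket_bracket_of_sum_eq_neg_two (h : pair b c = -1) (h' : pair a b + pair a c = -2) :
    bracket (δ (.inr a)) (bracket (δ (.inr b)) (δ (.inr c))) =
      (sgn (form b c + form a b + form a c) : ℂ) • ev (corootList a) := by
  rw [bracket_of_pair hb hc h, map_smul,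
    bracket_of_opp ha (form_self_add_of_pair hb hc h) (by rw [pair_add_right]; exact h'),
    smul_smul, ← Int.cast_mul, sgn_mul, form_add_right, add_assoc]

omit ha in
theorem bracket_bracket_eq_zero (h : pair b c = -1 → pair a b + pair a c ≠ -1 ∧
      pair a b + pair a c ≠ -2) (h2 : pair b c ≠ -2) :
    bracket (δ (.inr a)) (bracket (δ (.inr b)) (δ (.inr c))) = 0 := by
  by_cases h1 : pair b c = -1
  · obtain ⟨h3, h4⟩ := h h1
    rw [bracket_of_pair hb hc h1, map_smul, bracket_eq_zero, smul_zero] <;>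
    rwa [pair_add_right]
  · rw [bracket_eq_zero h1 h2, map_zero]

theorem jacobi_of_opp (h : pair a b = -2) :
    bracket (δ (.inr a)) (bracket (δ (.inr b)) (δ (.inr c))) +
      bracket (δ (.inr b)) (bracket (δ (.inr c)) (δ (.inr a))) +
      bracket (δ (.inr c)) (bracket (δ (.inr a)) (δ (.inr b))) = 0 := by
  have hab := (pair_mem ha hb).2 h
  have fr (x : RootLattice) : form x a + form x b = 0 := by
    rw [← form_add_right, hab]; simp [form, zero_def]
  have fl (x : RootLattice) : form a x + form b x = 0 := by
    rw [← form_add_left, hab]; simp [form, zero_def]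
  have e1 : form a b = -1 := by have := fr a; omega
  have e2 : form b a = -1 := by have := fr b; omega
  have hr : pair b c = -pair a c := by unfold pair; linarith [fr c, fl c]
  have h1 := (pair_mem ha hc)
  have h2 := (pair_mem hb hc)
  have ca := pair_comm c a
  have ba := pair_comm b a
  have z3 : a + b + c = c := by rw [hab]; simp [zero_def, add_def]
  have z4 : b + c + a = c := by rw [add_comm', ← add_assoc', z3]
  rw [bracket_bracket_of_opp hc ha hb h, e1]
  have hcases : pair a c = 0 ∨ pair a c = 1 ∨ pair a c = -1 ∨ pair a c = 2 ∨ pair a c = -2 := by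
    omega
  rcases hcases with h0 | h0 | h0 | h0 | h0
  · rw [bracket_bracket_eq_zero hb hc (by omega) (by omega),
      bracket_bracket_eq_zero hc ha (by omega) (by omega), ca, h0]
    simp
  · rw [bracket_bracket_of_sum_eq_neg_one ha hb hc (by omega) (by omega),
      bracket_bracket_eq_zero hc ha (by omega) (by omega), ca, h0, z3, e1,
      show form b c + -1 + form a c = -1 by linarith [fl c]]
    simp [sgn]
  · rw [bracket_bracket_of_sum_eq_neg_one hb hc ha (by omega) (by omega),
      bracket_bracket_eq_zero hb hc (by omega) (by omega), ca, h0, z4,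
      sgn_eq_of_even (n := 0) (by unfold pair at h0; have := fl c; omega)]
    simp [sgn]
  · have hc' : c = a := by
      have := h2.2 (by omega)
      rw [← z4, this]; simp [zero_def, add_def]
    rw [bracket_bracket_of_opp ha hb hc (by omega),
      bracket_bracket_eq_zero hc ha (by omega) (by omega), ca, h0, h, hc', e2]
    simp [sgn]
  · have hc' : c = b := by
      have := h1.2 (by omega)
      rw [← z3, add_assoc', add_comm', add_assoc', add_comm' c, this]; simp [zero_def, add_def]
    rw [bracket_bracket_of_opp hb hc ha (by omega),
      bracket_bracket_eq_zero hb hc (by omega) (by omega), ca, h0, hr, h0, hc', e2]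
    simp [sgn]

theorem jacobi_of_two_pairs (h1 : pair b c = -1) (h2 : pair c a = -1) (h0 : pair a b = 0) :
    bracket (δ (.inr a)) (bracket (δ (.inr b)) (δ (.inr c))) +
      bracket (δ (.inr b)) (bracket (δ (.inr c)) (δ (.inr a))) +
      bracket (δ (.inr c)) (bracket (δ (.inr a)) (δ (.inr b))) = 0 := by
  have h3 := pair_comm a c
  have h4 := pair_comm b a
  rw [bracket_bracket_of_sum_eq_neg_one ha hb hc h1 (by omega),
    bracket_bracket_of_sum_eq_neg_one hb hc ha h2 (by omega),
    bracket_bracket_eq_zero (a := c) ha hb (by omega) (by omega), add_comm' b c,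
    add_assoc' c b a, add_comm' c, add_comm' b a,
    sgn_eq_neg_of_odd (m := form b c + form a b + form a c)
      (n := form c a + form b c + form b a) (by unfold pair at *; omega)]
  push_cast
  module

theorem jacobi_root :
    bracket (δ (.inr a)) (bracket (δ (.inr b)) (δ (.inr c))) +
      bracket (δ (.inr b)) (bracket (δ (.inr c)) (δ (.inr a))) +
      bracket (δ (.inr c)) (bracket (δ (.inr a)) (δ (.inr b))) = 0 := by
  by_cases p2 : pair a b = -2
  · exact jacobi_of_opp ha hb hc p2
  by_cases q2 : pair b c = -2
  · rw [← jacobi_of_opp hb hc ha q2]; abel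
  by_cases r2 : pair c a = -2
  · rw [← jacobi_of_opp hc ha hb r2]; abel
  have hp := pair_mem ha hb
  have hq := pair_mem hb hc
  have hr := pair_mem hc ha
  have ac := pair_comm a c
  have ba := pair_comm b a
  have cb := pair_comm c b
  have hsum : form (a + b + c) (a + b + c) = 3 + pair a b + pair b c + pair c a := by
    rw [form_self_add, form_self_add, ha, hb, hc, pair_comm (a + b), pair_add_right]; linarith
  obtain ⟨hs, hs0⟩ := form_self_nonneg_and (a + b + c)
  by_cases p1 : pair a b = -1 <;> by_cases q1 : pair b c = -1 <;> by_cases r1 : pair c a = -1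
  · have h0 := hs0 (by omega)
    rw [bracket_bracket_of_sum_eq_neg_two ha hb hc q1 (by omega),
      bracket_bracket_of_sum_eq_neg_two hb hc ha r1 (by omega),
      bracket_bracket_of_sum_eq_neg_two hc ha hb p1 (by omega),
      sgn_eq_of_even (m := form c a + form b c + form b a) (n := form b c + form a b + form a c)
        (by unfold pair at *; omega),
      sgn_eq_of_even (m := form a b + form c a + form c b) (n := form b c + form a b + form a c)
        (by unfold pair at *; omega), ← smul_add, ← smul_add, ← ev_corootList_add,
      ← ev_corootList_add, h0, ev_corootList_zero, smul_zero]
  · by_cases r0 : pair c a = 0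
    · rw [← jacobi_of_two_pairs hc ha hb p1 q1 r0]; abel
    · rw [bracket_bracket_eq_zero hb hc (by omega) (by omega),
        bracket_bracket_eq_zero hc ha (by omega) (by omega),
        bracket_bracket_eq_zero ha hb (by omega) (by omega)]; simp
  · by_cases q0 : pair b c = 0
    · rw [← jacobi_of_two_pairs hb hc ha r1 p1 q0]; abel
    · rw [bracket_bracket_eq_zero hb hc (by omega) (by omega),
        bracket_bracket_eq_zero hc ha (by omega) (by omega),
        bracket_bracket_eq_zero ha hb (by omega) (by omega)]; simp
  · rw [bracket_bracket_eq_zero hb hc (by omega) (by omega),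
        bracket_bracket_eq_zero hc ha (by omega) (by omega),
        bracket_bracket_eq_zero ha hb (by omega) (by omega)]; simp
  · by_cases p0 : pair a b = 0
    · exact jacobi_of_two_pairs ha hb hc q1 r1 p0
    · rw [bracket_bracket_eq_zero hb hc (by omega) (by omega),
        bracket_bracket_eq_zero hc ha (by omega) (by omega),
        bracket_bracket_eq_zero ha hb (by omega) (by omega)]; simp
  all_goals
    rw [bracket_bracket_eq_zero hb hc (by omega) (by omega),
      bracket_bracket_eq_zero hc ha (by omega) (by omega),
      bracket_bracket_eq_zero ha hb (by omega) (by omega)]; simp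

end

/-- The Jacobi identity on the standard basis. -/
theorem jacobi_δ (k l m : E8Key) :
    bracket (δ k) (bracket (δ l) (δ m)) + bracket (δ l) (bracket (δ m) (δ k)) +
      bracket (δ m) (bracket (δ k) (δ l)) = 0 := by
  have h2 (i : Fin 8) (a b : RootLattice) (ha : form a a = 1) (hb : form b b = 1) :
      bracket (δ (.inl i)) (bracket (δ (.inr a)) (δ (.inr b))) +
        bracket (δ (.inr a)) (bracket (δ (.inr b)) (δ (.inl i))) +
        bracket (δ (.inr b)) (bracket (δ (.inl i)) (δ (.inr a))) = 0 := by
    rw [bracket_inr_inl hb, bracket_inl_inr ha, map_smul, map_smul, bracket_skew (δ (.inr b))]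
    by_cases p1 : pair a b = -1
    · have hab : form (a + b) (a + b) = 1 := form_self_add_of_pair ha hb p1
      rw [bracket_of_pair ha hb p1, map_smul, bracket_inl_inr hab, coroot_add]
      push_cast; module
    by_cases p2 : pair a b = -2
    · have h0 := (pair_mem ha hb).2 p2
      have h1 : coroot i a = -coroot i b := by
        rw [eq_neg_iff_add_eq_zero, ← coroot_add, h0, coroot_zero]
      rw [bracket_of_opp ha hb p2, map_smul, bracket_inl_corootList, h1]
      push_cast; module
    · rw [bracket_eq_zero p1 p2]; simp
  have h1 (i j : Fin 8) (a : RootLattice) (ha : form a a = 1) :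
      bracket (δ (.inl i)) (bracket (δ (.inl j)) (δ (.inr a))) +
        bracket (δ (.inl j)) (bracket (δ (.inr a)) (δ (.inl i))) +
        bracket (δ (.inr a)) (bracket (δ (.inl i)) (δ (.inl j))) = 0 := by
    simp only [bracket_inr_inl ha, bracket_inl_inr ha, map_smul, bracket_inl_inl, map_zero]
    module
  have hn (a : RootLattice) (ha : form a a ≠ 1) (x y : E8Model) :
      bracket (δ (.inr a)) (bracket x y) + bracket x (bracket y (δ (.inr a))) +
        bracket y (bracket (δ (.inr a)) x) = 0 := by
    rw [bracket_of_not_root ha, bracket_of_not_root' ha]; simp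
  by_cases hk : ∃ a, k = .inr a ∧ form a a ≠ 1
  · obtain ⟨a, rfl, ha⟩ := hk; exact hn a ha _ _
  by_cases hl : ∃ a, l = .inr a ∧ form a a ≠ 1
  · obtain ⟨a, rfl, ha⟩ := hl; rw [← hn a ha (δ m) (δ k)]; abel
  by_cases hm : ∃ a, m = .inr a ∧ form a a ≠ 1
  · obtain ⟨a, rfl, ha⟩ := hm; rw [← hn a ha (δ k) (δ l)]; abel
  push Not at hk hl hm
  rcases k with i | a <;> rcases l with j | b <;> rcases m with r | c
  · simp [bracket_inl_inl]
  · exact h1 i j c (hm c rfl)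
  · rw [← h1 r i b (hl b rfl)]; abel
  · exact h2 i b c (hl b rfl) (hm c rfl)
  · rw [← h1 j r a (hk a rfl)]; abel
  · rw [← h2 j c a (hm c rfl) (hk a rfl)]; abel
  · rw [← h2 r a b (hk a rfl) (hl b rfl)]; abel
  · exact jacobi_root (hk a rfl) (hl b rfl) (hm c rfl)

theorem jacobi (x y z : E8Model) :
    bracket x (bracket y z) + bracket y (bracket z x) + bracket z (bracket x y) = 0 := by
  induction x using induction_δ with
  | h0 => simp
  | hadd x x' hx hx' =>
    simp only [map_add, LinearMap.add_apply]
    rw [← add_zero (0 : E8Model)]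
    nth_rw 1 [← hx]
    rw [← hx']
    abel
  | hsmul r k =>
    induction y using induction_δ with
    | h0 => simp
    | hadd y y' hy hy' =>
      simp only [map_add, LinearMap.add_apply]
      rw [← add_zero (0 : E8Model)]
      nth_rw 1 [← hy]
      rw [← hy']
      abel
    | hsmul s l =>
      induction z using induction_δ with
      | h0 => simp
      | hadd z z' hz hz' =>
        simp only [map_add, LinearMap.add_apply]
        rw [← add_zero (0 : E8Model)]
        nth_rw 1 [← hz]
        rw [← hz']
        abel
      | hsmul t m =>
        simp only [map_smul, LinearMap.smul_apply]
        rw [← smul_zero (r * s * t), ← jacobi_δ k l m]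
        module

noncomputable instance : LieRing E8Model where
  bracket x y := bracket x y
  add_lie x y z := by simp
  lie_add x y z := by simp
  lie_self x := by
    have h : (2 : ℂ) • bracket x x = 0 := by
      rw [two_smul]; nth_rw 1 [bracket_skew]; simp
    exact (smul_eq_zero.1 h).resolve_left two_ne_zero
  leibniz_lie x y z := by
    change bracket x (bracket y z) = bracket (bracket x y) z + bracket y (bracket x z)
    rw [bracket_skew (bracket x y) z, bracket_skew x z, map_neg, ← sub_eq_zero, ← jacobi x y z]
    abel

noncomputable instance : LieAlgebra ℂ E8Model where
  lie_smul r x y := map_smul (bracket x) r y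

theorem lie_δ (k l : E8Key) : ⁅δ k, δ l⁆ = ev (bracketKey k l) := bracket_δ k l

/-- The bracket of two integral linear combinations. -/
def brL (x y : E8List) : E8List :=
  x.flatMap fun p => y.flatMap fun q => (bracketKey p.1 q.1).map fun r => (r.1, p.2 * q.2 * r.2)

theorem ev_brL (x y : E8List) : ev (brL x y) = ⁅ev x, ev y⁆ := by
  have h (p : E8Key × ℤ) : ev (y.flatMap fun q => (bracketKey p.1 q.1).map fun r =>
      (r.1, p.2 * q.2 * r.2)) = ⁅(p.2 : ℂ) • δ p.1, ev y⁆ := by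
    induction y with
    | nil => simp
    | cons q y ih =>
      rw [List.flatMap_cons, ev_append, ih, ev_cons, lie_add, ev_map_smul, lie_smul, smul_lie,
        smul_lie, lie_δ, smul_smul]
      push_cast
      module
  unfold brL
  induction x with
  | nil => simp
  | cons p x ih => rw [List.flatMap_cons, ev_append, ih, h, ev_cons, add_lie]

end E8Model

end

/-- Formal integral linear combinations of indices. -/
abbrev IntComb := List (ℕ × ℤ)

namespace IntComb

section Eval
variable {M N : Type*} [AddCommGroup M] [Module ℂ M] [AddCommGroup N] [Module ℂ N]

/-- The value of a formal linear combination. -/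
def ev (v : ℕ → M) (l : IntComb) : M := (l.map fun p => (p.2 : ℂ) • v p.1).sum

variable (v : ℕ → M)

@[simp] theorem ev_nil : ev v [] = 0 := rfl
@[simp] theorem ev_cons (p : ℕ × ℤ) (l : IntComb) : ev v (p :: l) = (p.2 : ℂ) • v p.1 + ev v l := by
  simp [ev]
@[simp] theorem ev_append (l l' : IntComb) : ev v (l ++ l') = ev v l + ev v l' := by simp [ev]

/-- Multiplication by an integer. -/
def smul (c : ℤ) (l : IntComb) : IntComb := l.map fun p => (p.1, c * p.2)

@[simp] theorem ev_smul (c : ℤ) (l : IntComb) : ev v (smul c l) = (c : ℂ) • ev v l := by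
  unfold smul
  induction l with
  | nil => simp
  | cons p l ih => simp [ih, smul_smul]

theorem map_ev (T : M →ₗ[ℂ] N) (l : IntComb) : T (ev v l) = ev (fun k => T (v k)) l := by
  induction l with
  | nil => simp
  | cons p l ih => simp [ih]

theorem ev_mem_span {s : Set ℕ} {l : IntComb} (h : ∀ p ∈ l, p.1 ∈ s) :
    ev v l ∈ Submodule.span ℂ (v '' s) := by
  induction l with
  | nil => simp
  | cons p l ih =>
    rw [ev_cons]
    exact add_mem (Submodule.smul_mem _ _ (Submodule.subset_span ⟨_, h p (by simp), rfl⟩))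
      (ih fun q hq => h q (by simp [hq]))

theorem ev_map_fst (f : ℕ → ℕ) (l : IntComb) :
    ev v (l.map fun p => (f p.1, p.2)) = ev (fun k => v (f k)) l := by
  induction l with
  | nil => simp
  | cons p l ih => simp [ih]

/-- Insertion in a sorted combination. -/
def insert (k : ℕ) (c : ℤ) : IntComb → IntComb
  | [] => [(k, c)]
  | (k', c') :: t =>
    bif Nat.beq k k' then (k', c + c') :: t
    else bif Nat.blt k k' then (k, c) :: (k', c') :: t
    else (k', c') :: insert k c t

theorem ev_insert (k : ℕ) (c : ℤ) (l : IntComb) :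
    ev v (insert k c l) = (c : ℂ) • v k + ev v l := by
  induction l with
  | nil => simp [insert]
  | cons p t ih =>
    obtain ⟨k', c'⟩ := p
    rw [insert]
    cases h : Nat.beq k k' with
    | true =>
      obtain rfl := Nat.eq_of_beq_eq_true h
      simp [add_smul, add_assoc]
    | false =>
      cases Nat.blt k k'
      · simp [ih, add_left_comm]
      · simp

/-- Whether an integer vanishes. -/
def isZeroInt : ℤ → Bool
  | .ofNat n => Nat.beq n 0
  | .negSucc _ => false

theorem isZeroInt_iff (c : ℤ) : isZeroInt c = true ↔ c = 0 := by
  cases c with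
  | ofNat n => simp [isZeroInt]
  | negSucc n => simp [isZeroInt]

/-- Collecting equal indices, given an initial sorted combination. -/
def collect (l acc : IntComb) : IntComb := l.foldr (fun p acc => insert p.1 p.2 acc) acc

theorem ev_collect (l acc : IntComb) : ev v (collect l acc) = ev v l + ev v acc := by
  induction l with
  | nil => simp [collect]
  | cons p l ih =>
    change ev v (insert p.1 p.2 (collect l acc)) = _
    rw [ev_insert, ih, ev_cons, add_assoc]

/-- Removing zero coefficients. -/
def clean (l : IntComb) : IntComb := l.filter fun p => !isZeroInt p.2

theorem ev_clean (l : IntComb) : ev v (clean l) = ev v l := by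
  unfold clean
  induction l with
  | nil => simp
  | cons p l ih =>
    rw [List.filter_cons]
    cases h : isZeroInt p.2 with
    | true => simp [ih, (isZeroInt_iff _).1 h]
    | false => simp [ih]

/-- Whether a combination is zero. -/
def isZero (l : IntComb) : Bool := (collect l []).all fun p => isZeroInt p.2

theorem ev_eq_zero {l : IntComb} (h : isZero l = true) : ev v l = 0 := by
  have h1 : clean (collect l []) = [] := by
    rw [isZero, List.all_eq_true] at h
    exact List.filter_eq_nil_iff.2 fun p hp => by simp [h p hp]
  rw [← add_zero (ev v l), ← ev_nil v, ← ev_collect, ← ev_clean, h1]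

/-- Whether two combinations are equal. -/
def isEq (l l' : IntComb) : Bool := isZero (l ++ smul (-1) l')

theorem ev_eq_ev {l l' : IntComb} (h : isEq l l' = true) : ev v l = ev v l' := by
  have := ev_eq_zero v h
  simpa [← sub_eq_add_neg, sub_eq_zero] using this

/-- The coefficient of an index. -/
def coef (k : ℕ) : IntComb → ℤ
  | [] => 0
  | p :: t => bif Nat.beq k p.1 then p.2 + coef k t else coef k t

theorem ev_single_apply (k : ℕ) (l : IntComb) :
    ev (fun k => Finsupp.single k (1 : ℂ)) l k = coef k l := by
  induction l with
  | nil => simp [coef]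
  | cons p t ih =>
    rw [ev_cons, coef, Finsupp.add_apply, ih, Finsupp.smul_apply]
    cases h : Nat.beq k p.1 with
    | true => simp [Nat.eq_of_beq_eq_true h]
    | false =>
      have : p.1 ≠ k := fun h' => by simp [h'] at h
      simp [this]

/-- Whether one combination is a scalar multiple of a nonzero multiple of the other:
returns the two multipliers. -/
def multipliers (r z : IntComb) : ℤ × ℤ :=
  match z with
  | [] => (1, 0)
  | p :: _ => (coef p.1 z, coef p.1 r)

/-- Whether a combination is a scalar multiple of another one. -/
def isMultiple (r z : IntComb) : Bool :=
  !isZeroInt (multipliers r z).1 && isEq (smul (multipliers r z).1 r) (smul (multipliers r z).2 z)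

/-- Whether a combination is a nonzero scalar multiple of another one. -/
def isNonzeroMultiple (r z : IntComb) : Bool :=
  isMultiple r z && !isZeroInt (multipliers r z).2

theorem exists_of_isNonzeroMultiple {r z : IntComb} (h : isNonzeroMultiple r z = true) :
    ∃ c : ℂ, c ≠ 0 ∧ ev v r = c • ev v z := by
  rw [isNonzeroMultiple, isMultiple, Bool.and_eq_true, Bool.and_eq_true, Bool.not_eq_true',
    Bool.not_eq_true', ← Bool.not_eq_true, ← Bool.not_eq_true, isZeroInt_iff, isZeroInt_iff] at h
  have h1 := ev_eq_ev v h.1.2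
  rw [ev_smul, ev_smul] at h1
  have h0 : ((multipliers r z).1 : ℂ) ≠ 0 := by exact_mod_cast h.1.1
  have h2 : ((multipliers r z).2 : ℂ) ≠ 0 := by exact_mod_cast h.2
  exact ⟨((multipliers r z).1 : ℂ)⁻¹ * (multipliers r z).2, mul_ne_zero (inv_ne_zero h0) h2, by
    rw [mul_smul, ← h1, smul_smul, inv_mul_cancel₀ h0, one_smul]⟩

end Eval

/-- Elimination of an index in a combination with the help of another one. -/
def eliminate (k : ℕ) (c : ℤ) (r r' : IntComb) : IntComb :=
  let c' := coef k r'
  bif isZeroInt c' then r' else clean (collect (smul (-c') r) (smul c r'))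

/-- Gaussian elimination: whether the rows are linearly independent. -/
def indep : ℕ → List IntComb → Bool
  | _, [] => true
  | 0, _ :: _ => false
  | _ + 1, [] :: _ => false
  | m + 1, ((k, c) :: t) :: rs =>
    !isZeroInt (coef k ((k, c) :: t)) && indep m (rs.map
      (eliminate k (coef k ((k, c) :: t)) ((k, c) :: t)))

/-- The vector of a row. -/
noncomputable abbrev rowVec (r : IntComb) : ℕ →₀ ℂ := ev (fun k => Finsupp.single k (1 : ℂ)) r

theorem rowVec_eliminate {k : ℕ} {c : ℤ} (hc : c ≠ 0) (r r' : IntComb) : ∃ s : ℂ, s ≠ 0 ∧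
    s • rowVec (eliminate k c r r') = rowVec r' - ((c : ℂ)⁻¹ * coef k r') • rowVec r := by
  cases h0 : isZeroInt (coef k r') with
  | true =>
    have h1 := (isZeroInt_iff _).1 h0
    rw [h1] at h0
    exact ⟨1, one_ne_zero, by simp [eliminate, h0, h1]⟩
  | false =>
    have hc' : (c : ℂ) ≠ 0 := by exact_mod_cast hc
    refine ⟨(c : ℂ)⁻¹, inv_ne_zero hc', ?_⟩
    simp only [eliminate, h0, rowVec, cond_false, ev_clean, ev_collect, ev_smul, smul_add,
      smul_smul, inv_mul_cancel₀ hc', one_smul]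
    push_cast
    module

theorem eq_zero_of_indep {m : ℕ} {w : List (ℂ × IntComb)} (h : indep m (w.map Prod.snd) = true)
    (hc : (w.map fun p => p.1 • rowVec p.2).sum = 0) : ∀ p ∈ w, p.1 = 0 := by
  induction m generalizing w with
  | zero =>
    cases w with
    | nil => simp
    | cons r rs => simp [indep] at h
  | succ m ih =>
    rcases w with _ | ⟨⟨a, _ | ⟨⟨k, b⟩, t⟩⟩, w⟩
    · simp
    · simp [indep] at h
    rw [List.map_cons, indep, Bool.and_eq_true, Bool.not_eq_true', ← Bool.not_eq_true,
      isZeroInt_iff] at h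
    set r : IntComb := (k, b) :: t
    obtain ⟨hp, h⟩ := h
    have hp' : (coef k r : ℂ) ≠ 0 := by exact_mod_cast hp
    rw [List.map_cons, List.sum_cons] at hc
    have hP : a * coef k r + (w.map fun p => p.1 * (coef k p.2 : ℂ)).sum = 0 := by
      have := congrArg (Finsupp.lapply (R := ℂ) k) hc
      rw [map_add, map_list_sum, List.map_map] at this
      simpa [rowVec, ev_single_apply, Function.comp_def, -ev_cons] using this
    choose s hs hs' using fun r' => rowVec_eliminate (k := k) hp r r'
    have hzero : ∀ p ∈ w, p.1 = 0 := by
      have := ih (w := w.map fun p => (p.1 * s p.2, eliminate k (coef k r) r p.2))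
        (by simpa [List.map_map, Function.comp_def] using h) ?_
      · intro p hp
        simpa [hs] using this _ (List.mem_map_of_mem hp)
      · rw [List.map_map]
        have h1 : ∀ w' : List (ℂ × IntComb), (w'.map ((fun p : ℂ × IntComb => p.1 • rowVec p.2) ∘
            fun p => (p.1 * s p.2, eliminate k (coef k r) r p.2))).sum =
            (w'.map fun p => p.1 • rowVec p.2).sum -
            ((coef k r : ℂ)⁻¹ * (w'.map fun p => p.1 * (coef k p.2 : ℂ)).sum) • rowVec r := by
          intro w'
          induction w' with
          | nil => simp
          | cons p w' ih' =>
            simp only [List.map_cons, List.sum_cons, ih', Function.comp_apply, mul_smul, hs']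
            module
        rw [h1, eq_neg_of_add_eq_zero_right hP, eq_neg_of_add_eq_zero_right hc]
        rw [mul_neg, mul_comm a, inv_mul_cancel_left₀ hp']
        module
    rw [List.map_congr_left (g := fun _ => 0) fun p hp => by rw [hzero p hp, zero_mul]] at hP
    have ha : a = 0 := by simpa [hp'] using hP
    intro p hp
    rcases List.mem_cons.1 hp with rfl | hp
    · exact ha
    · exact hzero p hp

end IntComb

section Serre
open CartanMatrix

theorem FreeLieAlgebra.subalgebra_eq_top {X : Type*} (S : LieSubalgebra ℂ (FreeLieAlgebra ℂ X))
    (h : ∀ x, FreeLieAlgebra.of ℂ x ∈ S) : S = ⊤ := by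
  let g : FreeLieAlgebra ℂ X →ₗ⁅ℂ⁆ S := FreeLieAlgebra.lift ℂ fun x => ⟨_, h x⟩
  have hg : S.incl.comp g = LieHom.id := FreeLieAlgebra.hom_ext (by
    simp [g, FreeLieAlgebra.lift_of_apply])
  refine eq_top_iff.2 fun x _ => ?_
  rw [← LieHom.id_apply (R := ℂ) x, ← hg]
  exact (g x).2

variable {n : ℕ} (A : Matrix (Fin n) (Fin n) ℤ)

/-- The image of a generator in the Lie algebra defined by the Serre relations. -/
noncomputable def serreGenerator (x : Generators (Fin n)) : A.ToLieAlgebra ℂ :=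
  LieSubmodule.Quotient.mk (N := Relations.toIdeal ℂ A) (FreeLieAlgebra.of ℂ x)

theorem serre_subalgebra_eq_top (S : LieSubalgebra ℂ (A.ToLieAlgebra ℂ))
    (h : ∀ x, serreGenerator A x ∈ S) : S = ⊤ := by
  let S' : LieSubalgebra ℂ (FreeLieAlgebra ℂ (Generators (Fin n))) :=
    { carrier := {x | (LieSubmodule.Quotient.mk (N := Relations.toIdeal ℂ A) x :
        A.ToLieAlgebra ℂ) ∈ S}
      add_mem' := fun hx hy => S.add_mem hx hy
      zero_mem' := S.zero_mem
      smul_mem' := fun c _ hx => S.smul_mem c hx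
      lie_mem' := fun hx hy => S.lie_mem hx hy }
  have hS' : S' = ⊤ := FreeLieAlgebra.subalgebra_eq_top S' h
  refine eq_top_iff.2 fun x _ => ?_
  obtain ⟨y, rfl⟩ := LieSubmodule.Quotient.surjective_mk' (Relations.toIdeal ℂ A) x
  have : y ∈ S' := hS' ▸ LieSubalgebra.mem_top y
  exact this

variable {M : Type*} [LieRing M] [LieAlgebra ℂ M] (H E F : Fin n → M)

/-- The value of a generator. -/
def Generators.eval : Generators (Fin n) → M
  | .H i => H i
  | .E i => E i
  | .F i => F i

/-- A Lie algebra homomorphism from the Lie algebra defined by the Serre relations. -/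
theorem exists_serre_lift (hHH : ∀ i j, ⁅H i, H j⁆ = 0)
    (hEF : ∀ i j, ⁅E i, F j⁆ = if i = j then H i else 0)
    (hHE : ∀ i j, ⁅H i, E j⁆ = A i j • E j) (hHF : ∀ i j, ⁅H i, F j⁆ = -A i j • F j)
    (hE : ∀ i j, (LieAlgebra.ad ℂ M (E i) ^ (-A i j).toNat) ⁅E i, E j⁆ = 0)
    (hF : ∀ i j, (LieAlgebra.ad ℂ M (F i) ^ (-A i j).toNat) ⁅F i, F j⁆ = 0) :
    ∃ ψ : A.ToLieAlgebra ℂ →ₗ⁅ℂ⁆ M,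
      ∀ x, ψ (serreGenerator A x) = Generators.eval H E F x := by
  set Φ : FreeLieAlgebra ℂ (Generators (Fin n)) →ₗ⁅ℂ⁆ M :=
    FreeLieAlgebra.lift ℂ (Generators.eval H E F) with hΦ
  have hof : ∀ x, Φ (FreeLieAlgebra.of ℂ x) = Generators.eval H E F x := fun x => by
    rw [hΦ, FreeLieAlgebra.lift_of_apply]
  have hpow : ∀ (x y : FreeLieAlgebra ℂ (Generators (Fin n))) (k : ℕ),
      Φ ((LieAlgebra.ad ℂ _ x ^ k) y) = (LieAlgebra.ad ℂ M (Φ x) ^ k) (Φ y) := by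
    intro x y k
    induction k generalizing y with
    | zero => rfl
    | succ k ih => rw [pow_succ, pow_succ, Module.End.mul_apply, Module.End.mul_apply, ih,
        LieAlgebra.ad_apply, LieAlgebra.ad_apply, Φ.map_lie]
  have hle : Relations.toIdeal ℂ A ≤ Φ.ker := by
    refine LieSubmodule.lieSpan_le.2 ?_
    rintro x (((((⟨⟨i, j⟩, rfl⟩ | ⟨⟨i, j⟩, rfl⟩) | ⟨⟨i, j⟩, rfl⟩) | ⟨⟨i, j⟩, rfl⟩) |
      ⟨⟨i, j⟩, rfl⟩) | ⟨⟨i, j⟩, rfl⟩)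
    all_goals change Φ _ = 0
    · simp [Relations.HH, hof, Generators.eval, hHH]
    · rcases eq_or_ne i j with rfl | hij
      · simp [Relations.EF, hof, Generators.eval, hEF]
      · simp [Relations.EF, hof, Generators.eval, hEF, hij]
    · simp [Relations.HE, hof, Generators.eval, hHE]
    · simp [Relations.HF, hof, Generators.eval, hHF]
    · simpa [Relations.adE, hpow, hof, Generators.eval] using hE i j
    · simpa [Relations.adF, hpow, hof, Generators.eval] using hF i j
  let ψ : (FreeLieAlgebra ℂ (Generators (Fin n)) ⧸ Relations.toIdeal ℂ A) →ₗ[ℂ] M :=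
    (Relations.toIdeal ℂ A).toSubmodule.liftQ (Φ : _ →ₗ[ℂ] M) fun x hx => LinearMap.mem_ker.2
      (show Φ x = 0 from hle hx)
  refine ⟨{ ψ with map_lie' := ?_ }, hof⟩
  intro x y
  obtain ⟨x, rfl⟩ := LieSubmodule.Quotient.surjective_mk' (Relations.toIdeal ℂ A) x
  obtain ⟨y, rfl⟩ := LieSubmodule.Quotient.surjective_mk' (Relations.toIdeal ℂ A) y
  exact Φ.map_lie x y

end Serre

section
open RootLattice

/-- Binary search trees. -/
inductive KeyTree (α : Type) where
  | nil : KeyTree α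
  | node (l : KeyTree α) (k : ℕ) (a : α) (r : KeyTree α) : KeyTree α

namespace KeyTree
variable {α : Type}

/-- Insertion in a search tree. -/
def insert (k : ℕ) (a : α) : KeyTree α → KeyTree α
  | nil => node nil k a nil
  | node l k' a' r =>
    bif Nat.blt k k' then node (insert k a l) k' a' r else node l k' a' (insert k a r)

/-- Search. -/
def find (k : ℕ) : KeyTree α → Option α
  | nil => none
  | node l k' a' r =>
    bif Nat.beq k k' then some a' else bif Nat.blt k k' then find k l else find k r

end KeyTree

namespace E8Key

/-- A numerical code for labels; it is injective on the labels which matter. -/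
def code : E8Key → ℕ
  | .inl i => i
  | .inr a => 8 + ((a.a₁ + 8).toNat + 16 * ((a.a₂ + 8).toNat + 16 * ((a.a₃ + 8).toNat +
      16 * ((a.a₄ + 8).toNat + 16 * ((a.a₅ + 8).toNat + 16 * ((a.a₆ + 8).toNat +
      16 * ((a.a₇ + 8).toNat + 16 * (a.a₈ + 8).toNat)))))))

/-- A one-sided inverse of the code. -/
def decode (n : ℕ) : E8Key :=
  if h : n < 8 then .inl ⟨n, h⟩ else
    let d (i : ℕ) : ℤ := ((n - 8) / 16 ^ i % 16 : ℕ) - 8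
    .inr ⟨d 0, d 1, d 2, d 3, d 4, d 5, d 6, d 7⟩

end E8Key

namespace E8Model
open IntComb

/-- Whether the code is faithful on the labels of a combination. -/
def isFaithful (l : E8List) : Bool := l.all fun p => decide (E8Key.decode p.1.code = p.1)

theorem ev_code {l : E8List} (h : isFaithful l = true) :
    IntComb.ev (fun k => δ (E8Key.decode k)) (l.map fun p => (p.1.code, p.2)) = ev l := by
  induction l with
  | nil => simp
  | cons p l ih =>
    rw [isFaithful, List.all_cons, Bool.and_eq_true, decide_eq_true_eq] at h
    rw [List.map_cons, IntComb.ev_cons, ev_cons, ih h.2, h.1]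

/-- Whether two combinations define the same vector. -/
def isEq (l l' : E8List) : Bool :=
  isFaithful l && isFaithful l' &&
    IntComb.isEq (l.map fun p => (p.1.code, p.2)) (l'.map fun p => (p.1.code, p.2))

theorem ev_eq_ev {l l' : E8List} (h : isEq l l' = true) : ev l = ev l' := by
  rw [isEq, Bool.and_eq_true, Bool.and_eq_true] at h
  rw [← ev_code h.1.1, ← ev_code h.1.2, IntComb.ev_eq_ev _ h.2]

/-- Multiplication by an integer. -/
def smulList (c : ℤ) (l : E8List) : E8List := l.map fun p => (p.1, c * p.2)

theorem ev_smulList (c : ℤ) (l : E8List) : ev (smulList c l) = (c : ℂ) • ev l := ev_map_smul c l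

theorem ev_iterate_brL (x y : E8List) (k : ℕ) :
    ev ((brL x)^[k] y) = (LieAlgebra.ad ℂ E8Model (ev x) ^ k) (ev y) := by
  induction k generalizing y with
  | zero => rfl
  | succ k ih => rw [Function.iterate_succ_apply, ih, ev_brL, pow_succ, Module.End.mul_apply,
      LieAlgebra.ad_apply]

end E8Model

/-- A root, with nonnegative coordinates given by decimal digits. -/
def RootLattice.ofDigits (w : ℕ) : RootLattice :=
  ⟨(w / 10000000 : ℕ), (w / 1000000 % 10 : ℕ), (w / 100000 % 10 : ℕ), (w / 10000 % 10 : ℕ),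
    (w / 1000 % 10 : ℕ), (w / 100 % 10 : ℕ), (w / 10 % 10 : ℕ), (w % 10 : ℕ)⟩

/-- The opposite of a label. -/
def E8Key.neg : E8Key → E8Key
  | .inl i => .inl i
  | .inr a => .inr ⟨-a.a₁, -a.a₂, -a.a₃, -a.a₄, -a.a₅, -a.a₆, -a.a₇, -a.a₈⟩

/-- The data describing a simple subalgebra of the Lie algebra of type `E₈`: the Cartan matrix, the
simple coroots, and the positive root vectors (with the coordinates of the root in terms of simple
roots), starting with the simple ones. `inv` divided by `scale` is the inverse of the
Cartan matrix; `step` is used to balance trees. -/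
structure RootTable (n : ℕ) where
  cartan : Matrix (Fin n) (Fin n) ℤ
  coroots : List (List (Fin 8))
  pos : List (ℕ × List (ℕ × ℤ))
  numPos : ℕ
  step : ℕ
  scale : ℤ
  inv : Matrix (Fin n) (Fin n) ℤ

namespace RootTable
variable {n : ℕ} (T : RootTable n)

/-- The dimension. -/
def dim : ℕ := n + 2 * T.numPos

/-- The positive roots, arranged in a tree. -/
def posTree : KeyTree (ℕ × List (ℕ × ℤ)) :=
  (List.range T.numPos).foldr (fun k t => t.insert (k * T.step % T.numPos)
    (T.pos.getD (k * T.step % T.numPos) (0, []))) .nil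

/-- The `k`-th positive root. -/
def root (k : ℕ) : ℕ × List (ℕ × ℤ) := (T.posTree.find k).getD (0, [])

/-- The `k`-th basis vector. -/
def vec (k : ℕ) : E8List :=
  bif Nat.blt k n then (T.coroots.getD k []).map fun i => (.inl i, 1)
  else bif Nat.blt k (n + T.numPos) then
    (T.root (k - n)).2.map fun p => (.inr (.ofDigits p.1), p.2)
  else bif Nat.blt k T.dim then
    (T.root (k - n - T.numPos)).2.map fun p => (E8Key.neg (.inr (.ofDigits p.1)), p.2)
  else []

/-- The decimal digits of a positive weight. -/
def digits (w : ℕ) : List ℤ :=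
  [(w / 10000000 : ℕ), (w / 1000000 % 10 : ℕ), (w / 100000 % 10 : ℕ), (w / 10000 % 10 : ℕ),
    (w / 1000 % 10 : ℕ), (w / 100 % 10 : ℕ), (w / 10 % 10 : ℕ), (w % 10 : ℕ)]

/-- The `k`-th weight. -/
def wt (k : ℕ) : List ℤ :=
  bif Nat.blt k n then []
  else bif Nat.blt k (n + T.numPos) then digits (T.root (k - n)).1
  else (digits (T.root (k - n - T.numPos)).1).map Int.neg

/-- The index of a basis vector having a given leading label. -/
def headTree : KeyTree (ℕ × ℤ) :=
  (List.range T.dim).foldr (fun k t =>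
    match T.vec (k * T.step % T.dim) with
    | [] => t
    | p :: _ => t.insert p.1.code (k * T.step % T.dim, p.2)) .nil

/-- The coordinates of a combination. -/
def toIndex (l : E8List) : IntComb :=
  l.filterMap fun p => (T.headTree.find p.1.code).map fun q => (q.1, q.2 * p.2)

/-- The structure constants. -/
def br (i j : ℕ) : IntComb := T.toIndex (E8Model.brL (T.vec i) (T.vec j))

/-- The combination of labels corresponding to a combination of indices. -/
def expand (l : IntComb) : E8List := l.flatMap fun p => E8Model.smulList p.2 (T.vec p.1)

/-- The index of the opposite of a simple root vector. -/
def idxF (i : ℕ) : ℕ := n + T.numPos + i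

def hVec (i : ℕ) : E8List := T.vec i
def eVec (i : ℕ) : E8List := T.vec (n + i)
def fVec (i : ℕ) : E8List := E8Model.smulList (-1) (T.vec (T.idxF i))

open E8Model in
/-- The Serre relations. -/
structure Serre : Prop where
  hh : ∀ i j : Fin n, isEq (brL (T.hVec i) (T.hVec j)) [] = true
  ef : ∀ i j : Fin n, isEq (brL (T.eVec i) (T.fVec j)) (if i = j then T.hVec i else []) = true
  he : ∀ i j : Fin n,
    isEq (brL (T.hVec i) (T.eVec j)) (smulList (T.cartan i j) (T.eVec j)) = true
  hf : ∀ i j : Fin n,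
    isEq (brL (T.hVec i) (T.fVec j)) (smulList (-T.cartan i j) (T.fVec j)) = true
  ee : ∀ i j : Fin n,
    isEq ((brL (T.eVec i))^[(-T.cartan i j).toNat] (brL (T.eVec i) (T.eVec j))) [] = true
  ff : ∀ i j : Fin n,
    isEq ((brL (T.fVec i))^[(-T.cartan i j).toNat] (brL (T.fVec i) (T.fVec j))) [] = true

/-- Whether the span of the basis vectors is stable under the action of a basis vector. -/
def isStable (g : ℕ) : Bool := (List.range T.dim).all fun k =>
  E8Model.isEq (E8Model.brL (T.vec g) (T.vec k)) (T.expand (T.br g k))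

/-- Whether the `k`-th vector is the bracket of the `g`-th one and of some previous one. -/
def isStep (k g g' : ℕ) : Bool :=
  match T.br g' k with
  | [] => false
  | p :: _ => Nat.blt p.1 k && IntComb.isNonzeroMultiple (T.br g p.1) [(k, 1)]

/-- Whether the `k`-th vector is obtained from generators. -/
def isReached (k : ℕ) : Bool :=
  Nat.blt k (2 * n) || (Nat.ble (n + T.numPos) k && Nat.blt k (2 * n + T.numPos)) ||
    (List.range n).any fun i =>
      T.isStep k (n + i) (T.idxF i) || T.isStep k (T.idxF i) (n + i)

/-- The verifications which show that the basis vectors form a basis of the Lie algebra defined by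
the Serre relations. -/
structure IsBasis : Prop extends T.Serre where
  stableE : ∀ i : Fin n, T.isStable (n + i) = true
  stableF : ∀ i : Fin n, T.isStable (T.idxF i) = true
  reached : (List.range T.dim).all T.isReached = true
  index : (List.range T.dim).all (fun k => IntComb.isEq (T.toIndex (T.vec k)) [(k, 1)]) = true

end RootTable

end

/-- A list of positive roots of type `E₈` with the corresponding root vectors. -/
def simplyLacedRoots (l : List ℕ) : List (ℕ × List (ℕ × ℤ)) := l.map fun w => (w, [(w, 1)])

/-- The Lie algebra of type `E₆`. -/
def tableE6 : RootTable 6 where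
  cartan := CartanMatrix.E₆
  coroots := [[0], [1], [2], [3], [4], [5]]
  pos := simplyLacedRoots [10000000, 1000000, 100000, 10000, 1000, 100, 10100000, 1010000,
    110000, 11000, 1100, 10110000, 1110000, 1011000, 111000, 11100, 11110000, 10111000, 1111000,
    1011100, 111100, 11111000, 10111100, 1121000, 1111100, 11121000, 11111100, 1121100, 11221000,
    11121100, 1122100, 11221100, 11122100, 11222100, 11232100, 12232100]
  numPos := 36
  step := 61
  scale := 3
  inv := !![4, 3, 5, 6, 4, 2; 3, 6, 6, 9, 6, 3; 5, 6, 10, 12, 8, 4; 6, 9, 12, 18, 12, 6; 4, 6, 8,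
    12, 10, 5; 2, 3, 4, 6, 5, 4]

/-- The Lie algebra of type `E₇`. -/
def tableE7 : RootTable 7 where
  cartan := CartanMatrix.E₇
  coroots := [[0], [1], [2], [3], [4], [5], [6]]
  pos := simplyLacedRoots [10000000, 1000000, 100000, 10000, 1000, 100, 10, 10100000, 1010000,
    110000, 11000, 1100, 110, 10110000, 1110000, 1011000, 111000, 11100, 1110, 11110000,
    10111000, 1111000, 1011100, 111100, 11110, 11111000, 10111100, 1121000, 1111100, 1011110,
    111110, 11121000, 11111100, 10111110, 1121100, 1111110, 11221000, 11121100, 11111110,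
    1122100, 1121110, 11221100, 11122100, 11121110, 1122110, 11222100, 11221110, 11122110,
    1122210, 11232100, 11222110, 11122210, 12232100, 11232110, 11222210, 12232110, 11232210,
    12232210, 11233210, 12233210, 12243210, 12343210, 22343210]
  numPos := 63
  step := 103
  scale := 2
  inv := !![4, 4, 6, 8, 6, 4, 2; 4, 7, 8, 12, 9, 6, 3; 6, 8, 12, 16, 12, 8, 4; 8, 12, 16, 24, 18,
    12, 6; 6, 9, 12, 18, 15, 10, 5; 4, 6, 8, 12, 10, 8, 4; 2, 3, 4, 6, 5, 4, 3]

/-- The Lie algebra of type `E₈`. -/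
def tableE8 : RootTable 8 where
  cartan := CartanMatrix.E₈
  coroots := [[0], [1], [2], [3], [4], [5], [6], [7]]
  pos := simplyLacedRoots [10000000, 1000000, 100000, 10000, 1000, 100, 10, 1, 10100000, 1010000,
    110000, 11000, 1100, 110, 11, 10110000, 1110000, 1011000, 111000, 11100, 1110, 111, 11110000,
    10111000, 1111000, 1011100, 111100, 11110, 1111, 11111000, 10111100, 1121000, 1111100,
    1011110, 111110, 11111, 11121000, 11111100, 10111110, 1121100, 1111110, 1011111, 111111,
    11221000, 11121100, 11111110, 10111111, 1122100, 1121110, 1111111, 11221100, 11122100,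
    11121110, 11111111, 1122110, 1121111, 11222100, 11221110, 11122110, 11121111, 1122210,
    1122111, 11232100, 11222110, 11221111, 11122210, 11122111, 1122211, 12232100, 11232110,
    11222210, 11222111, 11122211, 1122221, 12232110, 11232210, 11232111, 11222211, 11122221,
    12232210, 12232111, 11233210, 11232211, 11222221, 12233210, 12232211, 11233211, 11232221,
    12243210, 12233211, 12232221, 11233221, 12343210, 12243211, 12233221, 11233321, 22343210,
    12343211, 12243221, 12233321, 22343211, 12343221, 12243321, 22343221, 12343321, 12244321,
    22343321, 12344321, 22344321, 12354321, 22354321, 13354321, 23354321, 22454321, 23454321,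
    23464321, 23465321, 23465421, 23465431, 23465432]
  numPos := 120
  step := 77
  scale := 1
  inv := !![4, 5, 7, 10, 8, 6, 4, 2; 5, 8, 10, 15, 12, 9, 6, 3; 7, 10, 14, 20, 16, 12, 8, 4; 10,
    15, 20, 30, 24, 18, 12, 6; 8, 12, 16, 24, 20, 15, 10, 5; 6, 9, 12, 18, 15, 12, 8, 4; 4, 6, 8,
    12, 10, 8, 6, 3; 2, 3, 4, 6, 5, 4, 3, 2]

/-- The Lie algebra of type `F₄`. -/
def tableF4 : RootTable 4 where
  cartan := CartanMatrix.F₄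
  coroots := [[0, 5], [2, 4], [3], [1]]
  pos := [(10000000, [(100, 1), (10000000, 1)]), (1000000, [(1000, 1), (100000, 1)]), (100000,
    [(10000, 1)]), (10000, [(1000000, 1)]), (11000000, [(1100, 1), (10100000, -1)]), (1100000,
    [(11000, 1), (110000, -1)]), (110000, [(1010000, 1)]), (11100000, [(11100, 1), (10110000,
    1)]), (2100000, [(111000, -1)]), (1110000, [(1011000, 1), (1110000, -1)]), (12100000,
    [(111100, -1), (10111000, 1)]), (11110000, [(1011100, 1), (11110000, 1)]), (2110000,
    [(1111000, -1)]), (22100000, [(10111100, 1)]), (12110000, [(1111100, -1), (11111000, 1)]),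
    (2210000, [(1121000, -1)]), (22110000, [(11111100, 1)]), (12210000, [(1121100, -1),
    (11121000, 1)]), (22210000, [(11121100, 1)]), (13210000, [(1122100, -1), (11221000, -1)]),
    (23210000, [(11122100, 1), (11221100, -1)]), (24210000, [(11222100, -1)]), (24310000,
    [(11232100, -1)]), (24320000, [(12232100, -1)])]
  numPos := 24
  step := 43
  scale := 1
  inv := !![2, 3, 4, 2; 3, 6, 8, 4; 2, 4, 6, 3; 1, 2, 3, 2]

/-- The Lie algebra of type `G₂`. -/
def tableG2 : RootTable 2 where
  cartan := CartanMatrix.G₂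
  coroots := [[1, 2, 4], [3]]
  pos := [(10000000, [(1000, 1), (100000, 1), (1000000, 1)]), (1000000, [(10000, 1)]), (11000000,
    [(11000, 1), (110000, -1), (1010000, -1)]), (21000000, [(111000, -1), (1011000, -1),
    (1110000, 1)]), (31000000, [(1111000, 1)]), (32000000, [(1121000, 1)])]
  numPos := 6
  step := 11
  scale := 1
  inv := !![2, 3; 1, 2]

section
open RootLattice

section Realization
open IntComb
open CartanMatrix (Generators)

/-- A basis of a Lie algebra indexed by an initial segment of the natural numbers, with integral
structure constants. -/
structure IntBasis (L : Type*) [LieRing L] [LieAlgebra ℂ L] where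
  dim : ℕ
  b : ℕ → L
  coord : L →ₗ[ℂ] ℕ →₀ ℂ
  br : ℕ → ℕ → IntComb
  coord_b : ∀ k < dim, coord (b k) = Finsupp.single k 1
  coord_lie : ∀ i j, coord ⁅b i, b j⁆ = rowVec (br i j)
  eq_sum : ∀ x, x = Finsupp.linearCombination ℂ b (coord x)
  b_eq_zero : ∀ k, dim ≤ k → b k = 0

namespace RootTable
variable {n : ℕ} (T : RootTable n)

/-- The coordinates of a standard basis vector. -/
noncomputable def coordKey (k : E8Key) : ℕ →₀ ℂ :=
  (T.headTree.find k.code).elim 0 fun q => (q.2 : ℂ) • Finsupp.single q.1 1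

/-- The coordinates of a vector. -/
noncomputable def coordMap : E8Model →ₗ[ℂ] ℕ →₀ ℂ :=
  (Finsupp.linearCombination ℂ T.coordKey : (E8Key →₀ ℂ) →ₗ[ℂ] ℕ →₀ ℂ)

theorem coordMap_δ (k : E8Key) : T.coordMap (E8Model.δ k) = T.coordKey k := by
  simp only [coordMap, E8Model.δ]
  erw [Finsupp.linearCombination_single, one_smul]

theorem coordMap_ev (l : E8List) : T.coordMap (E8Model.ev l) = rowVec (T.toIndex l) := by
  induction l with
  | nil => simp [toIndex]
  | cons p l ih =>
    rw [E8Model.ev_cons, map_add, map_smul, ih, coordMap_δ, coordKey, toIndex, toIndex,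
      List.filterMap_cons]
    cases T.headTree.find p.1.code with
    | none => simp
    | some q => simp [mul_comm]

/-- The basis vectors. -/
noncomputable def vect (k : ℕ) : E8Model := E8Model.ev (T.vec k)

variable {T} in
theorem vect_eq_zero {k : ℕ} (hk : T.dim ≤ k) : T.vect k = 0 := by
  have h1 : Nat.blt k T.dim = false := by
    rw [← Bool.not_eq_true, Nat.blt_eq]; omega
  have h2 : Nat.blt k (n + T.numPos) = false := by
    rw [← Bool.not_eq_true, Nat.blt_eq]; unfold dim at hk; omega
  have h3 : Nat.blt k n = false := by
    rw [← Bool.not_eq_true, Nat.blt_eq]; unfold dim at hk; omega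
  simp [vect, vec, h1, h2, h3]

theorem ev_expand (l : IntComb) : E8Model.ev (T.expand l) = ev T.vect l := by
  induction l with
  | nil => rfl
  | cons p l ih =>
    rw [expand, List.flatMap_cons, E8Model.ev_append, E8Model.ev_smulList, ev_cons, ← ih]
    rfl

/-- The span of the basis vectors. -/
noncomputable def spanVect : Submodule ℂ E8Model := Submodule.span ℂ (Set.range T.vect)

variable {T}

theorem lie_vect_of_isStable {g k : ℕ} (h : T.isStable g = true) (hk : k < T.dim) :
    ⁅T.vect g, T.vect k⁆ = ev T.vect (T.br g k) := by
  rw [isStable, List.all_eq_true] at h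
  rw [vect, vect, ← E8Model.ev_brL, E8Model.ev_eq_ev (h k (List.mem_range.2 hk)), ev_expand]

theorem ev_mem_spanVect (l : IntComb) : ev T.vect l ∈ T.spanVect := by
  have := ev_mem_span T.vect (s := Set.univ) (l := l) fun _ _ => Set.mem_univ _
  rwa [Set.image_univ] at this

theorem lie_mem_of_isStable {g : ℕ} (h : T.isStable g = true) {x : E8Model}
    (hx : x ∈ T.spanVect) : ⁅T.vect g, x⁆ ∈ T.spanVect := by
  induction hx using Submodule.span_induction with
  | mem x hx =>
    obtain ⟨k, rfl⟩ := hx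
    rcases lt_or_ge k T.dim with hk | hk
    · rw [lie_vect_of_isStable h hk]; exact ev_mem_spanVect _
    · rw [vect_eq_zero hk, lie_zero]; exact zero_mem _
  | zero => rw [lie_zero]; exact zero_mem _
  | add x y _ _ hx hy => rw [lie_add]; exact add_mem hx hy
  | smul c x _ hx => rw [lie_smul]; exact Submodule.smul_mem _ _ hx

theorem ev_fVec (i : ℕ) : E8Model.ev (T.fVec i) = -T.vect (T.idxF i) := by
  rw [fVec, E8Model.ev_smulList, vect]; simp

theorem exists_hom (h : T.Serre) : ∃ ψ : T.cartan.ToLieAlgebra ℂ →ₗ⁅ℂ⁆ E8Model,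
    ∀ x, ψ (serreGenerator T.cartan x) = Generators.eval (fun i : Fin n => T.vect i)
      (fun i : Fin n => T.vect (n + i)) (fun i : Fin n => -T.vect (T.idxF i)) x := by
  have hz (c : ℤ) (x : E8Model) : (c : ℂ) • x = c • x := Int.cast_smul_eq_zsmul ℂ c x
  refine exists_serre_lift _ _ _ _ (fun i j => ?_) (fun i j => ?_) (fun i j => ?_)
    (fun i j => ?_) (fun i j => ?_) fun i j => ?_
  · rw [vect, vect, ← E8Model.ev_brL]
    exact E8Model.ev_eq_ev (h.hh i j)
  · rw [← ev_fVec, vect, ← E8Model.ev_brL]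
    refine (E8Model.ev_eq_ev (h.ef i j)).trans ?_
    split_ifs <;> rfl
  · rw [vect, vect, ← E8Model.ev_brL, ← hz]
    exact (E8Model.ev_eq_ev (h.he i j)).trans (E8Model.ev_smulList _ _)
  · rw [← ev_fVec, vect, ← E8Model.ev_brL, ← hz]
    exact (E8Model.ev_eq_ev (h.hf i j)).trans (E8Model.ev_smulList _ _)
  · rw [vect, vect, ← E8Model.ev_brL, ← E8Model.ev_iterate_brL]
    exact E8Model.ev_eq_ev (h.ee i j)
  · rw [← ev_fVec, ← ev_fVec, ← E8Model.ev_brL, ← E8Model.ev_iterate_brL]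
    exact E8Model.ev_eq_ev (h.ff i j)

/-- The elements of `T.spanVect` whose adjoint action preserves it. -/
noncomputable def stableSubalgebra (T : RootTable n) : LieSubalgebra ℂ E8Model where
  carrier := {x | x ∈ T.spanVect ∧ ∀ s ∈ T.spanVect, ⁅x, s⁆ ∈ T.spanVect}
  add_mem' hx hy := ⟨add_mem hx.1 hy.1, fun s hs => by
    rw [add_lie]; exact add_mem (hx.2 s hs) (hy.2 s hs)⟩
  zero_mem' := ⟨zero_mem _, fun s _ => by rw [zero_lie]; exact zero_mem _⟩
  smul_mem' c x hx := ⟨Submodule.smul_mem _ _ hx.1, fun s hs => by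
    rw [smul_lie]; exact Submodule.smul_mem _ _ (hx.2 s hs)⟩
  lie_mem' hx hy := ⟨hx.2 _ hy.1, fun s hs => by
    rw [lie_lie]; exact sub_mem (hx.2 _ (hy.2 s hs)) (hy.2 _ (hx.2 s hs))⟩

theorem vect_mem_range {ψ : T.cartan.ToLieAlgebra ℂ →ₗ⁅ℂ⁆ E8Model}
    (hψ : ∀ x, ψ (serreGenerator T.cartan x) = Generators.eval (fun i : Fin n => T.vect i)
      (fun i : Fin n => T.vect (n + i)) (fun i : Fin n => -T.vect (T.idxF i)) x)
    (h : T.IsBasis) (k : ℕ) : T.vect k ∈ ψ.range := by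
  have hE (i : Fin n) : T.vect (n + i) ∈ ψ.range := ⟨_, hψ (.E i)⟩
  have hF (i : Fin n) : T.vect (T.idxF i) ∈ ψ.range := by
    have : -T.vect (T.idxF i) ∈ ψ.range := ⟨_, hψ (.F i)⟩
    simpa using neg_mem this
  induction k using Nat.strong_induction_on with
  | _ k ih =>
  rcases le_or_gt T.dim k with hk | hk
  · rw [vect_eq_zero hk]; exact zero_mem _
  have hstep {g g' : ℕ} (hg : T.isStable g = true) (hg' : T.vect g ∈ ψ.range)
      (hs : T.isStep k g g' = true) : T.vect k ∈ ψ.range := by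
    unfold isStep at hs
    cases hb : T.br g' k with
    | nil => simp [hb] at hs
    | cons p l =>
      rw [hb, Bool.and_eq_true, Nat.blt_eq] at hs
      obtain ⟨c, hc, h1⟩ := exists_of_isNonzeroMultiple T.vect hs.2
      rw [← lie_vect_of_isStable hg (hs.1.trans hk), ev_cons, ev_nil, add_zero, Int.cast_one,
        one_smul] at h1
      have h2 : ⁅T.vect g, T.vect p.1⁆ ∈ ψ.range := ψ.range.lie_mem hg' (ih _ hs.1)
      rw [h1] at h2
      simpa [smul_smul, hc] using ψ.range.smul_mem c⁻¹ h2
  have hr := List.all_eq_true.1 h.reached k (List.mem_range.2 hk)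
  rw [isReached, Bool.or_eq_true, Bool.or_eq_true, Bool.and_eq_true, Nat.blt_eq, Nat.blt_eq,
    Nat.ble_eq, List.any_eq_true] at hr
  rcases hr with (hr | hr) | ⟨i, hi, hr⟩
  · rcases lt_or_ge k n with hn | hn
    · exact ⟨_, hψ (.H ⟨k, hn⟩)⟩
    · have := hE ⟨k - n, by omega⟩
      rwa [show n + (k - n) = k by omega] at this
  · have := hF ⟨k - (n + T.numPos), by omega⟩
    rwa [idxF, show n + T.numPos + (k - (n + T.numPos)) = k by omega] at this
  · rw [List.mem_range] at hi
    rw [Bool.or_eq_true] at hr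
    rcases hr with hr | hr
    · exact hstep (h.stableE ⟨i, hi⟩) (hE ⟨i, hi⟩) hr
    · exact hstep (h.stableF ⟨i, hi⟩) (hF ⟨i, hi⟩) hr

theorem coordMap_vect (h : T.IsBasis) {k : ℕ} (hk : k < T.dim) :
    T.coordMap (T.vect k) = Finsupp.single k 1 := by
  rw [vect, coordMap_ev, rowVec,
    ev_eq_ev _ (List.all_eq_true.1 h.index k (List.mem_range.2 hk))]
  simp

/-- The basis of a simple Lie algebra defined by the Serre relations. -/
theorem exists_intBasis (h : T.IsBasis) (h0 : 0 < T.dim) {L : Type*} [LieRing L] [LieAlgebra ℂ L]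
    [LieAlgebra.IsSimple ℂ L] (φ : L ≃ₗ⁅ℂ⁆ T.cartan.ToLieAlgebra ℂ) :
    ∃ B : IntBasis L, B.dim = T.dim ∧ B.br = T.br := by
  obtain ⟨ψ, hψ⟩ := exists_hom h.toSerre
  have hrange (k : ℕ) : ∃ x : L, ψ (φ x) = T.vect k := by
    obtain ⟨y, hy⟩ := vect_mem_range hψ h k
    obtain ⟨x, rfl⟩ : ∃ x, φ x = y := φ.surjective y
    exact ⟨x, hy⟩
  choose b hb using hrange
  have hspan (y : T.cartan.ToLieAlgebra ℂ) : ψ y ∈ T.spanVect := by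
    have h1 : T.stableSubalgebra.comap ψ = ⊤ := by
      have hE (i : Fin n) : T.vect (n + i) ∈ T.stableSubalgebra :=
        ⟨Submodule.subset_span ⟨_, rfl⟩, fun s hs => lie_mem_of_isStable (h.stableE i) hs⟩
      have hF (i : Fin n) : -T.vect (T.idxF i) ∈ T.stableSubalgebra :=
        neg_mem ⟨Submodule.subset_span ⟨_, rfl⟩, fun s hs => lie_mem_of_isStable (h.stableF i) hs⟩
      refine serre_subalgebra_eq_top _ _ fun x => ?_
      rw [LieSubalgebra.mem_comap, hψ]
      rcases x with i | i | i
      · have h2 := T.stableSubalgebra.lie_mem (hE i) (hF i)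
        have h3 := E8Model.ev_eq_ev (h.ef i i)
        rw [if_pos rfl, E8Model.ev_brL, ev_fVec] at h3
        change E8Model.ev (T.hVec i) ∈ _
        rw [← h3]
        exact h2
      · exact hE i
      · exact hF i
    have h2 : y ∈ T.stableSubalgebra.comap ψ := h1 ▸ LieSubalgebra.mem_top y
    exact h2.1
  set Φ : L →ₗ⁅ℂ⁆ E8Model := ψ.comp φ.toLieHom with hΦ
  have hΦb (k : ℕ) : Φ (b k) = T.vect k := hb k
  have hinj : Function.Injective Φ := by
    rw [← LieHom.ker_eq_bot]
    rcases LieAlgebra.IsSimple.eq_bot_or_eq_top Φ.ker with h1 | h1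
    · exact h1
    · exfalso
      have h2 : b 0 ∈ Φ.ker := h1 ▸ LieSubmodule.mem_top _
      rw [LieHom.mem_ker, hΦb] at h2
      have h3 := coordMap_vect h h0
      rw [h2, map_zero] at h3
      have := DFunLike.congr_fun h3 0
      simp at this
  have hexp {s : E8Model} (hs : s ∈ T.spanVect) :
      s = Finsupp.linearCombination ℂ T.vect (T.coordMap s) := by
    have : Set.EqOn (LinearMap.id : E8Model →ₗ[ℂ] E8Model)
        (Finsupp.linearCombination ℂ T.vect ∘ₗ T.coordMap) (Set.range T.vect) := by
      rintro _ ⟨k, rfl⟩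
      rcases lt_or_ge k T.dim with hk | hk
      · simp [coordMap_vect h hk]
      · simp [vect_eq_zero hk]
    exact LinearMap.eqOn_span this hs
  refine ⟨⟨T.dim, b, T.coordMap ∘ₗ (Φ : L →ₗ[ℂ] E8Model), T.br, fun k hk => ?_, fun i j => ?_,
    fun x => hinj ?_, fun k hk => hinj ?_⟩, rfl, rfl⟩
  · exact (congrArg T.coordMap (hΦb k)).trans (coordMap_vect h hk)
  · refine (congrArg T.coordMap (Φ.map_lie _ _)).trans ?_
    rw [hΦb, hΦb, vect, vect, ← E8Model.ev_brL, coordMap_ev]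
    rfl
  · refine (hexp (hspan (φ x))).trans ?_
    change _ = (Φ : L →ₗ[ℂ] E8Model) _
    rw [Finsupp.apply_linearCombination]
    congr 2
    exact (funext hΦb).symm
  · rw [hΦb, vect_eq_zero hk, map_zero]

end RootTable
end Realization

end

section
open RootLattice

namespace IntBasis
open IntComb Module
variable {L : Type*} [LieRing L] [LieAlgebra ℂ L] (B : IntBasis L)

theorem linearCombination_rowVec (l : IntComb) :
    Finsupp.linearCombination ℂ B.b (rowVec l) = ev B.b l := by
  rw [rowVec, map_ev]; simp

theorem lie_b (i j : ℕ) : ⁅B.b i, B.b j⁆ = ev B.b (B.br i j) := by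
  rw [B.eq_sum ⁅B.b i, B.b j⁆, B.coord_lie, linearCombination_rowVec]

theorem coord_apply_eq_zero (x : L) {l : ℕ} (hl : B.dim ≤ l) : B.coord x l = 0 := by
  rw [B.eq_sum x, Finsupp.apply_linearCombination, Finsupp.linearCombination_apply,
    Finsupp.sum, Finsupp.finsetSum_apply]
  refine Finset.sum_eq_zero fun k _ => ?_
  rcases lt_or_ge k B.dim with hk | hk
  · simp [B.coord_b k hk, (hk.trans_le hl).ne]
  · simp [B.b_eq_zero k hk]

/-- The underlying basis. -/
noncomputable def basis : Basis (Fin B.dim) ℂ L :=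
  Basis.mk (v := fun k : Fin B.dim => B.b k)
    (LinearIndependent.of_comp B.coord (by
      have : B.coord ∘ (fun k : Fin B.dim => B.b k) =
          (fun k : ℕ => Finsupp.single k (1 : ℂ)) ∘ Fin.val := by
        ext1 k; exact B.coord_b k k.2
      rw [this]
      exact (Finsupp.linearIndependent_single_one ℂ ℕ).comp _ Fin.val_injective))
    (by
      rintro x -
      rw [B.eq_sum x, Finsupp.linearCombination_apply]
      refine Submodule.sum_mem _ fun k _ => Submodule.smul_mem _ _ ?_
      rcases lt_or_ge k B.dim with hk | hk
      · exact Submodule.subset_span ⟨⟨k, hk⟩, rfl⟩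
      · rw [B.b_eq_zero k hk]; exact zero_mem _)

@[simp] theorem basis_apply (k : Fin B.dim) : B.basis k = B.b k := by simp [basis]

theorem b_ne_zero {k : ℕ} (hk : k < B.dim) : B.b k ≠ 0 := by
  have := B.basis.ne_zero ⟨k, hk⟩
  rwa [basis_apply] at this

/-- If two basis vectors are weight vectors, the coordinates of their bracket are indexed by basis
vectors of weight the sum of the weights. -/
theorem weight_eq_add {n : ℕ} {w : ℕ → Fin n → ℤ} {cart : (Fin n → ℂ) →ₗ[ℂ] L}
    (hw : ∀ c, ∀ k < B.dim, ⁅cart c, B.b k⁆ = (∑ j, c j * w k j) • B.b k) {i j l : ℕ}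
    (hi : i < B.dim) (hj : j < B.dim) (hl : B.coord ⁅B.b i, B.b j⁆ l ≠ 0) :
    w l = w i + w j := by
  have hc (c : Fin n → ℂ) (x : L) {l : ℕ} (hl : l < B.dim) :
      B.coord ⁅cart c, x⁆ l = (∑ j, c j * w l j) * B.coord x l := by
    rw [B.eq_sum x, Finsupp.linearCombination_apply, Finsupp.sum, lie_sum, map_sum, map_sum,
      Finsupp.finsetSum_apply, Finsupp.finsetSum_apply, Finset.mul_sum]
    refine Finset.sum_congr rfl fun k _ => ?_
    rcases lt_or_ge k B.dim with hk | hk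
    · rw [lie_smul, hw c k hk, map_smul, map_smul, map_smul, B.coord_b k hk]
      rcases eq_or_ne k l with rfl | hkl
      · simp [mul_comm]
      · simp [hkl]
    · simp [B.b_eq_zero k hk]
  have hl' : l < B.dim := by
    by_contra h
    exact hl (B.coord_apply_eq_zero _ (not_lt.1 h))
  funext a
  have h1 := hc (Pi.single a 1) ⁅B.b i, B.b j⁆ hl'
  rw [leibniz_lie, hw _ i hi, hw _ j hj, smul_lie, lie_smul, ← add_smul, map_smul,
    Finsupp.smul_apply, smul_eq_mul] at h1
  have h2 := mul_right_cancel₀ hl h1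
  simp only [Pi.single_apply, ite_mul, one_mul, zero_mul, Finset.sum_ite_eq', Finset.mem_univ,
    if_true] at h2
  rw [Pi.add_apply]
  exact_mod_cast h2.symm

end IntBasis

namespace RootTable
open IntComb Module
variable {n : ℕ} (T : RootTable n)

/-- The coordinates of a weight. -/
def weight (k : ℕ) (j : Fin n) : ℤ := (T.wt k).getD j 0

/-- A numerical code for the weights. -/
def weightCode (k : ℕ) : ℕ :=
  bif Nat.blt k n then 1000000000
  else bif Nat.blt k (n + T.numPos) then 1000000000 + (T.root (k - n)).1
  else 1000000000 - (T.root (k - n - T.numPos)).1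

/-- The codes of weights, shifted. -/
def codeTree : KeyTree Unit :=
  (List.range T.dim).foldr (fun k t =>
    t.insert (T.weightCode (k * T.step % T.dim) + 1000000000) ()) .nil

/-- Whether the sum of the weights of two basis vectors is a weight, according to codes. -/
def isSumWeight (i j : ℕ) : Bool := (T.codeTree.find (T.weightCode i + T.weightCode j)).isSome

/-- The structure constants, computed more efficiently. -/
def lieTable (i j : ℕ) : IntComb := bif T.isSumWeight i j then T.br i j else []

/-- The verifications which show that the basis vectors are root vectors. -/
structure IsRoots : Prop where
  scale_pos : 0 < T.scale
  inv_mul : T.inv * T.cartan = T.scale • (1 : Matrix (Fin n) (Fin n) ℤ)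
  mul_inv : T.cartan * T.inv = T.scale • (1 : Matrix (Fin n) (Fin n) ℤ)
  diag : ∀ i, T.cartan i i = 2
  le_numPos : n ≤ T.numPos
  ef : ∀ i : Fin n, isEq (T.br (n + i) (T.idxF i)) [(i, -1)] = true
  weightE : ∀ i j : Fin n, T.weight (n + i) j = if i = j then 1 else 0
  weightF : ∀ i j : Fin n, T.weight (T.idxF i) j = if i = j then -1 else 0
  lie : ∀ i : Fin n, (List.range T.dim).all fun k =>
    isEq (T.br i k) [(k, ∑ j, T.weight k j * T.cartan i j)]
  weight_ne_zero : (List.range T.dim).all fun k => Nat.blt k n || !decide (T.weight k = 0)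
  sign : (List.range T.dim).all fun k =>
    decide (∀ j, 0 ≤ T.weight k j) || decide (∀ j, T.weight k j ≤ 0)
  code : (List.range T.dim).all fun k => decide ((T.weightCode k : ℤ) =
    1000000000 + ∑ j : Fin n, 10 ^ (7 - (j : ℕ)) * T.weight k j)
  find_code : (List.range T.dim).all fun k =>
    (T.codeTree.find (T.weightCode k + 1000000000)).isSome

variable {T}
variable {L : Type*} [LieRing L] [LieAlgebra ℂ L] (B : IntBasis L)

/-- The parametrization of the Cartan subalgebra by fundamental coweights. -/
noncomputable def cartMap (T : RootTable n) (B : IntBasis L) : (Fin n → ℂ) →ₗ[ℂ] L :=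
  ∑ j, ∑ l : Fin n, (LinearMap.proj j : (Fin n → ℂ) →ₗ[ℂ] ℂ).smulRight
    (((T.scale : ℂ)⁻¹ * T.inv j l) • B.b l)

theorem cartMap_apply (c : Fin n → ℂ) : T.cartMap B c =
    ∑ j, ∑ l : Fin n, (c j * ((T.scale : ℂ)⁻¹ * T.inv j l)) • B.b l := by
  simp [cartMap, LinearMap.sum_apply, smul_smul]

/-- The element of the Cartan subalgebra with given coordinates in the basis of coroots. -/
theorem cartMap_cartan (hT : T.IsRoots) (a : Fin n → ℤ) :
    T.cartMap B (fun j => (∑ i, a i * T.cartan i j : ℤ)) = ∑ i, (a i : ℂ) • B.b i := by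
  have hs : (T.scale : ℂ) ≠ 0 := by exact_mod_cast hT.scale_pos.ne'
  have h1 (i l : Fin n) : ∑ j, (T.cartan i j : ℂ) * ((T.scale : ℂ)⁻¹ * T.inv j l) =
      if i = l then 1 else 0 := by
    have := congrFun (congrFun hT.mul_inv i) l
    rw [Matrix.mul_apply, Matrix.smul_apply, Matrix.one_apply] at this
    have h2 : (∑ j, (T.cartan i j : ℂ) * T.inv j l) = T.scale * if i = l then 1 else 0 := by
      have := congrArg (Int.cast (R := ℂ)) this
      push_cast [smul_eq_mul] at this
      exact this
    rw [Finset.sum_congr rfl fun j _ => mul_left_comm _ _ _, ← Finset.mul_sum, h2,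
      inv_mul_cancel_left₀ hs]
  rw [cartMap_apply, Finset.sum_comm]
  refine Finset.sum_congr rfl fun l _ => ?_
  rw [← Finset.sum_smul]
  congr 1
  push_cast
  simp only [Finset.sum_mul]
  rw [Finset.sum_comm]
  simp only [mul_assoc, ← Finset.mul_sum, h1]
  simp

theorem lie_cartMap (hT : T.IsRoots) (hB : B.dim = T.dim) (hbr : B.br = T.br) (c : Fin n → ℂ)
    (k : ℕ) (hk : k < B.dim) :
    ⁅T.cartMap B c, B.b k⁆ = (∑ j, c j * T.weight k j) • B.b k := by
  have hs : (T.scale : ℂ) ≠ 0 := by exact_mod_cast hT.scale_pos.ne'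
  have h1 (i : Fin n) : ⁅B.b i, B.b k⁆ = ((∑ j, T.weight k j * T.cartan i j : ℤ) : ℂ) • B.b k := by
    rw [B.lie_b, hbr, ev_eq_ev _ (List.all_eq_true.1 (hT.lie i) k (List.mem_range.2 (hB ▸ hk)))]
    simp
  have h2 (i l : Fin n) : ∑ j, (T.inv i j :
    ℂ) * T.cartan j l = T.scale * if i = l then 1 else 0 := by
    have := congrFun (congrFun hT.inv_mul i) l
    rw [Matrix.mul_apply, Matrix.smul_apply, Matrix.one_apply] at this
    have := congrArg (Int.cast (R := ℂ)) this
    push_cast [smul_eq_mul] at this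
    exact this
  rw [cartMap_apply, sum_lie, Finset.sum_smul]
  refine Finset.sum_congr rfl fun i _ => ?_
  rw [sum_lie]
  simp only [smul_lie, h1, smul_smul, ← Finset.sum_smul]
  congr 1
  push_cast
  simp only [Finset.mul_sum]
  rw [Finset.sum_comm]
  calc _ = ∑ j, c i * (T.scale : ℂ)⁻¹ * T.weight k j * ∑ l, (T.inv i l : ℂ) * T.cartan l j := by
        refine Finset.sum_congr rfl fun j _ => ?_
        rw [Finset.mul_sum]
        exact Finset.sum_congr rfl fun l _ => by ring
    _ = _ := by
        simp only [h2]
        rw [Finset.sum_eq_single i (by intro j _ hj; simp [hj.symm]) (by simp)]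
        simp only [if_true]
        field_simp

theorem weight_sign (hT : T.IsRoots) {k : ℕ} (hk : k < T.dim) :
    0 ≤ T.weight k ∨ T.weight k ≤ 0 := by
  have := List.all_eq_true.1 hT.sign k (List.mem_range.2 hk)
  rwa [Bool.or_eq_true, decide_eq_true_eq, decide_eq_true_eq] at this

/-- A root basis. -/
noncomputable def rootBasis (hT : T.IsRoots) (B : IntBasis L) (hB : B.dim = T.dim)
    (hbr : B.br = T.br) : RootBasis L n (Fin B.dim) where
  basis := B.basis
  wt k := T.weight k
  cart := T.cartMap B
  E i := B.b (n + i)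
  F i := -B.b (T.idxF i)
  A := T.cartan
  rho j := ∑ l, T.inv j l
  lie_cart c k := by
    rw [B.basis_apply]
    exact lie_cartMap B hT hB hbr c k k.2
  mem_cart k hk := by
    have h1 := List.all_eq_true.1 hT.weight_ne_zero k (List.mem_range.2 (hB ▸ k.2))
    have h2 : (k : ℕ) < n := by simpa [hk] using h1
    refine ⟨_, (cartMap_cartan B hT (Pi.single ⟨k, h2⟩ 1)).trans ?_⟩
    rw [Finset.sum_eq_single ⟨k, h2⟩ (by intro j _ hj; simp [hj]) (by simp)]
    simp
  sign k := weight_sign hT (hB ▸ k.2)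
  triple i := by
    have hd : n + 2 * T.numPos = B.dim := hB.symm
    have hn := hT.le_numPos
    have h0 : T.cartMap B (fun j => (T.cartan i j : ℂ)) = B.b i := by
      have := cartMap_cartan B hT (Pi.single i 1)
      rw [Finset.sum_eq_single i (by intro j _ hj; simp [hj]) (by simp)] at this
      convert this using 2
      · ext j
        rw [Finset.sum_eq_single i (by intro j _ hj; simp [hj]) (by simp)]
        simp
      · simp
    have hA : ∑ j, (T.cartan i j : ℂ) * (if i = j then 1 else 0 : ℤ) = 2 := by
      rw [Finset.sum_eq_single i (by intro j _ hj; simp [hj.symm]) (by simp)]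
      simp [hT.diag]
    refine ⟨?_, ?_, ?_, ?_⟩
    · rw [h0]
      exact B.b_ne_zero (by omega)
    · rw [h0, lie_neg, B.lie_b, hbr, ev_eq_ev _ (hT.ef i)]
      simp
    · rw [lie_cartMap B hT hB hbr _ _ (by omega)]
      simp only [hT.weightE, hA]
      rw [two_nsmul, two_smul]
    · have := i.2
      rw [lie_neg, lie_cartMap B hT hB hbr _ _ (by unfold idxF; omega)]
      have hA' : ∑ j, (T.cartan i j : ℂ) * (if i = j then -1 else 0 : ℤ) = -2 := by
        rw [← hA, ← Finset.sum_neg_distrib]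
        exact Finset.sum_congr rfl fun j _ => by split_ifs <;> simp
      simp only [hT.weightF, hA']
      module
  lie_E c i := by
    have hd : n + 2 * T.numPos = B.dim := hB.symm
    have hn := hT.le_numPos
    rw [lie_cartMap B hT hB hbr _ _ (by omega)]
    simp [hT.weightE]
  lie_F c i := by
    have hd : n + 2 * T.numPos = B.dim := hB.symm
    have hn := hT.le_numPos
    rw [lie_neg, lie_cartMap B hT hB hbr _ _ (by unfold idxF; omega)]
    simp [hT.weightF]
  rho_pos i := by
    have h1 (l : Fin n) : ∑ j, T.cartan i j * T.inv j l = T.scale * if i = l then 1 else 0 := by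
      have := congrFun (congrFun hT.mul_inv i) l
      rwa [Matrix.mul_apply, Matrix.smul_apply, Matrix.one_apply, smul_eq_mul] at this
    have h2 : ∑ j, (∑ l, T.inv j l) * T.cartan i j = T.scale := by
      simp only [Finset.sum_mul]
      rw [Finset.sum_comm]
      simp [mul_comm _ (T.cartan i _), h1]
    exact hT.scale_pos.trans_eq h2.symm
  lie_F_eq_zero k i h0 h1 h2 := by
    have hd : n + 2 * T.numPos = B.dim := hB.symm
    have hn := hT.le_numPos
    rw [B.basis_apply, lie_neg, neg_eq_zero, B.eq_sum ⁅_, _⁆]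
    suffices h : B.coord ⁅B.b k, B.b (T.idxF i)⁆ = 0 by rw [h, map_zero]
    ext l
    by_contra hl
    rw [Finsupp.zero_apply] at hl
    have hl' : l < B.dim := by
      by_contra h
      exact hl (B.coord_apply_eq_zero _ (not_lt.1 h))
    have hw := B.weight_eq_add (lie_cartMap B hT hB hbr) k.2 (by unfold idxF; omega) hl
    have h3 : T.weight l i = -1 := by rw [hw, Pi.add_apply, h2, hT.weightF]; simp
    obtain ⟨j, hj⟩ : ∃ j, T.weight k j ≠ 0 := by
      by_contra! h
      exact h1 (funext h)
    have h4 : T.weight l j = T.weight k j := by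
      have hij : i ≠ j := fun h => hj (h ▸ h2)
      rw [hw, Pi.add_apply, hT.weightF]; simp [hij]
    have h5 : (0 : ℤ) ≤ T.weight k j := h0 j
    rcases weight_sign hT (hB ▸ hl') with h | h
    · have : (0 : ℤ) ≤ T.weight l i := h i; omega
    · have : T.weight l j ≤ (0 : ℤ) := h j; omega

theorem coord_lie_eq_lieTable (hT : T.IsRoots) (B : IntBasis L) (hB : B.dim = T.dim)
    (hbr : B.br = T.br) (i j : ℕ) : B.coord ⁅B.b i, B.b j⁆ = rowVec (T.lieTable i j) := by
  rw [lieTable]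
  rcases hf : T.isSumWeight i j with _ | _
  swap
  · rw [cond_true, B.coord_lie, hbr]
  rcases le_or_gt B.dim i with hi | hi
  · simp [B.b_eq_zero i hi]
  rcases le_or_gt B.dim j with hj | hj
  · simp [B.b_eq_zero j hj]
  rw [cond_false, rowVec, ev_nil]
  ext l
  by_contra hl
  rw [Finsupp.zero_apply] at hl
  have hl' : l < B.dim := by
    by_contra h
    exact hl (B.coord_apply_eq_zero _ (not_lt.1 h))
  have hw := B.weight_eq_add (lie_cartMap B hT hB hbr) hi hj hl
  have hcode {k : ℕ} (hk : k < B.dim) := List.all_eq_true.1 hT.code k (List.mem_range.2 (hB ▸ hk))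
  simp only [decide_eq_true_eq] at hcode
  have h1 : T.weightCode l + 1000000000 = T.weightCode i + T.weightCode j := by
    zify
    rw [hcode hi, hcode hj, hcode hl', hw]
    simp only [Pi.add_apply, mul_add, Finset.sum_add_distrib]
    ring
  have h2 := List.all_eq_true.1 hT.find_code l (List.mem_range.2 (hB ▸ hl'))
  rw [h1] at h2
  exact Bool.noConfusion (hf.symm.trans h2)

end RootTable

end

namespace IntComb

/-- The bracket of two combinations, according to a table of structure constants. -/
def bracket (br : ℕ → ℕ → IntComb) (x y : IntComb) : IntComb :=
  clean (collect
    (x.flatMap fun p => y.flatMap fun q => smul (p.2 * q.2) (br p.1 q.1)) [])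

/-- The concatenation of the images of a basis vector under the adjoint action of a list of
elements, with shifted indices. -/
def adRow (br : ℕ → ℕ → IntComb) (i : ℕ) : ℕ → List IntComb → IntComb
  | _, [] => []
  | s, y :: ys => (bracket br y [(i, 1)]).map (fun p => (p.1 + s, p.2)) ++ adRow br i (s + 1024) ys

/-- Whether all the indices satisfy a property. -/
def supp (P : ℕ → Bool) (x : IntComb) : Bool := x.all fun p => P p.1

end IntComb

namespace IntBasis
open IntComb
variable {L : Type*} [LieRing L] [LieAlgebra ℂ L] (B : IntBasis L)

theorem coord_lie_ev (x y : IntComb) :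
    B.coord ⁅ev B.b x, ev B.b y⁆ = rowVec (bracket B.br x y) := by
  rw [rowVec, bracket, ev_clean, ev_collect, ev_nil, add_zero]
  induction x with
  | nil => simp
  | cons p x ih =>
    rw [ev_cons, add_lie, map_add, ih, List.flatMap_cons, ev_append]
    congr 1
    clear ih
    induction y with
    | nil => simp
    | cons q y ih' =>
      rw [ev_cons, lie_add, map_add, ih', List.flatMap_cons, ev_append, ev_smul, smul_lie, lie_smul,
        map_smul, map_smul, coord_lie, smul_smul]
      push_cast
      rfl

theorem lie_ev (x y : IntComb) : ⁅ev B.b x, ev B.b y⁆ = ev B.b (bracket B.br x y) := by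
  rw [B.eq_sum ⁅ev B.b x, ev B.b y⁆, coord_lie_ev, linearCombination_rowVec]

theorem coord_ev {x : IntComb} (hx : supp (fun k => Nat.blt k B.dim) x = true) (k : ℕ) :
    B.coord (ev B.b x) k = coef k x := by
  rw [← ev_single_apply, map_ev]
  congr 1
  induction x with
  | nil => rfl
  | cons p x ih =>
    simp only [supp, List.all_cons, Bool.and_eq_true, Nat.blt_eq] at hx
    rw [ev_cons, ev_cons, ih hx.2, B.coord_b _ hx.1]

/-- The linear map underlying `adRow`. -/
noncomputable def adMap : ℕ → List IntComb → L →ₗ[ℂ] ℕ →₀ ℂ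
  | _, [] => 0
  | s, y :: ys => Finsupp.lmapDomain ℂ ℂ (· + s) ∘ₗ B.coord ∘ₗ
      (LieAlgebra.ad ℂ L (ev B.b y) : L →ₗ[ℂ] L) + adMap (s + 1024) ys

theorem adMap_b (s : ℕ) (ys : List IntComb) (i : ℕ) :
    B.adMap s ys (B.b i) = rowVec (adRow B.br i s ys) := by
  induction ys generalizing s with
  | nil => simp [adMap, adRow]
  | cons y ys ih =>
    have h1 : B.b i = ev B.b [(i, 1)] := by simp
    rw [adMap, LinearMap.add_apply, ih, adRow, rowVec, rowVec, ev_append,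
      ev_map_fst _ (· + s),
      LinearMap.comp_apply, LinearMap.comp_apply, LieAlgebra.ad_apply]
    nth_rw 1 [h1]
    rw [coord_lie_ev, rowVec, map_ev]
    simp

theorem adMap_eq_zero {u : L} (s : ℕ) {ys : List IntComb} (h : ∀ y ∈ ys, ⁅ev B.b y, u⁆ = 0) :
    B.adMap s ys u = 0 := by
  induction ys generalizing s with
  | nil => rfl
  | cons y ys ih =>
    rw [adMap, LinearMap.add_apply, ih _ fun z hz => h z (List.mem_cons_of_mem _ hz),
      LinearMap.comp_apply, LinearMap.comp_apply, LieAlgebra.ad_apply, h y List.mem_cons_self]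
    simp

theorem eq_sum_map {u : L} {K : List ℕ} (hK : K.Nodup) (hu : ∀ k < B.dim, k ∉ K → B.coord u k = 0) :
    u = (K.map fun k => B.coord u k • B.b k).sum := by
  classical
  rw [← List.sum_toFinset _ hK]
  conv_lhs => rw [B.eq_sum u, Finsupp.linearCombination_apply]
  refine Finsupp.sum_of_support_subset _ (fun k hk => ?_) _ (by simp)
  rw [List.mem_toFinset]
  by_contra h
  refine Finsupp.mem_support_iff.1 hk ?_
  rcases lt_or_ge k B.dim with hk' | hk'
  · exact hu k hk' h
  · exact B.coord_apply_eq_zero _ hk'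

/-- An element killed by a family of elements vanishes, if the corresponding rows are linearly
independent. -/
theorem eq_zero_of_lie {u : L} {K : List ℕ} {ys : List IntComb} (hK : K.Nodup)
    (hu : ∀ k < B.dim, k ∉ K → B.coord u k = 0) (h : ∀ y ∈ ys, ⁅ev B.b y, u⁆ = 0)
    {m : ℕ} (hi : indep m (K.map fun k => adRow B.br k 0 ys) = true) : u = 0 := by
  have h1 := B.adMap_eq_zero 0 h
  rw [B.eq_sum_map hK hu, map_list_sum, List.map_map] at h1
  have h2 := eq_zero_of_indep (m := m)
    (w := K.map fun k => (B.coord u k, adRow B.br k 0 ys))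
    (by simpa [List.map_map, Function.comp_def] using hi)
    (by
      rw [List.map_map, ← h1]
      congr 1
      refine List.map_congr_left fun k _ => ?_
      simp [adMap_b])
  rw [B.eq_sum_map hK hu]
  refine List.sum_eq_zero fun x hx => ?_
  obtain ⟨k, hk, rfl⟩ := List.mem_map.1 hx
  rw [show B.coord u k = 0 from h2 _ (List.mem_map_of_mem hk), zero_smul]

/-- Reduction of an element modulo elements with prescribed leading indices. -/
theorem exists_reduction (u : L) {G : List IntComb} (J : IntComb → ℕ) (hG : (G.map J).Nodup)
    (hd : ∀ g ∈ G, supp (fun k => Nat.blt k B.dim) g = true)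
    (hJ : ∀ g ∈ G, ∀ g' ∈ G, coef (J g) g' = 0 ↔ J g ≠ J g') :
    ∃ c : IntComb → ℂ, ∀ g ∈ G,
      B.coord (u - (G.map fun g => c g • ev B.b g).sum) (J g) = 0 := by
  classical
  have hn := hG.of_map
  refine ⟨fun g => B.coord u (J g) / coef (J g) g, fun g hg => ?_⟩
  rw [map_sub, map_list_sum, List.map_map, Finsupp.sub_apply, sub_eq_zero,
    ← List.sum_toFinset _ hn, Finsupp.finsetSum_apply,
    Finset.sum_eq_single_of_mem g (List.mem_toFinset.2 hg)]
  · have h0 : (coef (J g) g : ℂ) ≠ 0 := by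
      have := (hJ g hg g hg).not.2 (by simp)
      exact_mod_cast this
    rw [Function.comp_apply, map_smul, Finsupp.smul_apply, B.coord_ev (hd g hg), smul_eq_mul,
      div_mul_cancel₀ _ h0]
  · intro g' hg' hne
    rw [List.mem_toFinset] at hg'
    have h0 : coef (J g) g' = 0 := (hJ g hg g' hg').2 fun h => hne
      (List.inj_on_of_nodup_map hG hg' hg h.symm)
    rw [Function.comp_apply, map_smul, Finsupp.smul_apply, B.coord_ev (hd g' hg'), h0]
    simp

end IntBasis

section
open IntComb

/-- Data for the verification of property (P) on homogeneous elements of a given degree. `ops` are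
elements of the centralizer, `gens` are elements which span the elements of
this degree which are killed by `e` and `ops`; each one comes with a list of elements of the
centralizer, and indices of elements of maximal degree obtained with their help. -/
structure CertificateBlock where
  degree : ℤ
  ops : List IntComb
  gens : List (IntComb × List (ℕ × IntComb))

/-- Data for the verification of property (P) for a nilpotent element. -/
structure Certificate where
  diagram : List ℕ
  e : IntComb
  f : IntComb
  top : ℤ
  blocks : List CertificateBlock

namespace Certificate

/-- The leading index. -/
def lead : IntComb → ℕ
  | [] => 0
  | p :: _ => p.1

section Check
variable (br : ℕ → ℕ → IntComb) (deg : ℕ → ℤ) (dim : ℕ) (C : Certificate)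

/-- Whether a basis vector is of a given degree. -/
def hasDegree (m : ℤ) (k : ℕ) : Bool := Nat.blt k dim && isZeroInt (deg k - m)

/-- The basis vectors of a given degree. -/
def component (m : ℤ) : List ℕ := (List.range dim).filter (hasDegree deg dim m)

/-- Whether two indices are equal or the first one is in a list. -/
def isMem (k : ℕ) (l : List ℕ) : Bool := l.any fun k' => Nat.beq k k'

/-- The verification of the images of a generator. -/
def checkImages (b : CertificateBlock) (g : IntComb) : List ℕ → List (ℕ × IntComb) → Bool
  | prev, [] => (component deg dim C.top).all fun k => isMem k prev
  | prev, (j, x) :: l =>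
    supp (hasDegree deg dim (C.top + 2 - b.degree)) x && (bracket br C.e x).isEmpty &&
    (b.gens.all fun g' => bif Nat.beq (lead g'.1) (lead g) then
        supp (fun k => isMem k (j :: prev)) (bracket br (bracket br C.f x) g'.1) &&
          !isZeroInt (coef j (bracket br (bracket br C.f x) g'.1))
      else supp (fun k => isMem k prev) (bracket br (bracket br C.f x) g'.1)) &&
    checkImages b g (j :: prev) l

/-- The verifications in a given degree. -/
def checkBlock (b : CertificateBlock) : Bool :=
  (b.ops.all fun y => (bracket br C.e y).isEmpty) &&
  (b.gens.all fun g => supp (hasDegree deg dim b.degree) g.1 &&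
    (C.e :: b.ops).all fun y => (bracket br y g.1).isEmpty) &&
  decide (b.gens.map fun g => lead g.1).Nodup &&
  (b.gens.all fun g => b.gens.all fun g' =>
    bif Nat.beq (lead g.1) (lead g'.1) then !isZeroInt (coef (lead g.1) g'.1)
    else isZeroInt (coef (lead g.1) g'.1)) &&
  indep dim (((component deg dim b.degree).filter fun k =>
    !isMem k (b.gens.map fun g => lead g.1)).map fun k => adRow br k 0 (C.e :: b.ops)) &&
  b.gens.all fun g => checkImages br deg dim C b g.1 [] g.2

/-- The verifications on a certificate. -/
structure IsValid : Prop where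
  top_pos : 0 < C.top
  supp_e : supp (hasDegree deg dim 2) C.e = true
  supp_f : supp (hasDegree deg dim (-2)) C.f = true
  blocks : C.blocks.all (checkBlock br deg dim C) = true
  zero : (C.blocks.all fun b => !isZeroInt b.degree || (b.ops.isEmpty && b.gens.isEmpty)) = true
  covers : ((List.range dim).all fun k => decide (deg k < 0) ||
    (decide (deg k ≤ C.top) && C.blocks.any fun b => isZeroInt (deg k - b.degree))) = true
  top : (component deg dim C.top).isEmpty = false

end Check

variable {L : Type*} [LieRing L] [LieAlgebra ℂ L] {B : IntBasis L} {deg : ℕ → ℤ} {h : L}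
  (hh : ∀ k < B.dim, ⁅h, B.b k⁆ = (deg k : ℂ) • B.b k) {C : Certificate}

theorem isMem_iff {k : ℕ} {l : List ℕ} : isMem k l = true ↔ k ∈ l := by
  simp [isMem]

theorem hasDegree_iff {dim : ℕ} {m : ℤ} {k : ℕ} :
    hasDegree deg dim m k = true ↔ k < dim ∧ deg k = m := by
  rw [hasDegree, Bool.and_eq_true, isZeroInt_iff, sub_eq_zero, Nat.blt_eq]

theorem mem_component {dim : ℕ} {m : ℤ} {k : ℕ} :
    k ∈ component deg dim m ↔ k < dim ∧ deg k = m := by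
  rw [component, List.mem_filter, hasDegree_iff, List.mem_range]
  tauto

theorem nodup_component {dim : ℕ} {m : ℤ} : (component deg dim m).Nodup :=
  List.nodup_range.filter _

theorem supp_blt {dim : ℕ} {m : ℤ} {x : IntComb} (hx : supp (hasDegree deg dim m) x = true) :
    supp (fun k => Nat.blt k dim) x = true := by
  rw [supp, List.all_eq_true] at hx ⊢
  exact fun p hp => Nat.blt_eq ▸ (hasDegree_iff.1 (hx p hp)).1

include hh in
theorem lie_ev {m : ℤ} {x : IntComb} (hx : supp (hasDegree deg B.dim m) x = true) :
    ⁅h, ev B.b x⁆ = (m : ℂ) • ev B.b x := by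
  induction x with
  | nil => simp
  | cons p x ih =>
    simp only [supp, List.all_cons, Bool.and_eq_true, hasDegree_iff] at hx
    rw [ev_cons, lie_add, ih hx.2, lie_smul, hh _ hx.1.1, hx.1.2, smul_comm, smul_add]

include hh in
theorem coord_lie (x : L) {l : ℕ} (hl : l < B.dim) : B.coord ⁅h, x⁆ l = deg l * B.coord x l := by
  rw [B.eq_sum x, Finsupp.linearCombination_apply, Finsupp.sum, lie_sum, map_sum, map_sum,
    Finsupp.finsetSum_apply, Finsupp.finsetSum_apply, Finset.mul_sum]
  refine Finset.sum_congr rfl fun k _ => ?_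
  rcases lt_or_ge k B.dim with hk | hk
  · rw [lie_smul, hh k hk, map_smul, map_smul, map_smul, B.coord_b k hk]
    rcases eq_or_ne k l with rfl | hkl
    · simp [mul_comm]
    · simp [hkl]
  · simp [B.b_eq_zero k hk]

include hh in
theorem coord_eq_zero {m : ℤ} {u : L} (hu : ⁅h, u⁆ = (m : ℂ) • u) {k : ℕ} (hk : k < B.dim)
    (hkm : deg k ≠ m) : B.coord u k = 0 := by
  have h1 := coord_lie hh u hk
  rw [hu, map_smul, Finsupp.smul_apply, smul_eq_mul, ← sub_eq_zero, ← sub_mul, mul_eq_zero,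
    sub_eq_zero] at h1
  exact h1.resolve_left fun h => hkm (by exact_mod_cast h.symm)

theorem lie_ev_eq_zero {x y : IntComb} (hxy : (bracket B.br x y).isEmpty = true) :
    ⁅ev B.b x, ev B.b y⁆ = 0 := by
  rw [B.lie_ev, List.isEmpty_iff.1 hxy, ev_nil]

include hh in
/-- The elements killed by `e` and `ops` are combinations of generators. -/
theorem exists_eq_sum {b : CertificateBlock} (hb : checkBlock B.br deg B.dim C b = true) {u : L}
    (hu : ⁅h, u⁆ = (b.degree : ℂ) • u) (hu' : ∀ y ∈ C.e :: b.ops, ⁅ev B.b y, u⁆ = 0) :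
    ∃ c : IntComb → ℂ, u = (b.gens.map fun g => c g.1 • ev B.b g.1).sum := by
  simp only [checkBlock, Bool.and_eq_true, decide_eq_true_eq] at hb
  obtain ⟨⟨⟨⟨⟨-, hg⟩, hn⟩, hJ⟩, hi⟩, -⟩ := hb
  rw [List.all_eq_true] at hg hJ
  have hg' (g) (hmem : g ∈ b.gens) : supp (hasDegree deg B.dim b.degree) g.1 = true ∧
      ∀ y ∈ C.e :: b.ops, ⁅ev B.b y, ev B.b g.1⁆ = 0 := by
    have := hg g hmem
    rw [Bool.and_eq_true, List.all_eq_true] at this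
    exact ⟨this.1, fun y hy => lie_ev_eq_zero (this.2 y hy)⟩
  obtain ⟨c, hc⟩ := B.exists_reduction u (G := b.gens.map Prod.fst) lead
    (by rwa [List.map_map])
    (by
      simp only [List.mem_map]
      rintro _ ⟨g, hmem, rfl⟩
      exact supp_blt (hg' g hmem).1)
    (by
      simp only [List.mem_map]
      rintro _ ⟨g, hmem, rfl⟩ _ ⟨g', hmem', rfl⟩
      have := List.all_eq_true.1 (hJ g hmem) g' hmem'
      rw [← isZeroInt_iff]
      cases h : Nat.beq (lead g.1) (lead g'.1) with
      | true => simp_all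
      | false =>
        rw [h, cond_false] at this
        have h' : lead g.1 ≠ lead g'.1 := fun h' => by simp [h'] at h
        simp [this, h'])
  refine ⟨c, sub_eq_zero.1 ?_⟩
  rw [List.map_map] at hc
  have hsum : ∀ T : L →ₗ[ℂ] L, (∀ g ∈ b.gens, T (ev B.b g.1) = 0) →
      T (b.gens.map fun g => c g.1 • ev B.b g.1).sum = 0 := by
    intro T hT
    rw [map_list_sum, List.map_map]
    refine List.sum_eq_zero fun x hx => ?_
    obtain ⟨g, hg, rfl⟩ := List.mem_map.1 hx
    simp [hT g hg]
  refine B.eq_zero_of_lie (nodup_component.filter _) (fun k hk hkK => ?_) (fun y hy => ?_)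
    (K := (component deg B.dim b.degree).filter fun k => !isMem k (b.gens.map fun g => lead g.1))
    (ys := C.e :: b.ops) (m := B.dim) ?_
  · by_cases hkd : deg k = b.degree
    · have h1 : k ∈ b.gens.map fun g => lead g.1 := by
        by_contra h
        refine hkK (List.mem_filter.2 ⟨mem_component.2 ⟨hk, hkd⟩, ?_⟩)
        rw [Bool.not_eq_true', ← Bool.not_eq_true, isMem_iff]
        exact h
      obtain ⟨g, hg, rfl⟩ := List.mem_map.1 h1
      exact hc g.1 (List.mem_map_of_mem hg)
    · refine coord_eq_zero hh (m := b.degree) ?_ hk hkd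
      rw [lie_sub, hu, smul_sub]
      congr 1
      have := hsum (LieAlgebra.ad ℂ L h - (b.degree : ℂ) • 1) fun g hg => by
        simp [lie_ev hh (hg' g hg).1]
      exact sub_eq_zero.1 this
  · rw [lie_sub, hu' y hy, zero_sub, neg_eq_zero]
    exact hsum (LieAlgebra.ad ℂ L (ev B.b y)) fun g hg => (hg' g hg).2 y hy
  · exact hi

/-- The elements `⁅⁅f, x⁆, u⁆`, where `x` is a homogeneous element of the centralizer of `e`. -/
noncomputable def images (e h f u : L) (m : ℤ) : Submodule ℂ L :=
  (LinearMap.ker (LieAlgebra.ad ℂ L e : L →ₗ[ℂ] L) ⊓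
    LinearMap.ker ((LieAlgebra.ad ℂ L h : L →ₗ[ℂ] L) - (m : ℂ) • 1)).map
    (-(LieAlgebra.ad ℂ L u : L →ₗ[ℂ] L) ∘ₗ (LieAlgebra.ad ℂ L f : L →ₗ[ℂ] L))

theorem mem_images {e h f u z : L} {m : ℤ} : z ∈ images e h f u m ↔
    ∃ x : L, ⁅e, x⁆ = 0 ∧ ⁅h, x⁆ = (m : ℂ) • x ∧ ⁅⁅f, x⁆, u⁆ = z := by
  rw [images, Submodule.mem_map]
  refine exists_congr fun x => ?_
  rw [Submodule.mem_inf, and_assoc, ← lie_skew]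
  simp [sub_eq_zero]

theorem ev_mem_of_supp {v : ℕ → L} {S : Submodule ℂ L} {l : List ℕ} (hl : ∀ k ∈ l, v k ∈ S)
    {x : IntComb} (hx : supp (fun k => isMem k l) x = true) : ev v x ∈ S := by
  rw [supp, List.all_eq_true] at hx
  refine Submodule.span_le.2 ?_ (ev_mem_span v (s := {k | k ∈ l}) fun p hp => isMem_iff.1 (hx p hp))
  rintro _ ⟨k, hk, rfl⟩
  exact hl k hk

theorem mem_of_ev_mem {v : ℕ → L} {S : Submodule ℂ L} {l : List ℕ} {j : ℕ} (hl : ∀ k ∈ l, v k ∈ S)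
    {x : IntComb} (hx : supp (fun k => isMem k (j :: l)) x = true) {c : ℂ} (hS : c • ev v x ∈ S)
    (hc : c ≠ 0) (hj : coef j x ≠ 0) : v j ∈ S := by
  have h1 : ev v x - (coef j x : ℂ) • v j ∈ S := by
    clear hS hj
    induction x with
    | nil => simp [coef]
    | cons p x ih =>
      rw [supp, List.all_cons, Bool.and_eq_true, isMem_iff] at hx
      have h2 := ih hx.2
      rw [coef, ev_cons]
      cases h : Nat.beq j p.1 with
      | true =>
        rw [Nat.eq_of_beq_eq_true h, cond_true, Int.cast_add, add_smul, add_sub_add_left_eq_sub]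
        rwa [Nat.eq_of_beq_eq_true h] at h2
      | false =>
        have h' : p.1 ≠ j := fun h' => by simp [h'] at h
        rw [cond_false, add_sub_assoc]
        exact add_mem (S.smul_mem _ (hl _ ((List.mem_cons.1 hx.1).resolve_left h'))) h2
  have h3 := S.sub_mem ((S.smul_mem_iff hc).1 hS) h1
  rw [sub_sub_cancel] at h3
  exact (S.smul_mem_iff (by exact_mod_cast hj)).1 h3

include hh in
theorem mem_images_of_checkImages {b : CertificateBlock}
    (hn : (b.gens.map fun g => lead g.1).Nodup) {c : IntComb → ℂ} {u : L}
    (hu : u = (b.gens.map fun g => c g.1 • ev B.b g.1).sum) {g : IntComb × List (ℕ × IntComb)}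
    (hg : g ∈ b.gens) (hc : c g.1 ≠ 0) {prev : List ℕ} {l : List (ℕ × IntComb)}
    (hl : checkImages B.br deg B.dim C b g.1 prev l = true)
    (hprev : ∀ k ∈ prev, B.b k ∈ images (ev B.b C.e) h (ev B.b C.f) u (C.top + 2 - b.degree)) :
    ∀ k ∈ component deg B.dim C.top,
      B.b k ∈ images (ev B.b C.e) h (ev B.b C.f) u (C.top + 2 - b.degree) := by
  classical
  induction l generalizing prev with
  | nil =>
    intro k hk
    rw [checkImages, List.all_eq_true] at hl
    exact hprev k (isMem_iff.1 (hl k hk))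
  | cons p l ih =>
    obtain ⟨j, x⟩ := p
    simp only [checkImages, Bool.and_eq_true] at hl
    obtain ⟨⟨⟨hx, hex⟩, hall⟩, hl⟩ := hl
    rw [List.all_eq_true] at hall
    refine ih hl fun k hk => ?_
    rcases List.mem_cons.1 hk with rfl | hk
    swap
    · exact hprev k hk
    set S := images (ev B.b C.e) h (ev B.b C.f) u (C.top + 2 - b.degree)
    set r := fun g' : IntComb × List (ℕ × IntComb) =>
      bracket B.br (bracket B.br C.f x) g'.1
    have hr (g' : IntComb × List (ℕ × IntComb)) :
        ⁅⁅ev B.b C.f, ev B.b x⁆, ev B.b g'.1⁆ = ev B.b (r g') := by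
      rw [B.lie_ev, B.lie_ev]
    have h1 : (b.gens.map fun g' => c g'.1 • ev B.b (r g')).sum ∈ S := by
      refine mem_images.2 ⟨ev B.b x, lie_ev_eq_zero hex, lie_ev hh hx, ?_⟩
      rw [hu, ← LieAlgebra.ad_apply ℂ L ⁅ev B.b C.f, ev B.b x⁆, map_list_sum, List.map_map]
      congr 1
      refine List.map_congr_left fun g' _ => ?_
      rw [Function.comp_apply, map_smul, LieAlgebra.ad_apply, hr]
    rw [← List.sum_toFinset _ hn.of_map, ← Finset.add_sum_erase _ _ (List.mem_toFinset.2 hg)] at h1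
    rw [Submodule.add_mem_iff_left] at h1
    · have := hall g hg
      rw [Nat.beq_refl, cond_true, Bool.and_eq_true, Bool.not_eq_true', ← Bool.not_eq_true,
        isZeroInt_iff] at this
      exact mem_of_ev_mem hprev this.1 h1 hc this.2
    · refine Submodule.sum_mem _ fun g' hg' => S.smul_mem _ ?_
      rw [Finset.mem_erase, List.mem_toFinset] at hg'
      have := hall g' hg'.2
      have hne : Nat.beq (lead g'.1) (lead g.1) = false := by
        rw [← Bool.not_eq_true, Nat.beq_eq]
        exact fun h => hg'.1 (List.inj_on_of_nodup_map hn hg'.2 hg h)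
      rw [hne, cond_false] at this
      exact ev_mem_of_supp hprev this

include hh in
theorem eq_zero_of_forall_coord {m : ℤ} {u : L} (hu : ⁅h, u⁆ = (m : ℂ) • u)
    (hm : ∀ k < B.dim, deg k ≠ m) : u = 0 := by
  rw [B.eq_sum u]
  suffices h : B.coord u = 0 by rw [h, map_zero]
  ext k
  rcases lt_or_ge k B.dim with hk | hk
  · exact coord_eq_zero hh hu hk (hm k hk)
  · exact B.coord_apply_eq_zero _ hk

theorem IsValid.exists_block (hC : C.IsValid B.br deg B.dim) {k : ℕ} (hk : k < B.dim)
    (h0 : 0 ≤ deg k) : deg k ≤ C.top ∧ ∃ b ∈ C.blocks, deg k = b.degree := by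
  have := List.all_eq_true.1 hC.covers k (List.mem_range.2 hk)
  rw [Bool.or_eq_true, Bool.and_eq_true, decide_eq_true_eq, decide_eq_true_eq,
    List.any_eq_true] at this
  obtain ⟨h1, b, hb, h2⟩ := this.resolve_left h0.not_gt
  exact ⟨h1, b, hb, sub_eq_zero.1 ((isZeroInt_iff _).1 h2)⟩

include hh in
theorem IsValid.injective (hC : C.IsValid B.br deg B.dim) {a : L} (ha : ⁅h, a⁆ = 0)
    (hea : ⁅ev B.b C.e, a⁆ = 0) : a = 0 := by
  have ha' : ⁅h, a⁆ = ((0 : ℤ) : ℂ) • a := by simpa using ha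
  by_contra hne
  have : ∃ k < B.dim, deg k = 0 := by
    by_contra! hk
    exact hne (eq_zero_of_forall_coord hh ha' hk)
  obtain ⟨k, hk, hk0⟩ := this
  obtain ⟨-, b, hb, hkb⟩ := hC.exists_block hk hk0.ge
  rw [hk0] at hkb
  have h1 := List.all_eq_true.1 hC.zero b hb
  rw [← hkb, Bool.or_eq_true, Bool.and_eq_true, List.isEmpty_iff, List.isEmpty_iff] at h1
  obtain ⟨h2, h3⟩ := h1.resolve_left (by decide)
  obtain ⟨c, hc⟩ := exists_eq_sum hh (List.all_eq_true.1 hC.blocks b hb) (u := a)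
    (by rw [← hkb]; exact ha') (by simpa [h2] using hea)
  exact hne (by simpa [h3] using hc)

include hh in
theorem IsValid.exists_lie_eq (hC : C.IsValid B.br deg B.dim) {k : ℤ} (hk : 0 < k) {u : L}
    (hu : InCenterOfCentralizer L (ev B.b C.e) u) (hu0 : u ≠ 0) (hku : ⁅h, u⁆ = (k : ℂ) • u) {z : L}
    (hz : ⁅h, z⁆ = (C.top : ℂ) • z) : ∃ x : L, ⁅x, ev B.b C.e⁆ = 0 ∧
      ⁅h, x⁆ = ((C.top + 2 - k : ℤ) : ℂ) • x ∧ ⁅⁅ev B.b C.f, x⁆, u⁆ = z := by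
  have : ∃ i < B.dim, deg i = k := by
    by_contra! h
    exact hu0 (eq_zero_of_forall_coord hh hku h)
  obtain ⟨i, hi, rfl⟩ := this
  obtain ⟨-, b, hb, hib⟩ := hC.exists_block hi hk.le
  rw [hib] at hku ⊢
  have hcheck := List.all_eq_true.1 hC.blocks b hb
  have hcheck' := hcheck
  simp only [checkBlock, Bool.and_eq_true, decide_eq_true_eq] at hcheck'
  obtain ⟨⟨⟨⟨⟨hops, -⟩, hn⟩, -⟩, -⟩, hI⟩ := hcheck'
  rw [List.all_eq_true] at hops hI
  obtain ⟨c, hc⟩ := exists_eq_sum hh hcheck hku fun y hy => by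
    rw [← lie_skew, neg_eq_zero]
    rcases List.mem_cons.1 hy with rfl | hy
    · exact hu.1
    · exact hu.2 _ (by rw [← lie_skew, lie_ev_eq_zero (hops y hy), neg_zero])
  obtain ⟨g, hg, hgc⟩ : ∃ g ∈ b.gens, c g.1 ≠ 0 := by
    by_contra! h
    refine hu0 (hc.trans (List.sum_eq_zero fun x hx => ?_))
    obtain ⟨g, hg, rfl⟩ := List.mem_map.1 hx
    rw [h g hg, zero_smul]
  have hS := mem_images_of_checkImages hh hn hc hg hgc (hI g hg) (by simp)
  have hz' : z ∈ images (ev B.b C.e) h (ev B.b C.f) u (C.top + 2 - b.degree) := by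
    rw [B.eq_sum_map (u := z) (K := component deg B.dim C.top) nodup_component fun k hk hk' =>
      coord_eq_zero hh hz hk fun h => hk' (mem_component.2 ⟨hk, h⟩)]
    refine list_sum_mem fun y hy => ?_
    obtain ⟨k, hk, rfl⟩ := List.mem_map.1 hy
    exact Submodule.smul_mem _ _ (hS k hk)
  obtain ⟨x, h1, h2, h3⟩ := mem_images.1 hz'
  exact ⟨x, by rw [← lie_skew, h1, neg_zero], h2, h3⟩

end Certificate

end

section
open IntComb

/-- The product of two lists of numbers. -/
def listDot : List ℕ → List ℤ → ℤ
  | a :: d, b :: w => a * b + listDot d w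
  | _, _ => 0

theorem listDot_eq {n : ℕ} {d : List ℕ} (hd : d.length = n) (w : List ℤ) :
    listDot d w = ∑ j : Fin n, (d.getD j 0 : ℤ) * w.getD j 0 := by
  induction d generalizing n w with
  | nil => subst hd; simp [listDot]
  | cons a d ih =>
    subst hd
    cases w with
    | nil => simp [listDot]
    | cons b w =>
      rw [listDot, ih rfl, List.length_cons, Fin.sum_univ_succ]
      simp

namespace RootTable
variable {n : ℕ} (T : RootTable n)

/-- The degrees of basis vectors for the grading defined by a weighted Dynkin diagram. -/
def degree (d : List ℕ) (k : ℕ) : ℤ := listDot d (T.wt k)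

/-- A verification of property (P) for a weighted Dynkin diagram. -/
structure IsCertificate (C : Certificate) : Prop
    extends C.IsValid T.lieTable (T.degree C.diagram) T.dim where
  length : C.diagram.length = n
  bracket_ef : isEq (smul T.scale (bracket T.lieTable C.e C.f)) ((List.finRange n).map fun l =>
    (l.val, ∑ j : Fin n, (C.diagram.getD j 0 : ℤ) * T.inv j l)) = true

instance (C : Certificate) : Decidable (T.IsCertificate C) :=
  decidable_of_iff
    (((0 < C.top ∧ supp (Certificate.hasDegree (T.degree C.diagram) T.dim 2) C.e = true) ∧
      supp (Certificate.hasDegree (T.degree C.diagram) T.dim (-2)) C.f = true ∧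
      C.blocks.all (Certificate.checkBlock T.lieTable (T.degree C.diagram) T.dim C) = true) ∧
      ((C.blocks.all fun b => !isZeroInt b.degree || (b.ops.isEmpty && b.gens.isEmpty)) = true ∧
      ((List.range T.dim).all fun k => decide (T.degree C.diagram k < 0) ||
        (decide (T.degree C.diagram k ≤ C.top) && C.blocks.any fun b =>
          isZeroInt (T.degree C.diagram k - b.degree))) = true ∧
      (Certificate.component (T.degree C.diagram) T.dim C.top).isEmpty = false) ∧
      C.diagram.length = n ∧
      isEq (smul T.scale (bracket T.lieTable C.e C.f)) ((List.finRange n).map fun l =>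
        (l.val, ∑ j : Fin n, (C.diagram.getD j 0 : ℤ) * T.inv j l)) = true)
    ⟨fun ⟨⟨⟨h1, h2⟩, h3, h4⟩, ⟨h5, h6, h7⟩, h8, h9⟩ => ⟨⟨h1, h2, h3, h4, h5, h6, h7⟩, h8, h9⟩,
      fun ⟨⟨h1, h2, h3, h4, h5, h6, h7⟩, h8, h9⟩ => ⟨⟨⟨h1, h2⟩, h3, h4⟩, ⟨h5, h6, h7⟩, h8, h9⟩⟩

variable {T} {L : Type*} [LieRing L] [LieAlgebra ℂ L]

theorem deg_rootBasis (hT : T.IsRoots) (B : IntBasis L) (hB : B.dim = T.dim) (hbr : B.br = T.br)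
    {d : List ℕ} (hd : d.length = n) (k : Fin B.dim) :
    (rootBasis hT B hB hbr).deg (fun j => d.getD j 0) k = T.degree d k :=
  (listDot_eq hd _).symm

variable [FiniteDimensional ℂ L]

theorem IsCertificate.exists_triple (hT : T.IsRoots) (B : IntBasis L) (hB : B.dim = T.dim)
    (hbr : B.br = T.br) {C : Certificate} (hC : T.IsCertificate C) :
    ∃ e f : L, IsSl2Triple ((rootBasis hT B hB hbr).cart fun i => ((C.diagram.getD i 0 : ℕ) :
      ℂ)) e f ∧
      (∀ a : L, ⁅(rootBasis hT B hB hbr).cart fun i => ((C.diagram.getD i 0 : ℕ) : ℂ), a⁆ = 0 →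
        ⁅e, a⁆ = 0 → a = 0) ∧
      PropertyP L e ((rootBasis hT B hB hbr).cart fun i => ((C.diagram.getD i 0 : ℕ) : ℂ)) f := by
  set R := rootBasis hT B hB hbr
  set d : Fin n → ℕ := fun j => C.diagram.getD j 0
  set h : L := R.cart fun i => (d i : ℂ)
  let B' : IntBasis L :=
    { B with
      br := T.lieTable
      coord_lie := coord_lie_eq_lieTable hT B hB hbr }
  have hh : ∀ k < B'.dim, ⁅h, B'.b k⁆ = (T.degree C.diagram k : ℂ) • B'.b k := by
    intro k hk
    have := R.lie_cart_natCast d ⟨k, hk⟩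
    rwa [deg_rootBasis hT B hB hbr hC.length, show R.basis ⟨k, hk⟩ = B.b k from B.basis_apply _]
      at this
  have hV : C.IsValid B'.br (T.degree C.diagram) B'.dim := by
    change C.IsValid T.lieTable _ B.dim
    rw [hB]
    exact hC.toIsValid
  obtain ⟨k, hk, hkM⟩ : ∃ k < B'.dim, T.degree C.diagram k = C.top := by
    obtain ⟨k, hk⟩ := List.exists_mem_of_ne_nil _ fun h0 =>
      Bool.noConfusion (hV.top.symm.trans (List.isEmpty_iff.2 h0))
    exact ⟨k, Certificate.mem_component.1 hk⟩
  have h0 : h ≠ 0 := by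
    intro h0
    have h1 := hh k hk
    rw [h0, zero_lie, hkM, eq_comm, smul_eq_zero] at h1
    rcases h1 with h1 | h1
    · exact hV.top_pos.ne' (by exact_mod_cast h1)
    · exact B.b_ne_zero hk h1
  have ht : IsSl2Triple h (ev B'.b C.e) (ev B'.b C.f) := by
    refine ⟨h0, ?_, ?_, ?_⟩
    · have hs : (T.scale : ℂ) ≠ 0 := by exact_mod_cast hT.scale_pos.ne'
      have h1 := ev_eq_ev B.b hC.bracket_ef
      rw [ev_smul] at h1
      rw [B'.lie_ev, ← inv_smul_smul₀ hs (ev _ _)]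
      change (T.scale : ℂ)⁻¹ • (T.scale : ℂ) • ev B.b (bracket T.lieTable C.e C.f) = T.cartMap B _
      rw [h1, cartMap_apply, Finset.sum_comm, ev, List.map_map, ← List.ofFn_eq_map, List.sum_ofFn,
        Finset.smul_sum]
      refine Finset.sum_congr rfl fun l _ => ?_
      rw [← Finset.sum_smul, Function.comp_apply, smul_smul]
      congr 1
      push_cast
      rw [Finset.mul_sum]
      exact Finset.sum_congr rfl fun j _ => by ring
    · rw [Certificate.lie_ev hh hV.supp_e, ← Nat.cast_smul_eq_nsmul ℂ]
      simp
    · rw [Certificate.lie_ev hh hV.supp_f, ← Nat.cast_smul_eq_nsmul ℂ]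
      simp
  refine ⟨_, _, ht, fun a ha hea => hV.injective hh ha hea,
    R.propertyP_of_homogeneous d ht (fun a ha hea => hV.injective hh ha hea) (M := C.top) ?_ ?_
    fun k hk u hu hu0 hku z hz => hV.exists_lie_eq hh hk hu hu0 hku hz⟩
  · intro k
    rw [deg_rootBasis hT B hB hbr hC.length]
    by_contra! hk
    exact hk.not_ge (hV.exists_block k.2 (hV.top_pos.trans hk).le).1
  · exact ⟨⟨k, hk⟩, (deg_rootBasis hT B hB hbr hC.length _).trans hkM⟩

end RootTable

end

/-- Certificates for the distinguished nilpotent elements in type `G₂`. -/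
def certificatesG2 : List Certificate := [
  { diagram := [0, 2], top := 4, e := [(3, 1), (6, 1)], f := [(9, -2), (12, -2)], blocks := [⟨0,
    [], []⟩, ⟨2, [[(4, 1)], [(5, 1)]], [([(3, 1), (6, 1)], [(7, [(7, 1)])])]⟩, ⟨4, [], [([(7, 1)],
    [(7, [(3, 1), (6, 1)])])]⟩] },
  { diagram := [2, 2], top := 10, e := [(2, 1), (3, 1)], f := [(8, -6), (9, -10)], blocks := [⟨0,
    [], []⟩, ⟨2, [], [([(3, 1), (2, 1)], [(7, [(7, 1)])])]⟩, ⟨4, [], []⟩, ⟨6, [], []⟩, ⟨8, [], []⟩,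
    ⟨10, [], [([(7, 1)], [(7, [(2, 1), (3, 1)])])]⟩] }]

/-- Certificates for the distinguished nilpotent elements in type `F₄`. -/
def certificatesF4 : List Certificate := [
  { diagram := [0, 0, 2, 0], top := 6, e := [(6, 1), (12, 1), (15, 1), (17, 1)], f := [(30, -1),
    (36, -4), (39, -3), (41, -1)], blocks := [⟨0, [], []⟩, ⟨2, [[(6, 1)], [(10, 1), (11, -1), (16,
    -1), (20, 1)]], [([(6, 1), (12, 1), (15, 1), (17, 1)], [(26, [(26, 1)]), (27, [(27, 1)])])]⟩,
    ⟨4, [[(13, -1), (14, 1)], [(6, 1)], [(17, 1)]], []⟩, ⟨6, [], [([(26, 1)], [(26, [(6, 1)]), (27,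
    [(10, 1), (11, -1), (16, -1), (20, 1)])]), ([(27, 1)], [(27, [(6, -4), (12, 1), (15, 1)]), (26,
    [(10, 1), (11, -1), (16, -1), (20, 1)])])]⟩] },
  { diagram := [2, 0, 2, 0], top := 10, e := [(6, 1), (8, 1), (12, 1), (13, 1)], f := [(30, -9),
    (32, -8), (36, -1), (37, -5)], blocks := [⟨0, [], []⟩, ⟨2, [[(22, -1), (25, 1)]], [([(6, 1),
    (8, 1), (12, 1), (13, 1)], [(26, [(26, 1)]), (27, [(27, 1)])])]⟩, ⟨4, [[(17, -1), (21, 1)]],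
    []⟩, ⟨6, [[(14, -1), (19, 1)]], []⟩, ⟨8, [[(12, 1)]], []⟩, ⟨10, [], [([(26, 1)], [(26, [(12,
    1)]), (27, [(4, -1), (9, -1), (10, -1), (16, 3)])]), ([(27, 1)], [(27, [(6, -1), (8, -1), (12,
    9), (13, -1)]), (26, [(4, -1), (9, -1), (10, -1), (16, 3)])])]⟩] },
  { diagram := [2, 0, 2, 2], top := 14, e := [(4, 1), (6, 1), (7, 1), (12, 1)], f := [(28, -10),
    (30, -8), (31, -14), (36, -18)], blocks := [⟨0, [], []⟩, ⟨2, [], [([(7, 1), (4, 1), (6, 1),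
    (12, 1)], [(27, [(27, 1)])])]⟩, ⟨4, [[(24, 1)]], []⟩, ⟨6, [[(11, 1), (13, 1)]], []⟩, ⟨8, [],
    []⟩, ⟨10, [[(11, 1), (13, 1)]], [([(22, -1), (25, 1)], [(27, [(17, 2), (18, 1), (19, -1)])])]⟩,
    ⟨12, [], []⟩, ⟨14, [], [([(27, 1)], [(27, [(4, 1), (6, 1), (7, 1), (12, 1)])])]⟩] },
  { diagram := [2, 2, 2, 2], top := 22, e := [(4, 1), (5, 1), (6, 1), (7, 1)], f := [(28, -16),
    (29, -30), (30, -42), (31, -22)], blocks := [⟨0, [], []⟩, ⟨2, [], [([(7, 1), (4, 1), (5, 1),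
    (6, 1)], [(27, [(27, 1)])])]⟩, ⟨4, [], []⟩, ⟨6, [], []⟩, ⟨8, [], []⟩, ⟨10, [], [([(19, -1),
    (17, 2), (18, 1)], [(27, [(22, 1), (23, -1)])])]⟩, ⟨12, [], []⟩, ⟨14, [], [([(23, -1), (22,
    1)], [(27, [(17, 2), (18, 1), (19, -1)])])]⟩, ⟨16, [], []⟩, ⟨18, [], []⟩, ⟨20, [], []⟩, ⟨22,
    [], [([(27, 1)], [(27, [(4, 1), (5, 1), (6, 1), (7, 1)])])]⟩] }]

/-- Certificates for the distinguished nilpotent elements in type `E₆`. -/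
def certificatesE6 : List Certificate := [
  { diagram := [2, 0, 0, 2, 0, 2], top := 10, e := [(9, 1), (11, 1), (12, 1), (18, 1), (19, 1),
    (20, 1)], f := [(45, -5), (47, -8), (48, -8), (54, -1), (55, -9), (56, -5)], blocks := [⟨0, [],
    []⟩, ⟨2, [[(37, 1), (38, -1)]], [([(11, 1), (9, 1), (12, 1), (18, 1), (19, 1), (20, 1)], [(40,
    [(40, 1)]), (41, [(41, 1)])])]⟩, ⟨4, [[(18, 1)], [(21, -1), (22, 1), (23, -1), (30, 1)]], []⟩,
    ⟨6, [[(21, -1), (22, 2), (23, -1), (29, 1)]], []⟩, ⟨8, [[(18, 1)]], [([(35, -1), (39, 1)],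
    [(40, [(17, -1), (25, 1), (26, -1), (27, 1)]), (41, [(21, -1), (22, 1), (23, -1), (30,
    1)])])]⟩, ⟨10, [], [([(40, 1)], [(40, [(9, -1), (11, -1), (12, -1), (18, 9), (19, -1), (20,
    -1)]), (41, [(6, 1), (13, 1), (14, -3), (15, 1), (16, 1), (24, 1)])]), ([(41, 1)], [(41, [(18,
    1)]), (40, [(6, 1), (13, 1), (14, -3), (15, 1), (16, 1), (24, 1)])])]⟩] },
  { diagram := [2, 2, 2, 0, 2, 2], top := 16, e := [(6, 1), (7, 1), (10, 1), (11, 1), (13, 1), (14,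
    1)], f := [(42, -12), (43, -8), (44, 8), (46, -22), (47, -12), (49, -8), (50, -22), (51, -8)],
    blocks := [⟨0, [], []⟩, ⟨2, [], [([(11, 1), (6, 1), (7, 1), (10, 1), (13, 1), (14, 1)], [(41,
    [(41, 1)])])]⟩, ⟨4, [[(35, 1), (36, 1)]], []⟩, ⟨6, [[(35, 1), (36, 1)]], []⟩, ⟨8, [], [([(30,
    -1), (28, 1), (31, 1)], [(41, [(35, 1), (36, 1)])])]⟩, ⟨10, [[(22, -2), (23, -1), (24, -1),
    (25, 2), (26, -1), (29, 1)]], [([(36, 1), (32, -1), (34, 1), (35, 1)], [(41, [(28, 1), (30,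
    -1), (31, 1)])])]⟩, ⟨12, [], []⟩, ⟨14, [], [([(39, 1), (40, 1)], [(41, [(12, 2), (16, 1), (17,
    1), (18, 1), (19, -1), (20, 1), (21, -2)])])]⟩, ⟨16, [], [([(41, 1)], [(41, [(6, 1), (7, 1),
    (10, 1), (11, 1), (13, 1), (14, 1)])])]⟩] },
  { diagram := [2, 2, 2, 2, 2, 2], top := 22, e := [(6, 1), (7, 1), (8, 1), (9, 1), (10, 1), (11,
    1)], f := [(42, -16), (43, -22), (44, -30), (45, -42), (46, -30), (47, -16)], blocks := [⟨0,
    [], []⟩, ⟨2, [], [([(11, 1), (6, 1), (7, 1), (8, 1), (9, 1), (10, 1)], [(41, [(41, 1)])])]⟩,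
    ⟨4, [], []⟩, ⟨6, [], []⟩, ⟨8, [], [([(26, 1), (22, 1), (23, 1), (25, -1)], [(41, [(37, 1), (38,
    1)])])]⟩, ⟨10, [], [([(30, -1), (27, 1), (28, 2), (29, 1)], [(41, [(34, 1), (35, 1), (36,
    1)])])]⟩, ⟨12, [], []⟩, ⟨14, [], [([(36, 1), (34, 1), (35, 1)], [(41, [(27, 1), (28, 2), (29,
    1), (30, -1)])])]⟩, ⟨16, [], [([(38, 1), (37, 1)], [(41, [(22, 1), (23, 1), (25, -1), (26,
    1)])])]⟩, ⟨18, [], []⟩, ⟨20, [], []⟩, ⟨22, [], [([(41, 1)], [(41, [(6, 1), (7, 1), (8, 1), (9,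
    1), (10, 1), (11, 1)])])]⟩] }]

/-- Certificates for the distinguished nilpotent elements in type `E₇`. -/
def certificatesE7 : List Certificate := [
  { diagram := [0, 0, 0, 2, 0, 0, 2], top := 10, e := [(16, 1), (17, 1), (19, 1), (26, 1), (28, 1),
    (29, 1), (33, 1)], f := [(79, -2), (80, -8), (82, -9), (89, -5), (91, -8), (92, -2), (96, -5)],
    blocks := [⟨0, [], []⟩, ⟨2, [[(41, 1)], [(53, 1), (54, -1), (55, 1)]], [([(19, 1), (16, 1),
    (17, 1), (26, 1), (28, 1), (29, 1), (33, 1)], [(67, [(67, 1)]), (68, [(68, 1)]), (69, [(69,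
    1)])])]⟩, ⟨4, [[(15, 3), (20, -2), (23, 1), (24, -1), (25, 1), (32, 1)]], []⟩, ⟨6, [[(41, 1)],
    [(15, 3), (20, -2), (23, 1), (24, -1), (25, 1), (32, 1)]], []⟩, ⟨8, [[(15, 3), (20, -2), (23,
    1), (24, -1), (25, 1), (32, 1)]], []⟩, ⟨10, [], [([(67, 1)], [(68, [(15, 1), (24, -1), (35,
    1)]), (67, [(16, 1), (29, 1)]), (69, [(10, 3), (13, -1), (21, -2), (22, -1), (27, -1), (39,
    2)])]), ([(68, 1)], [(67, [(10, 1), (21, -1), (30, 1)]), (68, [(16, 1), (29, 1)]), (69, [(15,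
    3), (20, -2), (23, 1), (24, -1), (25, 1), (32, 1)])]), ([(69, 1)], [(69, [(16, -4), (17, 1),
    (19, 1), (26, 1), (28, 1), (29, -4), (33, 1)]), (67, [(15, -1), (20, -2), (23, 1), (24, 3),
    (25, 1), (32, 1), (35, -4)]), (68, [(10, 3), (13, -1), (21, -2), (22, -1), (27, -1), (39,
    2)])])]⟩] },
  { diagram := [2, 0, 0, 2, 0, 0, 2], top := 14, e := [(10, 1), (14, 1), (21, 1), (22, 1), (23, 1),
    (25, 1), (35, 1)], f := [(73, -18), (76, -2), (77, -14), (84, -2), (85, -8), (86, -1), (87, 9),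
    (88, -11), (98, -9)], blocks := [⟨0, [], []⟩, ⟨2, [[(50, 1), (56, 1), (57, -1), (58, 1)]],
    [([(25, 1), (10, 1), (14, 1), (21, 1), (22, 1), (23, 1), (35, 1)], [(69, [(69, 1)])])]⟩, ⟨4,
    [[(38, 1), (40, -1), (47, -1), (48, 1), (49, -2)]], []⟩, ⟨6, [[(26, 1), (34, 1), (36, 1), (37,
    -2)]], []⟩, ⟨8, [[(13, 1), (21, 1)]], []⟩, ⟨10, [[(23, 1)], [(13, 1), (21, 1)], [(7, -1), (15,
    -1), (16, -1), (17, -1), (19, -1), (28, 3), (29, -1), (30, 2)]], [([(63, 1), (62, 2), (66, 1)],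
    [(69, [(38, 1), (40, -1), (47, -1), (48, 1), (49, -2)])])]⟩, ⟨12, [[(7, -1), (15, -1), (16,
    -1), (17, -1), (19, -1), (28, 3), (29, -1), (30, 2)]], []⟩, ⟨14, [], [([(69, 1)], [(69, [(10,
    1), (13, -1), (14, 1), (22, 1), (25, 1), (35, 1)])])]⟩] },
  { diagram := [2, 0, 0, 2, 0, 2, 2], top := 18, e := [(7, 1), (12, 1), (13, 1), (15, 1), (16, 1),
    (17, 1), (28, 1)], f := [(70, -18), (75, -28), (76, -15), (78, -1), (79, -10), (80, -15), (91,
    -24)], blocks := [⟨0, [], []⟩, ⟨2, [[(64, 1), (65, 1)]], [([(13, 1), (7, 1), (12, 1), (15, 1),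
    (16, 1), (17, 1), (28, 1)], [(69, [(69, 1)])])]⟩, ⟨4, [[(15, 1)]], []⟩, ⟨6, [[(40, 1), (44,
    -1), (47, -2), (52, 1)]], []⟩, ⟨8, [[(15, 1)]], []⟩, ⟨10, [[(25, 1), (26, -3), (27, 1), (29,
    1), (30, 1), (34, 2)]], [([(55, -1), (53, 3), (54, -1), (56, 2)], [(69, [(53, 1), (54, -1),
    (55, -1)])])]⟩, ⟨12, [], []⟩, ⟨14, [[(15, 1)]], [([(63, 1), (66, 1)], [(69, [(31, 2), (39, -1),
    (42, -1), (43, 1), (46, -1)])])]⟩, ⟨16, [], [([(67, 1)], [(69, [(25, 1), (26, -3), (27, 1),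
    (29, 1), (30, 1), (34, 2)])])]⟩, ⟨18, [], [([(69, 1)], [(69, [(7, 1), (12, 1), (13, 1), (16,
    1), (17, 1), (28, 1)])])]⟩] },
  { diagram := [2, 2, 2, 0, 2, 0, 2], top := 22, e := [(7, 1), (8, 1), (11, 1), (15, 1), (16, 1),
    (19, 1), (24, 1)], f := [(70, -22), (71, -28), (72, 28), (74, -32), (76, -3), (78, -3), (79,
    -42), (80, -3), (82, -17), (87, -15)], blocks := [⟨0, [], []⟩, ⟨2, [[(59, 1), (61, -1)]],
    [([(19, 1), (7, 1), (8, 1), (11, 1), (15, 1), (16, 1), (24, 1)], [(69, [(69, 1)])])]⟩, ⟨4, [],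
    []⟩, ⟨6, [[(50, 1), (51, 1)]], []⟩, ⟨8, [[(50, 1), (51, 1)]], []⟩, ⟨10, [[(38, -1), (40, -1),
    (42, 1), (44, 1), (46, 1)]], [([(51, -1), (43, -1), (45, 1), (49, -1), (50, -1), (55, 2)],
    [(69, [(59, 1), (61, -1)])])]⟩, ⟨12, [], []⟩, ⟨14, [[(13, 1), (15, 1), (17, 1)]], [([(57, 1),
    (59, 1), (60, 1), (63, 1)], [(69, [(43, -1), (45, 1), (49, -1), (55, 2)])])]⟩, ⟨16, [[(13, 1),
    (15, 1), (17, 1)]], []⟩, ⟨18, [], [([(67, 1)], [(69, [(26, 2), (27, 1), (28, 1), (33, -3), (34,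
    -1), (35, 3), (36, -2), (37, 1), (41, 1)])])]⟩, ⟨20, [], []⟩, ⟨22, [], [([(69, 1)], [(69, [(7,
    1), (8, 1), (11, 1), (13, -1), (16, 1), (17, -1), (19, 1), (24, 1)])])]⟩] },
  { diagram := [2, 2, 2, 0, 2, 2, 2], top := 26, e := [(7, 1), (9, 1), (11, 1), (12, 1), (13, 1),
    (15, 1), (17, 1)], f := [(70, -26), (71, -22), (72, -50), (74, -22), (75, -40), (76, -21), (78,
    -37), (79, -35), (80, -35)], blocks := [⟨0, [], []⟩, ⟨2, [], [([(13, 1), (7, 1), (9, 1), (11,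
    1), (12, 1), (15, 1), (17, 1)], [(69, [(69, 1)])])]⟩, ⟨4, [], []⟩, ⟨6, [[(57, 1), (58, 1), (59,
    1)]], []⟩, ⟨8, [], []⟩, ⟨10, [[(57, 1), (58, 1), (59, 1)]], [([(42, -2), (39, -2), (40, -2),
    (43, 1), (44, 1), (46, -1), (47, 3)], [(69, [(61, 1), (62, 1), (63, -1)])])]⟩, ⟨12, [], []⟩,
    ⟨14, [], [([(55, 1), (53, 1), (54, 1), (56, 1)], [(69, [(53, 1), (54, 1), (55, 1), (56,
    1)])])]⟩, ⟨16, [[(39, 1), (40, 2), (42, 1), (46, 1), (47, -2)]], []⟩, ⟨18, [], [([(61, 1), (62,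
    1), (63, -1)], [(69, [(39, 1), (40, 2), (42, 1), (46, 1), (47, -2)])])]⟩, ⟨20, [], []⟩, ⟨22,
    [], [([(66, 1)], [(69, [(25, -2), (26, -2), (27, 1), (28, -2), (29, -2), (30, 1), (31, 1), (34,
    1)])])]⟩, ⟨24, [], []⟩, ⟨26, [], [([(69, 1)], [(69, [(7, 1), (9, 1), (11, 1), (12, 1), (13, 1),
    (15, 1), (17, 1)])])]⟩] },
  { diagram := [2, 2, 2, 2, 2, 2, 2], top := 34, e := [(7, 1), (8, 1), (9, 1), (10, 1), (11, 1),
    (12, 1), (13, 1)], f := [(70, -34), (71, -49), (72, -66), (73, -96), (74, -75), (75, -52), (76,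
    -27)], blocks := [⟨0, [], []⟩, ⟨2, [], [([(13, 1), (7, 1), (8, 1), (9, 1), (10, 1), (11, 1),
    (12, 1)], [(69, [(69, 1)])])]⟩, ⟨4, [], []⟩, ⟨6, [], []⟩, ⟨8, [], []⟩, ⟨10, [], [([(37, 2),
    (32, 1), (33, 2), (34, 1), (35, -1), (36, -3)], [(69, [(64, 1), (65, -1)])])]⟩, ⟨12, [], []⟩,
    ⟨14, [], [([(47, -1), (43, 1), (44, 1), (45, -2), (46, 1)], [(69, [(59, 1), (60, -1), (61,
    1)])])]⟩, ⟨16, [], []⟩, ⟨18, [], [([(55, 1), (53, 1), (54, 1)], [(69, [(53, 1), (54, 1), (55,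
    1)])])]⟩, ⟨20, [], []⟩, ⟨22, [], [([(61, 1), (59, 1), (60, -1)], [(69, [(43, 1), (44, 1), (45,
    -2), (46, 1), (47, -1)])])]⟩, ⟨24, [], []⟩, ⟨26, [], [([(65, -1), (64, 1)], [(69, [(32, 1),
    (33, 2), (34, 1), (35, -1), (36, -3), (37, 2)])])]⟩, ⟨28, [], []⟩, ⟨30, [], []⟩, ⟨32, [], []⟩,
    ⟨34, [], [([(69, 1)], [(69, [(7, 1), (8, 1), (9, 1), (10, 1), (11, 1), (12, 1), (13, 1)])])]⟩]
    }]

/-- Certificates for the distinguished nilpotent elements in type `E₈`. -/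
def certificatesE8 : List Certificate := [
  { diagram := [0, 0, 0, 0, 2, 0, 0, 0], top := 10, e := [(27, 1), (31, 1), (34, 1), (36, 1), (39,
    1), (45, 1), (48, 1), (67, 1)], f := [(147, -5), (151, -6), (154, -2), (156, -3), (159, -4),
    (161, 5), (165, -3), (168, -10), (187, -7), (192, 2)], blocks := [⟨0, [], []⟩, ⟨2, [[(97, 1)],
    [(92, 1), (103, 1), (106, 1)]], [([(36, 1), (27, 1), (31, 1), (34, 1), (39, 1), (45, 1), (48,
    1), (67, 1)], [(124, [(124, 1)]), (125, [(125, 1)]), (126, [(126, 1)]), (127, [(127, 1)])])]⟩,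
    ⟨4, [[(19, -1), (26, 1), (28, -1), (33, 2), (37, -1), (54, -1), (60, 1), (65, 1)]], []⟩, ⟨6,
    [[(59, -1), (62, 1), (83, 1), (86, 1)], [(12, 2), (47, 1), (49, -2), (51, 1), (57, -1)]], []⟩,
    ⟨8, [[(50, 1), (58, 1)], [(20, -2), (25, 2), (43, -1), (46, 1), (52, 1), (56, -1)]], []⟩, ⟨10,
    [], [([(124, 1)], [(124, [(34, -3), (36, 2), (39, 2), (45, 2), (72, 3)]), (125, [(12, 2), (47,
    1), (49, -2), (51, 1), (57, -1)]), (127, [(26, -1), (33, -2), (37, 2), (40, -1), (63, 1)]),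
    (126, [(20, -2), (25, 2), (43, -1), (46, 1), (52, 1), (56, -1)])]), ([(125, 1)], [(127, [(20,
    2), (25, -4), (32, -2), (50, 1), (58, 3), (61, 2)]), (125, [(34, -1), (72, 1)]), (124, [(26,
    -1), (33, -2), (37, 2), (40, -1), (63, 1)]), (126, [(12, 3), (35, -1), (38, -1), (44, -1), (47,
    2), (49, -2), (53, 1)])]), ([(126, 1)], [(126, [(27, 4), (31, 4), (34, -1), (36, -6), (39, -6),
    (45, -6), (48, 4), (67, 4), (72, 5)]), (124, [(20, -1), (32, -1), (43, -1), (46, 1), (50, 1),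
    (52, 1), (56, -1), (58, 2), (61, 1)]), (127, [(12, -4), (35, 2), (38, 2), (44, 2), (47, -3),
    (49, 2), (51, 1), (53, -2), (57, -1)]), (125, [(19, -1), (26, 1), (28, -1), (33, 2), (37, -1),
    (54, -1), (60, 1), (65, 1)])]), ([(127, 1)], [(125, [(20, -2), (25, 4), (32, 2), (50, 3), (58,
    1), (61, -2)]), (127, [(34, -1), (72, 1)]), (124, [(12, 2), (47, 1), (49, -2), (51, 1), (57,
    -1)]), (126, [(19, -1), (26, 1), (28, -1), (33, 2), (37, -1), (54, -1), (60, 1), (65, 1)])])]⟩]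
    },
  { diagram := [0, 0, 0, 2, 0, 0, 0, 2], top := 16, e := [(22, 1), (23, 1), (24, 1), (25, 1), (26,
    1), (27, 1), (45, 1), (53, 1)], f := [(135, -8), (142, -16), (143, -2), (144, -12), (145, -2),
    (146, -12), (147, -22), (155, 14), (165, -8), (173, -14)], blocks := [⟨0, [], []⟩, ⟨2, [[(118,
    1), (119, 1)]], [([(22, 1), (23, 1), (24, 1), (25, 1), (26, 1), (27, 1), (45, 1), (53, 1)],
    [(127, [(127, 1)])])]⟩, ⟨4, [[(67, -2), (69, 1), (70, 1), (85, 1), (92, 1)]], []⟩, ⟨6, [[(43,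
    -1), (47, 1), (56, 2), (61, 1), (64, -1), (71, 1), (73, -1)]], []⟩, ⟨8, [[(67, -2), (69, 1),
    (70, 1), (85, 1), (92, 1)]], []⟩, ⟨10, [[(39, 2), (54, 1), (58, 1), (59, 1), (66, 2)], [(49,
    -1), (51, 2), (52, -1), (55, -1), (60, 1), (62, -1)]], []⟩, ⟨12, [[(23, 1), (25, 1)]], []⟩,
    ⟨14, [[(17, 4), (18, -2), (19, -2), (36, 1), (37, 1), (38, 1), (40, 1), (46, 2)], [(11, -1),
    (29, -1), (30, 2), (31, -4), (32, 2), (33, -1), (34, -1), (41, 1), (42, -1)]], [([(126, 1)],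
    [(127, [(43, -1), (47, 1), (56, 2), (61, 1), (64, -1), (71, 1), (73, -1)])])]⟩, ⟨16, [],
    [([(127, 1)], [(127, [(22, 1), (24, 1), (26, 1), (27, 1), (45, 1), (53, 1)])])]⟩] },
  { diagram := [0, 0, 0, 2, 0, 0, 2, 0], top := 18, e := [(17, 1), (18, 1), (27, 1), (28, 1), (29,
    1), (31, 1), (32, 1), (45, 1)], f := [(137, -20), (138, -14), (147, -8), (148, -18), (149,
    -18), (151, -20), (152, -14), (165, -8)], blocks := [⟨0, [], []⟩, ⟨2, [[(125, 1)]], [([(29, 1),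
    (17, 1), (18, 1), (27, 1), (28, 1), (31, 1), (32, 1), (45, 1)], [(126, [(126, 1)]), (127,
    [(127, 1)])])]⟩, ⟨4, [[(118, 1), (119, 1)]], []⟩, ⟨6, [[(109, 1), (113, -1), (114, 1)], [(60,
    1), (68, -2), (70, 1), (71, -1), (72, -1)]], []⟩, ⟨8, [[(60, 1), (68, -2), (70, 1), (71, -1),
    (72, -1)]], []⟩, ⟨10, [[(11, -2), (14, -2), (25, 1), (26, 1), (30, -2), (36, 1), (38, 4), (40,
    -5)]], []⟩, ⟨12, [[(11, -2), (14, -2), (25, 1), (26, 1), (30, -2), (36, 1), (38, 4), (40,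
    -5)]], []⟩, ⟨14, [[(41, -1), (42, 1), (44, 1), (54, 1), (55, -1), (57, -1), (58, 1)]], [([(117,
    1), (122, 1)], [(127, [(60, 1), (68, -2), (70, 1), (71, -1), (72, -1)]), (126, [(62, 1), (63,
    1), (65, 2), (73, -2), (74, -1), (76, 1)])])]⟩, ⟨16, [[(11, -2), (14, -2), (25, 1), (26, 1),
    (30, -2), (36, 1), (38, 4), (40, -5)]], []⟩, ⟨18, [], [([(126, 1)], [(127, [(11, -2), (14, -2),
    (25, 1), (26, 1), (30, -2), (36, 1), (38, 4), (40, -5)]), (126, [(17, 1), (18, 1), (27, 1),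
    (28, 1), (29, 1), (31, 1), (32, 1), (45, 1)])]), ([(127, 1)], [(126, [(19, 2), (21, -1), (22,
    2), (23, -1), (24, -1), (33, -4), (34, 5), (37, 2)]), (127, [(17, 1), (18, 1), (27, 1), (28,
    1), (29, 1), (31, 1), (32, 1), (45, 1)])])]⟩] },
  { diagram := [0, 0, 0, 2, 0, 0, 2, 2], top := 22, e := [(15, 1), (18, 1), (25, 1), (27, 1), (28,
    1), (30, 1), (31, 1), (40, 1)], f := [(135, -22), (138, -30), (145, -16), (147, -16), (148,
    -42), (150, -30), (151, -2), (160, -2)], blocks := [⟨0, [], []⟩, ⟨2, [[(110, 1), (111, -1),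
    (115, 1)]], [([(15, 1), (18, 1), (25, 1), (27, 1), (28, 1), (30, 1), (31, 1), (40, 1)], [(127,
    [(127, 1)])])]⟩, ⟨4, [[(110, 1), (111, -1), (115, 1)]], []⟩, ⟨6, [[(64, 1)]], []⟩, ⟨8, [[(43,
    -1), (57, 2), (60, 1), (68, -1), (70, 3), (71, 2)]], []⟩, ⟨10, [[(43, -1), (57, 2), (60, 1),
    (68, -1), (70, 3), (71, 2)]], []⟩, ⟨12, [], []⟩, ⟨14, [[(64, 1)]], [([(113, -1), (109, 1),
    (114, 1)], [(127, [(88, -1), (90, 1), (91, 1), (96, 2)])])]⟩, ⟨16, [[(31, 1), (40, 1)], [(26,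
    -1), (37, 1), (38, -1)]], []⟩, ⟨18, [], [([(124, 1)], [(127, [(49, -1), (54, 2), (56, -1), (66,
    1), (76, 3), (78, 2)])]), ([(125, 1)], [(127, [(43, -1), (57, 2), (60, 1), (68, -1), (70, 3),
    (71, 2)])])]⟩, ⟨20, [], []⟩, ⟨22, [], [([(127, 1)], [(127, [(15, 1), (18, 1), (25, 1), (27, 1),
    (28, 1), (30, 1)])])]⟩] },
  { diagram := [2, 0, 0, 2, 0, 0, 2, 0], top := 22, e := [(8, 1), (11, 1), (14, 1), (25, 1), (26,
    1), (27, 1), (29, 1), (40, 1)], f := [(128, -36), (131, -20), (134, -22), (144, 20), (145,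
    -12), (146, -30), (147, -2), (148, -2), (149, -22), (160, -40)], blocks := [⟨0, [], []⟩, ⟨2,
    [[(123, 1)]], [([(14, 1), (8, 1), (11, 1), (25, 1), (26, 1), (27, 1), (29, 1), (40, 1)], [(126,
    [(126, 1)]), (127, [(127, 1)])])]⟩, ⟨4, [[(120, 1), (121, 1)]], []⟩, ⟨6, [[(116, 1), (117,
    -1)]], []⟩, ⟨8, [[(113, 1)]], []⟩, ⟨10, [[(101, 1), (102, -1), (103, -1)], [(96, -1), (99, 1),
    (107, 1)]], []⟩, ⟨12, [[(77, 1), (87, 1), (88, 1), (90, 1)]], []⟩, ⟨14, [[(65, -1), (66, 1),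
    (67, -1), (76, 1), (78, -1), (79, 1), (80, -1), (81, -2)]], [([(106, 1), (104, -1), (112, 1),
    (113, -4)], [(126, [(83, 1), (86, -1), (92, 1), (94, -1)]), (127, [(88, -2), (89, -1), (90,
    -1), (91, 1), (97, 1)])])]⟩, ⟨16, [[(52, -1), (53, -1), (54, -1), (56, -2), (64, 1), (68, -1),
    (69, 1)]], []⟩, ⟨18, [[(38, -1), (41, 2), (42, -1), (43, 1), (55, 1)]], []⟩, ⟨20, [[(27, 1),
    (28, 1)]], []⟩, ⟨22, [], [([(126, 1)], [(126, [(27, 1), (28, 1)]), (127, [(16, 1), (17, -2),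
    (18, 1), (19, -3), (21, 1), (22, 1), (32, 1), (33, 1), (34, 1), (36, -4)])]), ([(127, 1)],
    [(127, [(8, 1), (11, 1), (14, 1), (25, 1), (26, 1), (27, -10), (28, -11), (29, 1), (40, 1)]),
    (126, [(16, 1), (17, -2), (18, 1), (19, -3), (21, 1), (22, 1), (32, 1), (33, 1), (34, 1), (36,
    -4)])])]⟩] },
  { diagram := [2, 0, 0, 2, 0, 0, 2, 2], top := 26, e := [(8, 1), (14, 1), (15, 1), (17, 1), (19,
    1), (32, 1), (33, 1), (34, 1)], f := [(128, -40), (134, -50), (135, -26), (137, -22), (138,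
    22), (139, -1), (148, -15), (152, -21), (153, -15), (154, -57)], blocks := [⟨0, [], []⟩, ⟨2,
    [[(118, 1), (122, 1)]], [([(15, 1), (8, 1), (14, 1), (17, 1), (19, 1), (32, 1), (33, 1), (34,
    1)], [(127, [(127, 1)])])]⟩, ⟨4, [[(19, 1)]], []⟩, ⟨6, [[(80, -1), (81, -1), (92, 1)]], []⟩,
    ⟨8, [], []⟩, ⟨10, [[(84, -1), (96, 1)], [(43, -1), (59, 1), (62, 1)]], []⟩, ⟨12, [[(80, -1),
    (81, -1), (92, 1)]], []⟩, ⟨14, [[(19, 1)]], [([(95, 1), (102, 1), (103, 1), (104, 1), (105,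
    -1)], [(127, [(95, 1), (102, 1), (103, 1), (104, 1), (105, -1)])])]⟩, ⟨16, [[(46, 1), (49, -2),
    (50, 1), (51, -3), (52, 2), (56, 1), (64, 1), (68, -1)]], []⟩, ⟨18, [[(29, -1), (31, 3), (35,
    -1), (39, -3), (45, -1), (48, -1), (55, 2)]], []⟩, ⟨20, [[(19, 1)]], []⟩, ⟨22, [[(29, -1), (31,
    3), (35, -1), (39, -3), (45, -1), (48, -1), (55, 2)]], [([(123, 1)], [(127, [(46, 1), (49, -2),
    (50, 1), (51, -3), (52, 2), (56, 1), (64, 1), (68, -1)])])]⟩, ⟨24, [], []⟩, ⟨26, [], [([(127,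
    1)], [(127, [(8, 1), (14, 1), (15, 1), (17, 1), (32, 1), (33, 1), (34, 1)])])]⟩] },
  { diagram := [2, 0, 0, 2, 0, 2, 0, 2], top := 28, e := [(11, 1), (15, 1), (16, 1), (20, 1), (21,
    1), (24, 1), (25, 1), (26, 1)], f := [(131, -36), (135, -28), (136, -44), (140, -26), (141,
    -54), (144, -14), (145, -50), (146, -28)], blocks := [⟨0, [], []⟩, ⟨2, [], [([(15, 1), (11, 1),
    (16, 1), (20, 1), (21, 1), (24, 1), (25, 1), (26, 1)], [(127, [(127, 1)])])]⟩, ⟨4, [[(93, -1),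
    (100, 1)]], []⟩, ⟨6, [[(120, 1), (121, 1)]], []⟩, ⟨8, [[(93, -1), (100, 1)]], []⟩, ⟨10, [[(52,
    -3), (54, -1), (63, -2), (64, 3), (65, 1), (66, -1), (68, 2)]], []⟩, ⟨12, [], []⟩, ⟨14, [[(52,
    -3), (54, -1), (63, -2), (64, 3), (65, 1), (66, -1), (68, 2)]], [([(95, 1), (93, -3), (94, 1),
    (100, 4), (102, 1)], [(127, [(101, -1), (104, -1), (107, -1), (109, 1)])])]⟩, ⟨16, [[(70, -1),
    (72, -1), (75, 2), (78, -1), (82, 1)]], []⟩, ⟨18, [[(30, -3), (31, 1), (33, -3), (34, 5), (35,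
    1), (36, 1), (39, -2), (48, 1)]], []⟩, ⟨20, [], []⟩, ⟨22, [[(38, -1), (44, 1), (47, -1), (49,
    -1), (50, 2), (53, -1), (62, 1)]], [([(118, 1), (122, 1)], [(127, [(52, -3), (54, -1), (63,
    -2), (64, 3), (65, 1), (66, -1), (68, 2)])])]⟩, ⟨24, [], []⟩, ⟨26, [], [([(125, 1)], [(127,
    [(30, -3), (31, 1), (33, -3), (34, 5), (35, 1), (36, 1), (39, -2), (48, 1)])])]⟩, ⟨28, [],
    [([(127, 1)], [(127, [(11, 1), (15, 1), (16, 1), (20, 1), (21, 1), (24, 1), (25, 1), (26,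
    1)])])]⟩] },
  { diagram := [2, 0, 0, 2, 0, 2, 2, 2], top := 34, e := [(8, 1), (13, 1), (14, 1), (15, 1), (17,
    1), (18, 1), (19, 1), (32, 1)], f := [(128, -52), (133, -96), (134, -66), (135, -34), (137,
    -1), (138, -27), (139, -49), (152, -75)], blocks := [⟨0, [], []⟩, ⟨2, [[(120, 1), (121, 1)]],
    [([(15, 1), (8, 1), (13, 1), (14, 1), (17, 1), (18, 1), (19, 1), (32, 1)], [(127, [(127,
    1)])])]⟩, ⟨4, [], []⟩, ⟨6, [], []⟩, ⟨8, [[(17, 1)]], []⟩, ⟨10, [[(91, 1), (93, 1), (94, -1),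
    (96, 2)]], []⟩, ⟨12, [], []⟩, ⟨14, [], [([(81, -1), (80, -1), (83, 1), (84, -2), (92, 1)],
    [(127, [(111, 1), (112, -1), (113, -1)])])]⟩, ⟨16, [[(17, 1)]], []⟩, ⟨18, [[(46, 1), (49, -3),
    (50, 1), (52, -1), (56, -2), (64, 1)]], []⟩, ⟨20, [], []⟩, ⟨22, [], [([(113, -1), (111, 1),
    (112, -1)], [(127, [(80, -1), (81, -1), (83, 1), (84, -2), (92, 1)])])]⟩, ⟨24, [], []⟩, ⟨26,
    [[(17, 1)]], [([(118, 1), (122, 1)], [(127, [(61, -2), (65, 2), (66, 1), (68, 1), (69, -1),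
    (70, 3)])])]⟩, ⟨28, [], [([(123, 1)], [(127, [(46, 1), (49, -3), (50, 1), (52, -1), (56, -2),
    (64, 1)])])]⟩, ⟨30, [], []⟩, ⟨32, [], []⟩, ⟨34, [], [([(127, 1)], [(127, [(8, 1), (13, 1), (14,
    1), (15, 1), (18, 1), (19, 1), (32, 1)])])]⟩] },
  { diagram := [2, 2, 2, 0, 2, 0, 2, 2], top := 38, e := [(8, 1), (9, 1), (12, 1), (15, 1), (17,
    1), (18, 1), (21, 1), (27, 1)], f := [(128, -60), (129, -66), (130, 66), (132, -108), (134,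
    -22), (135, -38), (137, -22), (138, -118), (139, -22), (141, -74), (147, -34)], blocks := [⟨0,
    [], []⟩, ⟨2, [], [([(15, 1), (8, 1), (9, 1), (12, 1), (17, 1), (18, 1), (21, 1), (27, 1)],
    [(127, [(127, 1)])])]⟩, ⟨4, [], []⟩, ⟨6, [[(106, 1)]], []⟩, ⟨8, [], []⟩, ⟨10, [[(118, 1), (119,
    1)]], []⟩, ⟨12, [], []⟩, ⟨14, [], [([(81, 1), (71, 1), (72, -1), (74, 1), (76, 1), (77, 1),
    (80, 2), (83, 1)], [(127, [(111, -1), (114, -1), (115, 1), (117, 1)])])]⟩, ⟨16, [[(106, 1)]],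
    []⟩, ⟨18, [[(82, 1), (84, -1), (85, 2), (86, -1), (87, 1), (89, -1), (90, 1)]], []⟩, ⟨20, [],
    []⟩, ⟨22, [[(82, 1), (84, -1), (85, 2), (86, -1), (87, 1), (89, -1), (90, 1)]], [([(107, 1),
    (104, 1), (105, -1), (106, 1)], [(127, [(88, -1), (91, -1), (93, 1), (94, -1), (96, 2)])])]⟩,
    ⟨24, [], []⟩, ⟨26, [], [([(115, 1), (111, -1), (114, -1), (117, 1)], [(127, [(71, 1), (72, -1),
    (74, 1), (76, 1), (77, 1), (80, 2), (81, 1), (83, 1)])])]⟩, ⟨28, [[(51, -2), (53, 2), (54, 6),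
    (57, -4), (59, -2), (60, 3), (62, 3), (63, -3), (68, 4)]], []⟩, ⟨30, [], []⟩, ⟨32, [], []⟩,
    ⟨34, [], [([(125, 1)], [(127, [(30, 2), (31, 1), (32, 1), (36, 1), (38, -3), (39, -1), (40, 3),
    (41, -2), (42, 1), (43, -3), (47, 1)])])]⟩, ⟨36, [], []⟩, ⟨38, [], [([(127, 1)], [(127, [(8,
    1), (9, 1), (12, 1), (15, 1), (17, 1), (18, 1), (21, 1), (27, 1)])])]⟩] },
  { diagram := [2, 2, 2, 0, 2, 2, 2, 2], top := 46, e := [(8, 1), (9, 1), (10, 1), (13, 1), (14,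
    1), (15, 1), (17, 1), (19, 1)], f := [(128, -72), (129, -68), (130, -142), (132, -68), (133,
    -132), (134, -90), (135, -46), (137, -38), (138, 38), (139, -172)], blocks := [⟨0, [], []⟩, ⟨2,
    [], [([(15, 1), (8, 1), (9, 1), (10, 1), (13, 1), (14, 1), (17, 1), (19, 1)], [(127, [(127,
    1)])])]⟩, ⟨4, [], []⟩, ⟨6, [], []⟩, ⟨8, [], []⟩, ⟨10, [[(108, 1), (109, -1), (110, 1)]], []⟩,
    ⟨12, [], []⟩, ⟨14, [], [([(69, -1), (61, -2), (64, 1), (65, 1), (66, 1), (67, 1), (68, 1), (70,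
    1)], [(127, [(116, -1), (119, 1)])])]⟩, ⟨16, [], []⟩, ⟨18, [[(108, 1), (109, -1), (110, 1)]],
    []⟩, ⟨20, [], []⟩, ⟨22, [], [([(91, 1), (92, 1), (93, -1), (94, -1), (95, 2)], [(127, [(102,
    1), (103, -1), (104, 1), (105, -1), (106, 1)])])]⟩, ⟨24, [], []⟩, ⟨26, [], [([(103, -1), (102,
    1), (104, 1), (105, -1), (106, 1)], [(127, [(91, 1), (92, 1), (93, -1), (94, -1), (95,
    2)])])]⟩, ⟨28, [[(79, 2), (80, 2), (81, 2), (82, 1), (83, -1), (84, 1)]], []⟩, ⟨30, [], []⟩,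
    ⟨32, [], []⟩, ⟨34, [], [([(119, 1), (116, -1)], [(127, [(61, -2), (64, 1), (65, 1), (66, 1),
    (67, 1), (68, 1), (69, -1), (70, 1)])])]⟩, ⟨36, [], []⟩, ⟨38, [], [([(123, 1)], [(127, [(45,
    1), (46, 2), (48, -1), (49, -3), (50, 2), (51, 4), (52, 4), (55, 1), (56, 2)])])]⟩, ⟨40, [],
    []⟩, ⟨42, [], []⟩, ⟨44, [], []⟩, ⟨46, [], [([(127, 1)], [(127, [(8, 1), (9, 1), (10, 1), (13,
    1), (14, 1), (15, 1), (17, 1), (19, 1)])])]⟩] },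
  { diagram := [2, 2, 2, 2, 2, 2, 2, 2], top := 58, e := [(8, 1), (9, 1), (10, 1), (11, 1), (12,
    1), (13, 1), (14, 1), (15, 1)], f := [(128, -92), (129, -136), (130, -182), (131, -270), (132,
    -220), (133, -168), (134, -114), (135, -58)], blocks := [⟨0, [], []⟩, ⟨2, [], [([(15, 1), (8,
    1), (9, 1), (10, 1), (11, 1), (12, 1), (13, 1), (14, 1)], [(127, [(127, 1)])])]⟩, ⟨4, [], []⟩,
    ⟨6, [], []⟩, ⟨8, [], []⟩, ⟨10, [], []⟩, ⟨12, [], []⟩, ⟨14, [], [([(57, 1), (51, 1), (52, 1),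
    (53, -2), (54, -3), (55, 1), (56, -1)], [(127, [(120, 1), (121, 1)])])]⟩, ⟨16, [], []⟩, ⟨18,
    [], []⟩, ⟨20, [], []⟩, ⟨22, [], [([(81, 2), (76, 1), (77, -1), (78, 1), (79, 1), (80, 2)],
    [(127, [(111, 1), (112, -1), (113, 1)])])]⟩, ⟨24, [], []⟩, ⟨26, [], [([(91, -1), (87, 1), (88,
    -2), (89, -1), (90, 1)], [(127, [(104, 1), (105, -1), (106, 1), (107, -1)])])]⟩, ⟨28, [], []⟩,
    ⟨30, [], []⟩, ⟨32, [], []⟩, ⟨34, [], [([(107, -1), (104, 1), (105, -1), (106, 1)], [(127, [(87,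
    1), (88, -2), (89, -1), (90, 1), (91, -1)])])]⟩, ⟨36, [], []⟩, ⟨38, [], [([(113, 1), (111, 1),
    (112, -1)], [(127, [(76, 1), (77, -1), (78, 1), (79, 1), (80, 2), (81, 2)])])]⟩, ⟨40, [], []⟩,
    ⟨42, [], []⟩, ⟨44, [], []⟩, ⟨46, [], [([(121, 1), (120, 1)], [(127, [(51, 1), (52, 1), (53,
    -2), (54, -3), (55, 1), (56, -1), (57, 1)])])]⟩, ⟨48, [], []⟩, ⟨50, [], []⟩, ⟨52, [], []⟩, ⟨54,
    [], []⟩, ⟨56, [], []⟩, ⟨58, [], [([(127, 1)], [(127, [(8, 1), (9, 1), (10, 1), (11, 1), (12,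
    1), (13, 1), (14, 1), (15, 1)])])]⟩] }]

/-- The product of two lists of natural numbers. -/
def natDot : List ℕ → List ℕ → ℕ
  | a :: d, b :: w => a * b + natDot d w
  | _, _ => 0

theorem listDot_map_natCast (d w : List ℕ) :
    listDot d (w.map Nat.cast) = natDot d w := by
  induction d generalizing w with
  | nil => simp [listDot, natDot]
  | cons a d ih =>
    cases w with
    | nil => simp [listDot, natDot]
    | cons b w => simp [listDot, natDot, ih]

theorem listDot_map_neg (d : List ℕ) (w : List ℤ) : listDot d (w.map Int.neg) = -listDot d w := by
  induction d generalizing w with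
  | nil => simp [listDot]
  | cons a d ih =>
    cases w with
    | nil => simp [listDot]
    | cons b w =>
      rw [List.map_cons, listDot, listDot, ih, neg_add, ← mul_neg]
      rfl

/-! Enumeration of the weighted diagrams with at least as many roots of degree two as the dimension
of the subalgebra of degree zero. A root is given by the contribution to its degree of the first
labels of the diagram, and the other coordinates; roots of degree greater than two are omitted. -/

namespace DiagramSearch

/-- The choice of a label. -/
def step (v : ℕ) : ℕ × List ℕ → Option (ℕ × List ℕ)
  | (s, []) => some (s, [])
  | (s, a :: w) => match s + v * a with
    | 0 => some (0, w)
    | 1 => some (1, w)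
    | 2 => some (2, w)
    | _ => none

/-- Whether the degree is already determined and equal to zero. -/
def isZeroRoot (p : ℕ × List ℕ) : Bool := Nat.beq p.1 0 && p.2.all fun a => Nat.beq a 0

/-- Whether the degree may be equal to two. -/
def isTwoRoot (p : ℕ × List ℕ) : Bool := Nat.beq p.1 2 || p.2.any fun a => !Nat.beq a 0

/-- The enumeration; `m` is the number of labels to be chosen. -/
def isComplete (n : ℕ) (sols : List (List ℕ)) : ℕ → List ℕ → List (ℕ × List ℕ) → Bool
  | 0, acc, S => Nat.blt (S.countP isTwoRoot) (2 * S.countP isZeroRoot + n) ||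
      sols.contains acc.reverse
  | m + 1, acc, S => Nat.blt (S.countP isTwoRoot) (2 * S.countP isZeroRoot + n) ||
      (isComplete n sols m (0 :: acc) (S.filterMap (step 0)) &&
        isComplete n sols m (1 :: acc) (S.filterMap (step 1)) &&
        isComplete n sols m (2 :: acc) (S.filterMap (step 2)))

/-- The number of roots of a given degree. -/
def count (d : List ℕ) (S : List (ℕ × List ℕ)) (j : ℕ) : ℕ :=
  S.countP fun p => Nat.beq (p.1 + natDot d p.2) j

theorem count_cons (v : ℕ) (d : List ℕ) (S : List (ℕ × List ℕ)) {j : ℕ} (hj : j ≤ 2) :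
    count (v :: d) S j = count d (S.filterMap (step v)) j := by
  rw [count, count, List.countP_filterMap]
  congr 1
  funext ⟨s, w⟩
  cases w with
  | nil => cases d <;> simp [step, natDot]
  | cons a w =>
    rw [natDot, ← add_assoc, step]
    split
    · next h => simp [h]
    · next h => simp [h]
    · next h => simp [h]
    · next h0 h1 h2 =>
      rw [Option.map_none, Option.getD_none, ← Bool.not_eq_true, Nat.beq_eq]
      have : s + v * a ≠ 0 := fun h => h0 h
      have : s + v * a ≠ 1 := fun h => h1 h
      have : s + v * a ≠ 2 := fun h => h2 h
      omega

theorem natDot_eq_zero (d : List ℕ) {w : List ℕ} (hw : ∀ a ∈ w, a = 0) : natDot d w = 0 := by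
  induction d generalizing w with
  | nil => rfl
  | cons a d ih =>
    cases w with
    | nil => rfl
    | cons b w =>
      rw [natDot, hw b (by simp), ih fun a ha => hw a (by simp [ha]), mul_zero]

theorem countP_isZeroRoot_le (d : List ℕ) (S : List (ℕ × List ℕ)) :
    S.countP isZeroRoot ≤ count d S 0 := by
  refine List.countP_mono_left fun p _ hp => ?_
  simp only [isZeroRoot, Bool.and_eq_true, Nat.beq_eq, List.all_eq_true] at hp
  simp [hp.1, natDot_eq_zero d hp.2]

theorem count_le_countP_isTwoRoot (d : List ℕ) (S : List (ℕ × List ℕ)) :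
    count d S 2 ≤ S.countP isTwoRoot := by
  refine List.countP_mono_left fun p _ hp => ?_
  by_contra h
  simp only [isTwoRoot, Bool.or_eq_true, Nat.beq_eq, List.any_eq_true, not_or, not_exists, not_and,
    Bool.not_eq_eq_eq_not, Bool.not_true] at h
  rw [Nat.beq_eq, natDot_eq_zero d fun a ha => by simpa using h.2 a ha] at hp
  exact h.1 hp

theorem mem_of_isComplete {n : ℕ} {sols : List (List ℕ)} {m : ℕ} {acc : List ℕ}
    {S : List (ℕ × List ℕ)} (h : isComplete n sols m acc S = true) {d : List ℕ} (hd : d.length = m)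
    (hd2 : ∀ v ∈ d, v ≤ 2) (hS : 2 * count d S 0 + n ≤ count d S 2) : acc.reverse ++ d ∈ sols := by
  have hprune (d : List ℕ) (S : List (ℕ × List ℕ)) (hS : 2 * count d S 0 + n ≤ count d S 2) :
      ¬ Nat.blt (S.countP isTwoRoot) (2 * S.countP isZeroRoot + n) = true := by
    rw [Nat.blt_eq, not_lt]
    have := countP_isZeroRoot_le d S
    have := count_le_countP_isTwoRoot d S
    omega
  induction m generalizing acc S d with
  | zero =>
    rw [isComplete, Bool.or_eq_true] at h
    rw [List.length_eq_zero_iff.1 hd] at hS ⊢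
    rw [List.append_nil]
    exact List.contains_iff_mem.1 (h.resolve_left (hprune _ _ hS))
  | succ m ih =>
    rw [isComplete, Bool.or_eq_true] at h
    have h' := h.resolve_left (hprune d S hS)
    simp only [Bool.and_eq_true] at h'
    obtain ⟨⟨h0, h1⟩, h2⟩ := h'
    obtain ⟨v, d, rfl⟩ : ∃ v d', d = v :: d' := by
      cases d with
      | nil => simp at hd
      | cons v d => exact ⟨v, d, rfl⟩
    have hv : v ≤ 2 := hd2 v (by simp)
    rw [count_cons v d S (by norm_num), count_cons v d S le_rfl] at hS
    have key : isComplete n sols m (v :: acc) (S.filterMap (step v)) = true := by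
      interval_cases v <;> assumption
    have := ih key (by simpa using hd) (fun v hv => hd2 v (by simp [hv])) hS
    simpa using this

end DiagramSearch

theorem Nat.card_subtype_fin (p : ℕ → Prop) [DecidablePred p] (N : ℕ) :
    Nat.card {k : Fin N // p k} = Nat.count p N := by
  rw [Nat.count_eq_card_filter_range, Nat.card_eq_fintype_card, Fintype.card_subtype,
    ← Finset.card_map Fin.valEmbedding]
  congr 1
  ext k
  simpa [Fin.exists_iff] using and_comm

namespace RootTable
variable {n : ℕ} (T : RootTable n)

/-- The digits of a code. -/
def natDigits (w : ℕ) : List ℕ :=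
  [w / 10000000, w / 1000000 % 10, w / 100000 % 10, w / 10000 % 10, w / 1000 % 10, w / 100 % 10,
    w / 10 % 10, w % 10]

/-- The initial state of the enumeration of diagrams. -/
def searchState : List (ℕ × List ℕ) :=
  (List.range T.numPos).map fun i => (0, natDigits (T.root i).1)

variable {T}

theorem degree_pos (d : List ℕ) {i : ℕ} (hi : i < T.numPos) :
    T.degree d (n + i) = natDot d (natDigits (T.root i).1) := by
  have h1 : Nat.blt (n + i) n = false := by rw [← Bool.not_eq_true, Nat.blt_eq]; omega
  have h2 : Nat.blt (n + i) (n + T.numPos) = true := Nat.blt_eq ▸ (by omega)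
  rw [degree, wt, h1, h2, cond_false, cond_true, Nat.add_sub_cancel_left, ← listDot_map_natCast]
  rfl

theorem degree_neg (d : List ℕ) (i : ℕ) :
    T.degree d (n + T.numPos + i) = -natDot d (natDigits (T.root i).1) := by
  have h1 : Nat.blt (n + T.numPos + i) n = false := by rw [← Bool.not_eq_true, Nat.blt_eq]; omega
  have h2 : Nat.blt (n + T.numPos + i) (n + T.numPos) = false := by
    rw [← Bool.not_eq_true, Nat.blt_eq]; omega
  rw [degree, wt, h1, h2, cond_false, cond_false, listDot_map_neg, Nat.sub_sub,
    Nat.add_sub_cancel_left, ← listDot_map_natCast]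
  rfl

theorem degree_of_lt (d : List ℕ) {k : ℕ} (hk : k < n) : T.degree d k = 0 := by
  have h1 : Nat.blt k n = true := Nat.blt_eq ▸ hk
  rw [degree, wt, h1, cond_true]
  cases d <;> rfl

theorem count_searchState (d : List ℕ) (j : ℕ) :
    DiagramSearch.count d T.searchState j =
      Nat.count (fun i => natDot d (natDigits (T.root i).1) = j) T.numPos := by
  rw [DiagramSearch.count, searchState, List.countP_map, Nat.count]
  congr 1
  funext i
  rw [Function.comp_apply, zero_add, Bool.eq_iff_iff, Nat.beq_eq, decide_eq_true_eq]

theorem count_degree_eq_zero (d : List ℕ) : Nat.count (fun k => T.degree d k = 0) T.dim =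
    2 * DiagramSearch.count d T.searchState 0 + n := by
  have h1 : Nat.count (fun k => T.degree d k = 0) n = n :=
    Nat.count_iff_forall.2 fun _ hk => degree_of_lt d hk
  have h2 : Nat.count (fun i => T.degree d (n + i) = 0) T.numPos =
      DiagramSearch.count d T.searchState 0 := by
    rw [count_searchState, Nat.count_eq_card_filter_range, Nat.count_eq_card_filter_range]
    congr 1
    refine Finset.filter_congr fun i hi => ?_
    rw [degree_pos d (Finset.mem_range.1 hi)]
    exact Int.natCast_eq_zero
  have h3 : Nat.count (fun i => T.degree d (n + T.numPos + i) = 0) T.numPos =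
      DiagramSearch.count d T.searchState 0 := by
    rw [count_searchState]
    congr 1
    funext i
    rw [degree_neg, neg_eq_zero, Int.natCast_eq_zero]
  rw [dim, two_mul, ← add_assoc, Nat.count_add, Nat.count_add, h1, h2, h3]
  omega

theorem count_degree_eq_two (d : List ℕ) : Nat.count (fun k => T.degree d k = 2) T.dim =
    DiagramSearch.count d T.searchState 2 := by
  have h1 : Nat.count (fun k => T.degree d k = 2) n = 0 := by
    rw [Nat.count_iff_forall_not]
    intro k hk
    rw [degree_of_lt d hk]
    norm_num
  have h2 : Nat.count (fun i => T.degree d (n + i) = 2) T.numPos =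
      DiagramSearch.count d T.searchState 2 := by
    rw [count_searchState, Nat.count_eq_card_filter_range, Nat.count_eq_card_filter_range]
    congr 1
    refine Finset.filter_congr fun i hi => ?_
    rw [degree_pos d (Finset.mem_range.1 hi)]
    norm_cast
  have h3 : Nat.count (fun i => T.degree d (n + T.numPos + i) = 2) T.numPos = 0 := by
    rw [Nat.count_iff_forall_not]
    intro k hk
    rw [degree_neg]
    omega
  rw [dim, two_mul, ← add_assoc, Nat.count_add, Nat.count_add, h1, h2, h3]
  omega

/-- If a list of certificates contains all the relevant weighted Dynkin diagrams, then property (P)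
holds for all distinguished elements. -/
theorem propertyP_of_certificates {L : Type*} [LieRing L] [LieAlgebra ℂ L] [FiniteDimensional ℂ L]
    [LieAlgebra.IsSimple ℂ L] (hB : T.IsBasis) (h0 : 0 < T.dim) (hT : T.IsRoots)
    {l : List Certificate} (hl : ∀ C ∈ l, T.IsCertificate C)
    (hcomplete : DiagramSearch.isComplete n (l.map Certificate.diagram) n [] T.searchState = true)
    (φ : L ≃ₗ⁅ℂ⁆ T.cartan.ToLieAlgebra ℂ) {e h f : L} (ht : IsSl2Triple h e f)
    (hdist : IsDistinguished L e) : PropertyP L e h f := by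
  obtain ⟨B, hdim, hbr⟩ := RootTable.exists_intBasis hB h0 φ
  have := LieAlgebra.HasTrivialRadical.instIsKilling ℂ L
  refine (rootBasis hT B hdim hbr).propertyP_of_distinguished (fun d hd hcard => ?_) ht hdist
  have hgetD (i : Fin n) : (List.ofFn d).getD i 0 = d i := by simp
  have hdeg (k : Fin B.dim) : (rootBasis hT B hdim hbr).deg d k = T.degree (List.ofFn d) k := by
    rw [← deg_rootBasis hT B hdim hbr (d := List.ofFn d) (List.length_ofFn)]
    simp only [hgetD]
  simp only [hdeg] at hcard
  rw [Nat.card_subtype_fin (fun k => T.degree (List.ofFn d) k = 0),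
    Nat.card_subtype_fin (fun k => T.degree (List.ofFn d) k = 2), hdim, count_degree_eq_zero,
    count_degree_eq_two] at hcard
  have hmem := DiagramSearch.mem_of_isComplete hcomplete (d := List.ofFn d) (List.length_ofFn)
    (by simpa [List.mem_ofFn] using hd) hcard.le
  rw [List.reverse_nil, List.nil_append, List.mem_map] at hmem
  obtain ⟨C, hC, hCd⟩ := hmem
  have := (hl C hC).exists_triple hT B hdim hbr
  rw [hCd] at this
  simpa only [hgetD] using this

end RootTable

theorem tableE6_isBasis : tableE6.IsBasis := by
  refine ⟨⟨?_, ?_, ?_, ?_, ?_, ?_⟩, ?_, ?_, ?_, ?_⟩ <;> decide +kernel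

theorem tableE6_isRoots : tableE6.IsRoots := by
  constructor <;> decide +kernel

theorem certificatesE6_isCertificate : ∀ C ∈ certificatesE6, tableE6.IsCertificate C := by
  decide +kernel

theorem certificatesE6_isComplete : DiagramSearch.isComplete 6
    (certificatesE6.map Certificate.diagram) 6 [] tableE6.searchState = true := by
  decide +kernel

theorem tableE7_isBasis : tableE7.IsBasis := by
  refine ⟨⟨?_, ?_, ?_, ?_, ?_, ?_⟩, ?_, ?_, ?_, ?_⟩ <;> decide +kernel

theorem tableE7_isRoots : tableE7.IsRoots := by
  constructor <;> decide +kernel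

theorem certificatesE7_isCertificate : ∀ C ∈ certificatesE7, tableE7.IsCertificate C := by
  decide +kernel

theorem certificatesE7_isComplete : DiagramSearch.isComplete 7
    (certificatesE7.map Certificate.diagram) 7 [] tableE7.searchState = true := by
  decide +kernel

theorem tableE8_isBasis : tableE8.IsBasis := by
  refine ⟨⟨?_, ?_, ?_, ?_, ?_, ?_⟩, ?_, ?_, ?_, ?_⟩ <;> decide +kernel

theorem tableE8_isRoots : tableE8.IsRoots := by
  constructor <;> decide +kernel

theorem certificatesE8_take_isCertificate :
    ∀ C ∈ certificatesE8.take 4, tableE8.IsCertificate C := by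
  decide +kernel

theorem certificatesE8_take_drop_isCertificate :
    ∀ C ∈ (certificatesE8.drop 4).take 4, tableE8.IsCertificate C := by
  decide +kernel

theorem certificatesE8_drop_drop_isCertificate :
    ∀ C ∈ (certificatesE8.drop 4).drop 4, tableE8.IsCertificate C := by
  decide +kernel

theorem certificatesE8_isCertificate : ∀ C ∈ certificatesE8, tableE8.IsCertificate C := by
  rw [← List.take_append_drop 4 certificatesE8, ← List.take_append_drop 4 (certificatesE8.drop 4)]
  exact List.forall_mem_append.2 ⟨certificatesE8_take_isCertificate, List.forall_mem_append.2
    ⟨certificatesE8_take_drop_isCertificate, certificatesE8_drop_drop_isCertificate⟩⟩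

theorem certificatesE8_isComplete : DiagramSearch.isComplete 8
    (certificatesE8.map Certificate.diagram) 8 [] tableE8.searchState = true := by
  decide +kernel

theorem tableF4_isBasis : tableF4.IsBasis := by
  refine ⟨⟨?_, ?_, ?_, ?_, ?_, ?_⟩, ?_, ?_, ?_, ?_⟩ <;> decide +kernel

theorem tableF4_isRoots : tableF4.IsRoots := by
  constructor <;> decide +kernel

theorem certificatesF4_isCertificate : ∀ C ∈ certificatesF4, tableF4.IsCertificate C := by
  decide +kernel

theorem certificatesF4_isComplete : DiagramSearch.isComplete 4
    (certificatesF4.map Certificate.diagram) 4 [] tableF4.searchState = true := by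
  decide +kernel

theorem tableG2_isBasis : tableG2.IsBasis := by
  refine ⟨⟨?_, ?_, ?_, ?_, ?_, ?_⟩, ?_, ?_, ?_, ?_⟩ <;> decide +kernel

theorem tableG2_isRoots : tableG2.IsRoots := by
  constructor <;> decide +kernel

theorem certificatesG2_isCertificate : ∀ C ∈ certificatesG2, tableG2.IsCertificate C := by
  decide +kernel

theorem certificatesG2_isComplete : DiagramSearch.isComplete 2
    (certificatesG2.map Certificate.diagram) 2 [] tableG2.searchState = true := by
  decide +kernel

/-- Distinguished non-regular nilpotent elements of the exceptional simple
complex Lie algebras `E₆`, `E₇`, `E₈`, `F₄`, `G₂` satisfy property (P). -/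
theorem propertyP_of_exceptional
    (L : Type*) [LieRing L] [LieAlgebra ℂ L] [FiniteDimensional ℂ L]
    [LieAlgebra.IsSimple ℂ L]
    (hexc : Nonempty (L ≃ₗ⁅ℂ⁆ LieAlgebra.e₆ ℂ) ∨ Nonempty (L ≃ₗ⁅ℂ⁆ LieAlgebra.e₇ ℂ) ∨
      Nonempty (L ≃ₗ⁅ℂ⁆ LieAlgebra.e₈ ℂ) ∨ Nonempty (L ≃ₗ⁅ℂ⁆ LieAlgebra.f₄ ℂ) ∨
      Nonempty (L ≃ₗ⁅ℂ⁆ LieAlgebra.g₂ ℂ))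
    (e h f : L) (ht : IsSl2Triple h e f) (he : IsNilpotent (LieAlgebra.ad ℂ L e))
    (hdist : IsDistinguished L e)
    (hnonreg : Module.finrank ℂ ↥(centralizer L e) ≠ LieAlgebra.rank ℂ L) :
    PropertyP L e h f := by
  rcases hexc with ⟨⟨φ⟩⟩ | ⟨⟨φ⟩⟩ | ⟨⟨φ⟩⟩ | ⟨⟨φ⟩⟩ | ⟨⟨φ⟩⟩
  · exact RootTable.propertyP_of_certificates tableE6_isBasis (by decide) tableE6_isRoots
      certificatesE6_isCertificate certificatesE6_isComplete φ ht hdist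
  · exact RootTable.propertyP_of_certificates tableE7_isBasis (by decide) tableE7_isRoots
      certificatesE7_isCertificate certificatesE7_isComplete φ ht hdist
  · exact RootTable.propertyP_of_certificates tableE8_isBasis (by decide) tableE8_isRoots
      certificatesE8_isCertificate certificatesE8_isComplete φ ht hdist
  · exact RootTable.propertyP_of_certificates tableF4_isBasis (by decide) tableF4_isRoots
      certificatesF4_isCertificate certificatesF4_isComplete φ ht hdist
  · exact RootTable.propertyP_of_certificates tableG2_isBasis (by decide) tableG2_isRoots
      certificatesG2_isCertificate certificatesG2_isComplete φ ht hdist
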